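/- Let q be a power of an odd prime, F_q a finite field with q elements, m ≥ 1, and let J ∈ M_{2m}(F_q) be an invertible symmetric matrix. Set ε = 1 if J is split and ε = −1 if J is nonsplit. Let H = O(J) and let S be a complete set of irreducible complex representations of H. Then Σ_{σ ∈ S} dim σ = Σ_{k=0}^{m} q^{2k(m−k)} · binom(m,k)_{q²} + q^{m−1}(q^m − ε) · Σ_{k=0}^{m−1} q^{2k(m−k−1)} · binom(m−1,k)_{q²} (as real numbers). -/

import Mathlib

open Matrix CategoryTheory
open scoped Classical

noncomputable section

/-- The Frobenius–Schur indicator of a complex-valued function on a finite group. -/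
def fsIndicator (G : Type*) [Group G] [Fintype G] (χ : G → ℂ) : ℂ :=
  (Fintype.card G : ℂ)⁻¹ * ∑ g : G, χ (g * g)

/-- The twisted Frobenius–Schur indicator of a complex-valued function on a finite group,
with respect to a map `σ`. -/
def twistedFSIndicator (G : Type*) [Group G] [Fintype G] (σ : G → G) (χ : G → ℂ) : ℂ :=
  (Fintype.card G : ℂ)⁻¹ * ∑ g : G, χ (g * σ g)

/-- A complex-valued function is real-valued if all its values are real. -/
def IsRealValued {G : Type*} (χ : G → ℂ) : Prop := ∀ g : G, ∃ r : ℝ, χ g = (r : ℂ)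

/-- The Gaussian binomial coefficient `binom(m,k)_q` as a real number. -/
def gbinom (m k : ℕ) (q : ℝ) : ℝ := ∏ i ∈ Finset.Icc 1 k, (q ^ (m - k + i) - 1) / (q ^ i - 1)

section Groups

variable {N F : Type*} [Fintype N] [DecidableEq N] [Field F]

theorem sim_one (J : Matrix N N F) :
    ((1 : GL N F) : Matrix N N F)ᵀ * J * ((1 : GL N F) : Matrix N N F) = ((1 : Fˣ) : F) • J := by
  simp

theorem sim_mul {J : Matrix N N F} (a b : GL N F) (c d : Fˣ)
    (hc : (a : Matrix N N F)ᵀ * J * (a : Matrix N N F) = (c : F) • J)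
    (hd : (b : Matrix N N F)ᵀ * J * (b : Matrix N N F) = (d : F) • J) :
    ((a * b : GL N F) : Matrix N N F)ᵀ * J * ((a * b : GL N F) : Matrix N N F)
      = ((c * d : Fˣ) : F) • J := by
  calc ((a * b : GL N F) : Matrix N N F)ᵀ * J * ((a * b : GL N F) : Matrix N N F)
      = (b : Matrix N N F)ᵀ * ((a : Matrix N N F)ᵀ * J * (a : Matrix N N F)) *
          (b : Matrix N N F) := by
        rw [show ((a * b : GL N F) : Matrix N N F) = (a : Matrix N N F) * b from rfl,
          transpose_mul]
        simp only [Matrix.mul_assoc]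
    _ = (b : Matrix N N F)ᵀ * ((c : F) • J) * (b : Matrix N N F) := by rw [hc]
    _ = (c : F) • ((b : Matrix N N F)ᵀ * J * (b : Matrix N N F)) := by
        rw [Matrix.mul_smul, Matrix.smul_mul]
    _ = (c : F) • ((d : F) • J) := by rw [hd]
    _ = ((c * d : Fˣ) : F) • J := by rw [smul_smul, Units.val_mul]

theorem sim_inv {J : Matrix N N F} (a : GL N F) (c : Fˣ)
    (hc : (a : Matrix N N F)ᵀ * J * (a : Matrix N N F) = (c : F) • J) :
    ((a⁻¹ : GL N F) : Matrix N N F)ᵀ * J * ((a⁻¹ : GL N F) : Matrix N N F)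
      = ((c⁻¹ : Fˣ) : F) • J := by
  have ht : ((a⁻¹ : GL N F) : Matrix N N F)ᵀ * (a : Matrix N N F)ᵀ = 1 := by
    rw [← transpose_mul, a.mul_inv, transpose_one]
  have key : ((a⁻¹ : GL N F) : Matrix N N F)ᵀ * ((a : Matrix N N F)ᵀ * J * (a : Matrix N N F)) *
      ((a⁻¹ : GL N F) : Matrix N N F) = J := by
    calc ((a⁻¹ : GL N F) : Matrix N N F)ᵀ * ((a : Matrix N N F)ᵀ * J * (a : Matrix N N F)) *
        ((a⁻¹ : GL N F) : Matrix N N F)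
        = (((a⁻¹ : GL N F) : Matrix N N F)ᵀ * (a : Matrix N N F)ᵀ) * J *
          ((a : Matrix N N F) * ((a⁻¹ : GL N F) : Matrix N N F)) := by
          simp only [Matrix.mul_assoc]
      _ = J := by rw [ht, a.mul_inv, Matrix.one_mul, Matrix.mul_one]
  have key2 : ((a⁻¹ : GL N F) : Matrix N N F)ᵀ * ((c : F) • J) * ((a⁻¹ : GL N F) : Matrix N N F)
      = (c : F) • (((a⁻¹ : GL N F) : Matrix N N F)ᵀ * J * ((a⁻¹ : GL N F) : Matrix N N F)) := by
    rw [Matrix.mul_smul, Matrix.smul_mul]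
  have h3 : (c : F) • (((a⁻¹ : GL N F) : Matrix N N F)ᵀ * J *
      ((a⁻¹ : GL N F) : Matrix N N F)) = J := by rw [← key2, ← hc, key]
  calc ((a⁻¹ : GL N F) : Matrix N N F)ᵀ * J * ((a⁻¹ : GL N F) : Matrix N N F)
      = ((c⁻¹ : Fˣ) : F) • ((c : F) • (((a⁻¹ : GL N F) : Matrix N N F)ᵀ * J *
          ((a⁻¹ : GL N F) : Matrix N N F))) := by
        rw [smul_smul, ← Units.val_mul, inv_mul_cancel, Units.val_one, one_smul]
    _ = ((c⁻¹ : Fˣ) : F) • J := by rw [h3]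

/-- The similitude group of the bilinear form given by the matrix `J`:  all invertible
matrices `g` with `gᵀ * J * g = c • J` for some nonzero scalar `c` (the similitude of `g`). -/
def similitudeGroup (J : Matrix N N F) : Subgroup (GL N F) where
  carrier := {g | ∃ c : Fˣ, (g : Matrix N N F)ᵀ * J * (g : Matrix N N F) = (c : F) • J}
  one_mem' := ⟨1, sim_one J⟩
  mul_mem' := by rintro a b ⟨c, hc⟩ ⟨d, hd⟩; exact ⟨c * d, sim_mul a b c d hc hd⟩
  inv_mem' := by rintro a ⟨c, hc⟩; exact ⟨c⁻¹, sim_inv a c hc⟩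

/-- The isometry group of the bilinear form given by the matrix `J`:  all invertible
matrices `g` with `gᵀ * J * g = J`. -/
def fixGroup (J : Matrix N N F) : Subgroup (GL N F) where
  carrier := {g | (g : Matrix N N F)ᵀ * J * (g : Matrix N N F) = J}
  one_mem' := by simp
  mul_mem' := by
    intro a b ha hb
    have := sim_mul (J := J) a b 1 1 (by simpa using ha) (by simpa using hb)
    simpa using this
  inv_mem' := by
    intro a ha
    have := sim_inv (J := J) a 1 (by simpa using ha)
    simpa using this

/-- The group of isometries of determinant one of the bilinear form given by the matrix `J`. -/
def specialFixGroup (J : Matrix N N F) : Subgroup (GL N F) where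
  carrier := {g | (g : Matrix N N F)ᵀ * J * (g : Matrix N N F) = J ∧
    ((g : Matrix N N F)).det = 1}
  one_mem' := ⟨by simp, by simp⟩
  mul_mem' := by
    rintro a b ⟨ha1, ha2⟩ ⟨hb1, hb2⟩
    refine ⟨(fixGroup J).mul_mem ha1 hb1, ?_⟩
    rw [show ((a * b : GL N F) : Matrix N N F) = (a : Matrix N N F) * b from rfl,
      Matrix.det_mul, ha2, hb2, one_mul]
  inv_mem' := by
    rintro a ⟨ha1, ha2⟩
    refine ⟨(fixGroup J).inv_mem ha1, ?_⟩
    have h := congrArg Matrix.det a.mul_inv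
    rw [Matrix.det_mul, ha2, one_mul, Matrix.det_one] at h
    exact h

/-- The connected component of the similitude group of the symmetric bilinear form on a
`2 * m`-dimensional space given by the matrix `J`:  all similitudes `g`, with similitude
character `μ`, such that `det g = μ(g) ^ m`. -/
def connSimilitudeGroup (J : Matrix N N F) (m : ℕ) : Subgroup (GL N F) where
  carrier := {g | ∃ c : Fˣ, (g : Matrix N N F)ᵀ * J * (g : Matrix N N F) = (c : F) • J ∧
    ((g : Matrix N N F)).det = (c : F) ^ m}
  one_mem' := ⟨1, sim_one J, by simp⟩
  mul_mem' := by
    rintro a b ⟨c, hc1, hc2⟩ ⟨d, hd1, hd2⟩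
    refine ⟨c * d, sim_mul a b c d hc1 hd1, ?_⟩
    rw [show ((a * b : GL N F) : Matrix N N F) = (a : Matrix N N F) * b from rfl,
      Matrix.det_mul, hc2, hd2, Units.val_mul, mul_pow]
  inv_mem' := by
    rintro a ⟨c, hc1, hc2⟩
    refine ⟨c⁻¹, sim_inv a c hc1, ?_⟩
    have h := congrArg Matrix.det a.mul_inv
    rw [Matrix.det_mul, hc2, Matrix.det_one] at h
    have hc : ((c : F) ^ m)⁻¹ = ((c⁻¹ : Fˣ) : F) ^ m := by
      rw [← inv_pow]
      norm_cast
    rw [← hc]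
    exact (inv_eq_of_mul_eq_one_right h).symm

theorem neg_one_mem_similitudeGroup (J : Matrix N N F) : (-1 : GL N F) ∈ similitudeGroup J := by
  refine ⟨1, ?_⟩
  have h : ((-1 : GL N F) : Matrix N N F) = -1 := by simp
  rw [h]
  simp

/-- The standard symplectic form matrix `[[0, I], [-I, 0]]`. -/
def Jsp (n : ℕ) (F : Type*) [Field F] : Matrix (Fin n ⊕ Fin n) (Fin n ⊕ Fin n) F :=
  Matrix.fromBlocks 0 1 (-1) 0

/-- The standard split symmetric form matrix `[[0, I], [I, 0]]`. -/
def Jsplit (n : ℕ) (F : Type*) [Field F] : Matrix (Fin n ⊕ Fin n) (Fin n ⊕ Fin n) F :=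
  Matrix.fromBlocks 0 1 1 0

/-- A symmetric matrix `J` of size `2n` is split if it is congruent to `[[0, I], [I, 0]]`. -/
def IsSplit {n : ℕ} (J : Matrix (Fin n ⊕ Fin n) (Fin n ⊕ Fin n) F) : Prop :=
  ∃ P : GL (Fin n ⊕ Fin n) F,
    (P : Matrix (Fin n ⊕ Fin n) (Fin n ⊕ Fin n) F)ᵀ * J * P = Jsplit n F

/-- The symplectic similitude group `GSp(2n, F)`. -/
def GSp (n : ℕ) (F : Type*) [Field F] : Subgroup (GL (Fin n ⊕ Fin n) F) :=
  similitudeGroup (Jsp n F)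

/-- The symplectic group `Sp(2n, F)`. -/
def Sp (n : ℕ) (F : Type*) [Field F] : Subgroup (GL (Fin n ⊕ Fin n) F) :=
  fixGroup (Jsp n F)


/-- The underlying matrix of an element of a matrix subgroup. -/
def matOf {S : Subgroup (GL N F)} (g : ↥S) : Matrix N N F := ((g : GL N F) : Matrix N N F)

end Groups

noncomputable instance subgroupFintype {G : Type*} [Group G] [Finite G] (S : Subgroup G) :
    Fintype S := Fintype.ofFinite _

/-- No irreducible complex representation of `G` carries a nonzero invariant alternating form. -/
def NoSymplectic (G : Type) [Group G] : Prop :=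
  ∀ (V : Type) [AddCommGroup V] [Module ℂ V] [FiniteDimensional ℂ V] (ρ : Representation ℂ G V),
    ρ.IsIrreducible → ∀ ω : LinearMap.BilinForm ℂ V, ω.IsAlt →
      (∀ g x y, ω (ρ g x) (ρ g y) = ω x y) → ω = 0

/-- Every element of `G` is conjugate to its inverse. -/
def IsRealGroup (G : Type) [Group G] : Prop := ∀ g : G, ∃ j : G, j * g * j⁻¹ = g⁻¹

section Rep
variable {G : Type} [Group G] {V : Type} [AddCommGroup V] [Module ℂ V]
  {ρ : Representation ℂ G V}

theorem Representation.IsIrreducible.eq_bot_or_eq_top_of_invariant (h : ρ.IsIrreducible)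
    (W : Submodule ℂ V) (hW : ∀ g, ∀ w ∈ W, ρ g w ∈ W) : W = ⊥ ∨ W = ⊤ := by
  rcases h.eq_bot_or_eq_top (⟨W, fun g w hw => hW g w hw⟩ : Subrepresentation ρ) with h | h
  · left; exact congrArg Subrepresentation.toSubmodule h
  · right; exact congrArg Subrepresentation.toSubmodule h

theorem Representation.IsIrreducible.nontrivial_space (h : ρ.IsIrreducible) : Nontrivial V := by
  by_contra hV
  rw [not_nontrivial_iff_subsingleton] at hV
  obtain ⟨a, b, hab⟩ := h.toNontrivial
  exact hab (Subrepresentation.toSubmodule_injective (Subsingleton.elim _ _))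

theorem Representation.isIrreducible_of_invariant [Nontrivial V]
    (h : ∀ W : Submodule ℂ V, (∀ g, ∀ w ∈ W, ρ g w ∈ W) → W = ⊥ ∨ W = ⊤) :
    ρ.IsIrreducible where
  exists_pair_ne := ⟨⊥, ⊤, fun e =>
    bot_ne_top (α := Submodule ℂ V) (congrArg Subrepresentation.toSubmodule e)⟩
  eq_bot_or_eq_top σ := by
    rcases h σ.toSubmodule (fun g w hw => σ.apply_mem_toSubmodule g hw) with h | h
    · left; exact Subrepresentation.toSubmodule_injective h
    · right; exact Subrepresentation.toSubmodule_injective h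

theorem exists_irreducible_sub [FiniteDimensional ℂ V] (W : Submodule ℂ V) (hW0 : W ≠ ⊥)
    (hW : ∀ g, ∀ w ∈ W, ρ g w ∈ W) :
    ∃ σ : Subrepresentation ρ, σ.toSubmodule ≤ W ∧ σ.toSubmodule ≠ ⊥ ∧
      σ.toRepresentation.IsIrreducible := by
  induction hn : Module.finrank ℂ W using Nat.strong_induction_on generalizing W with
  | _ n ih =>
  by_cases hirr : ∃ U : Submodule ℂ V, U ≤ W ∧ U ≠ ⊥ ∧ U ≠ W ∧ ∀ g, ∀ w ∈ U, ρ g w ∈ U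
  · obtain ⟨U, hUW, hU0, hUne, hU⟩ := hirr
    have := Submodule.finrank_lt_finrank_of_lt (lt_of_le_of_ne hUW hUne)
    obtain ⟨σ, h1, h2⟩ := ih _ (hn ▸ this) U hU0 hU rfl
    exact ⟨σ, h1.trans hUW, h2⟩
  · push Not at hirr
    refine ⟨⟨W, fun g w hw => hW g w hw⟩, le_rfl, hW0, ?_⟩
    have : Nontrivial W := Submodule.nontrivial_iff_ne_bot.mpr hW0
    refine Representation.isIrreducible_of_invariant fun U hU => ?_
    by_contra hne
    push Not at hne
    obtain ⟨g, w, hw, hgw⟩ := hirr (U.map W.subtype) (Submodule.map_subtype_le W U)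
      (fun h => hne.1 (Submodule.map_injective_of_injective W.subtype_injective (by
        rw [h, Submodule.map_bot])))
      (fun h => hne.2 (Submodule.map_injective_of_injective W.subtype_injective (by
        rw [h, Submodule.map_subtype_top])))
    obtain ⟨u, hu, rfl⟩ := hw
    exact hgw ⟨_, hU g u hu, rfl⟩

theorem exists_invariant_isCompl [Finite G] (W : Submodule ℂ V)
    (hW : ∀ g, ∀ w ∈ W, ρ g w ∈ W) :
    ∃ K : Submodule ℂ V, IsCompl W K ∧ ∀ g, ∀ w ∈ K, ρ g w ∈ K := by
  have : NeZero (Nat.card G : ℂ) := ⟨by exact_mod_cast Nat.card_pos.ne'⟩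
  obtain ⟨K, hK⟩ := exists_isCompl (⟨W, fun g w hw => hW g w hw⟩ : Subrepresentation ρ)
  refine ⟨K.toSubmodule, ?_, fun g w hw => K.apply_mem_toSubmodule g hw⟩
  constructor
  · rw [disjoint_iff]
    have := hK.inf_eq_bot
    exact congrArg Subrepresentation.toSubmodule this
  · rw [codisjoint_iff]
    exact congrArg Subrepresentation.toSubmodule hK.sup_eq_top

theorem trace_eq_add_of_isCompl [FiniteDimensional ℂ V] {U K : Submodule ℂ V} (h : IsCompl U K)
    (f : Module.End ℂ V) (hU : ∀ u ∈ U, f u ∈ U) (hK : ∀ u ∈ K, f u ∈ K) :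
    LinearMap.trace ℂ V f =
      LinearMap.trace ℂ U (f.restrict hU) + LinearMap.trace ℂ K (f.restrict hK) := by
  rw [← LinearMap.trace_prodMap', ← LinearMap.trace_conj' _ (Submodule.prodEquivOfIsCompl U K h)]
  congr 1
  ext v
  obtain ⟨⟨u, k⟩, rfl⟩ := (Submodule.prodEquivOfIsCompl U K h).surjective v
  simp [LinearEquiv.conj_apply]

open scoped ComplexOrder in
theorem char_inv_eq_conj [Fintype G] [FiniteDimensional ℂ V] (g : G) :
    ρ.character g⁻¹ = (starRingEnd ℂ) (ρ.character g) := by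
  let b := Module.finBasis ℂ V
  let R : G → Matrix _ _ ℂ := fun g => LinearMap.toMatrix b b (ρ g)
  have hmul : ∀ x y, R (x * y) = R x * R y := fun x y => by
    simp only [R, map_mul]; exact LinearMap.toMatrix_mul b _ _
  have hone : R 1 = 1 := by simp only [R, map_one]; exact LinearMap.toMatrix_one b
  have htr : ∀ x, ρ.character x = (R x).trace := fun x => LinearMap.trace_eq_matrix_trace ℂ b _
  let H : Matrix _ _ ℂ := ∑ x, (R x)ᴴ * R x
  have hpos : H.PosDef := by
    have : H = (R 1)ᴴ * R 1 + ∑ x ∈ Finset.univ.erase 1, (R x)ᴴ * R x :=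
      (Finset.add_sum_erase _ _ (Finset.mem_univ _)).symm
    rw [this, hone]
    refine Matrix.PosDef.add_posSemidef (by simpa using Matrix.PosDef.one) ?_
    exact Matrix.posSemidef_sum _ fun x _ => Matrix.posSemidef_conjTranspose_mul_self _
  have hinv : (R g)ᴴ * H * R g = H := by
    simp only [H, Finset.mul_sum, Finset.sum_mul]
    refine Fintype.sum_equiv (Equiv.mulRight g) _ _ fun x => ?_
    simp [hmul, Matrix.conjTranspose_mul, Matrix.mul_assoc]
  have hu : IsUnit H.det := (Matrix.isUnit_iff_isUnit_det H).mp hpos.isUnit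
  have hgi : R g * R g⁻¹ = 1 := by rw [← hmul, mul_inv_cancel, hone]
  have key : (R g)ᴴ * H = H * R g⁻¹ := by
    calc (R g)ᴴ * H = ((R g)ᴴ * H * R g) * R g⁻¹ := by rw [Matrix.mul_assoc _ (R g), hgi, mul_one]
      _ = _ := by rw [hinv]
  rw [htr, htr, starRingEnd_apply, ← Matrix.trace_conjTranspose]
  have : (R g)ᴴ = H * R g⁻¹ * H⁻¹ := by
    rw [← key, Matrix.mul_assoc, Matrix.mul_nonsing_inv _ hu, mul_one]
  rw [this, Matrix.trace_mul_comm, ← Matrix.mul_assoc, Matrix.nonsing_inv_mul _ hu, one_mul]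

/-- Averages of traces of commuting finite-order twists are algebraic integers. -/
theorem isIntegral_trace_of_pow_eq [FiniteDimensional ℂ V] (A : Module.End ℂ V) (n : ℕ)
    (hn : 0 < n) (hA : A ^ (n + 1) = A) : IsIntegral ℤ (LinearMap.trace ℂ V A) := by
  rw [Module.End.trace_eq_sum_roots_charpoly_of_splits (IsAlgClosed.splits _)]
  refine IsIntegral.multiset_sum fun μ hμ => ?_
  have hev : A.HasEigenvalue μ := by
    rw [Module.End.hasEigenvalue_iff_isRoot_charpoly]
    exact Polynomial.isRoot_of_mem_roots hμ
  obtain ⟨v, hv⟩ := hev.exists_hasEigenvector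
  have h1 : (A ^ (n + 1)) v = μ ^ (n + 1) • v := hv.pow_apply _
  rw [hA, hv.apply_eq_smul] at h1
  have h2 : μ ^ (n + 1) - μ = 0 := by
    have := sub_eq_zero.mpr h1
    rw [← sub_smul] at this
    rcases smul_eq_zero.mp this with h | h
    · linear_combination -h
    · exact absurd h hv.2
  refine ⟨Polynomial.X ^ (n + 1) - Polynomial.X, ?_, by simpa using h2⟩
  refine Polynomial.monic_X_pow_sub ?_
  rw [Polynomial.degree_X]
  exact_mod_cast Nat.succ_lt_succ hn

end Rep

section Rep
variable {G : Type} [Group G] {V : Type} [AddCommGroup V] [Module ℂ V]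
  {ρ : Representation ℂ G V}

theorem Representation.IsIrreducible.form_separating (h : ρ.IsIrreducible)
    (ω : LinearMap.BilinForm ℂ V) (hω : ∀ g x y, ω (ρ g x) (ρ g y) = ω x y) (h0 : ω ≠ 0) (x : V)
    (hx : ∀ y, ω x y = 0) : x = 0 := by
  have := h.eq_bot_or_eq_top_of_invariant (LinearMap.ker ω) (fun g w hw => by
    rw [LinearMap.mem_ker] at hw ⊢
    ext y
    have := hω g w (ρ g⁻¹ y)
    rw [hw] at this
    simpa using this)
  rcases this with h | h
  · have : x ∈ LinearMap.ker ω := by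
      rw [LinearMap.mem_ker]; ext y; simpa using hx y
    rwa [h, Submodule.mem_bot] at this
  · exact absurd (LinearMap.ker_eq_top.mp h) h0

theorem sum_char_sq_eq_of_forms [Fintype G] [FiniteDimensional ℂ V] (c : ℂ)
    (hc : ∀ B : LinearMap.BilinForm ℂ V, (∀ g x y, B (ρ g x) (ρ g y) = B x y) →
      ∀ x y, B y x = c * B x y) :
    ∑ g, ρ.character (g * g) = c * ∑ g, ρ.character g ^ 2 := by
  let b := Module.finBasis ℂ V
  let P : Fin (Module.finrank ℂ V) → Fin (Module.finrank ℂ V) → LinearMap.BilinForm ℂ V :=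
    fun i j => ∑ g, (LinearMap.mul ℂ ℂ).compl₁₂ (b.coord i ∘ₗ ρ g) (b.coord j ∘ₗ ρ g)
  have hP : ∀ i j x y, P i j x y = ∑ g, b.coord i (ρ g x) * b.coord j (ρ g y) := by
    intro i j x y
    simp [P, LinearMap.sum_apply]
  have hinv : ∀ i j g x y, P i j (ρ g x) (ρ g y) = P i j x y := by
    intro i j g x y
    rw [hP, hP]
    refine Fintype.sum_equiv (Equiv.mulRight g) _ _ fun x => ?_
    simp [map_mul]
  have htr : ∀ f : Module.End ℂ V, LinearMap.trace ℂ V f = ∑ i, b.coord i (f (b i)) := by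
    intro f
    rw [LinearMap.trace_eq_matrix_trace ℂ b]
    simp [Matrix.trace, LinearMap.toMatrix_apply]
  have h1 : ∀ g, ρ.character (g * g) =
      ∑ i, ∑ j, b.coord i (ρ g (b j)) * b.coord j (ρ g (b i)) := by
    intro g
    rw [Representation.character, htr]
    refine Finset.sum_congr rfl fun i _ => ?_
    rw [map_mul, Module.End.mul_apply]
    calc b.coord i (ρ g (ρ g (b i)))
        = b.coord i (ρ g (∑ j, b.repr (ρ g (b i)) j • b j)) := by rw [b.sum_repr]
      _ = _ := by
        simp only [map_sum, map_smul, smul_eq_mul, Module.Basis.coord_apply]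
        exact Finset.sum_congr rfl fun j _ => mul_comm _ _
  have h2 : ∀ g, ρ.character g ^ 2 =
      ∑ i, ∑ j, b.coord i (ρ g (b i)) * b.coord j (ρ g (b j)) := by
    intro g
    rw [Representation.character, htr, sq, Finset.sum_mul_sum]
  simp_rw [h1, h2]
  rw [Finset.sum_comm, Finset.sum_comm (s := (Finset.univ : Finset G)), Finset.mul_sum]
  refine Finset.sum_congr rfl fun i _ => ?_
  rw [Finset.sum_comm, Finset.sum_comm (s := (Finset.univ : Finset G)), Finset.mul_sum]
  refine Finset.sum_congr rfl fun j _ => ?_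
  rw [← hP, ← hP]
  exact hc _ (hinv i j) _ _

theorem IsRealGroup.char_inv (hG : IsRealGroup G) [FiniteDimensional ℂ V] (g : G) :
    ρ.character g⁻¹ = ρ.character g := by
  obtain ⟨j, hj⟩ := hG g
  rw [← hj, ρ.char_conj]

theorem Representation.IsIrreducible.sum_char_mul_char_inv [Fintype G] [FiniteDimensional ℂ V]
    (h : ρ.IsIrreducible) :
    ∑ g, ρ.character g * ρ.character g⁻¹ = Nat.card G := by
  have hc : (Nat.card G : ℂ) ≠ 0 := by exact_mod_cast Nat.card_pos.ne'
  let _ : Invertible (Nat.card G : ℂ) := invertibleOfNonzero hc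
  have := Representation.card_inv_mul_sum_char_mul_char_eq_finrank ρ ρ
  rw [Representation.IsIrreducible.finrank_intertwiningMap_self] at this
  field_simp at this
  simpa using this

theorem Representation.IsIrreducible.sum_char_sq [Fintype G] [FiniteDimensional ℂ V]
    (h : ρ.IsIrreducible) (hG : IsRealGroup G) :
    ∑ g, ρ.character g ^ 2 = Nat.card G := by
  rw [← h.sum_char_mul_char_inv]
  refine Finset.sum_congr rfl fun g _ => ?_
  rw [hG.char_inv, sq]

theorem NoSymplectic.sum_char_sq [Fintype G] [FiniteDimensional ℂ V] (hN : NoSymplectic G)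
    (hG : IsRealGroup G) (h : ρ.IsIrreducible) :
    ∑ g, ρ.character (g * g) = Nat.card G := by
  rw [sum_char_sq_eq_of_forms 1, h.sum_char_sq hG, one_mul]
  intro B hB x y
  have := hN V ρ h (B - LinearMap.flip B) (fun x => by simp) (fun g x y => by simp [hB])
  have := LinearMap.congr_fun (LinearMap.congr_fun this y) x
  simp only [LinearMap.sub_apply, LinearMap.flip_apply, LinearMap.zero_apply] at this
  rw [one_mul]; exact sub_eq_zero.mp this

theorem form_eq_smul_of_irreducible [FiniteDimensional ℂ V] (h : ρ.IsIrreducible)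
    (ω B : LinearMap.BilinForm ℂ V)
    (hω : ∀ g x y, ω (ρ g x) (ρ g y) = ω x y) (h0 : ω ≠ 0)
    (hB : ∀ g x y, B (ρ g x) (ρ g y) = B x y) : ∃ c : ℂ, B = c • ω := by
  have hinj : Function.Injective ω := by
    rw [← LinearMap.ker_eq_bot, LinearMap.ker_eq_bot']
    intro x hx
    exact h.form_separating ω hω h0 x (fun y => by rw [hx]; rfl)
  let e : V ≃ₗ[ℂ] Module.Dual ℂ V :=
    LinearMap.linearEquivOfInjective ω hinj Subspace.dual_finrank_eq.symm
  have he : ∀ x, e x = ω x := fun x => rfl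
  have := h.nontrivial_space
  obtain ⟨c, hc⟩ := Module.End.exists_eigenvalue (e.symm.toLinearMap ∘ₗ B : Module.End ℂ V)
  obtain ⟨v, hv⟩ := hc.exists_hasEigenvector
  refine ⟨c, ?_⟩
  have h1 : B v = c • ω v := by
    have := hv.apply_eq_smul
    simp only [LinearMap.comp_apply, LinearEquiv.coe_coe] at this
    rw [LinearEquiv.symm_apply_eq] at this
    rw [this, map_smul, he]
  by_contra hne
  have := h.form_separating (B - c • ω) (fun g x y => by simp [hB, hω]) (sub_ne_zero.mpr hne) v
    (fun y => by simp [h1])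
  exact hv.2 this

theorem sum_char_sq_of_symplectic [Fintype G] [FiniteDimensional ℂ V]
    (hG : IsRealGroup G) (h : ρ.IsIrreducible)
    (ω : LinearMap.BilinForm ℂ V) (ha : ω.IsAlt)
    (hω : ∀ g x y, ω (ρ g x) (ρ g y) = ω x y) (h0 : ω ≠ 0) :
    ∑ g, ρ.character (g * g) = -Nat.card G := by
  rw [sum_char_sq_eq_of_forms (-1), h.sum_char_sq hG, neg_one_mul]
  intro B hB x y
  obtain ⟨c, rfl⟩ := form_eq_smul_of_irreducible h ω B hω h0 hB
  simp [← ha.neg_eq x y]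

/-- If `V` carries an invariant symplectic form and `G` has no symplectic irreducible
representations then the character of `V` is `α + ᾱ`. -/
theorem exists_lagrangian [Finite G] [FiniteDimensional ℂ V] (hN : NoSymplectic G)
    (ω : LinearMap.BilinForm ℂ V) (ha : ω.IsAlt)
    (hω : ∀ g x y, ω (ρ g x) (ρ g y) = ω x y) (hnd : ∀ x, (∀ y, ω x y = 0) → x = 0) :
    ∃ U : Subrepresentation ρ, (Nontrivial V → Nontrivial U.toSubmodule) ∧
      ∀ g, ρ.character g = U.toRepresentation.character g + U.toRepresentation.character g⁻¹ := by
  -- a maximal isotropic subrepresentation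
  let iso : Submodule ℂ V → Prop := fun U =>
    (∀ g, ∀ u ∈ U, ρ g u ∈ U) ∧ ∀ x ∈ U, ∀ y ∈ U, ω x y = 0
  obtain ⟨U, hU, hmax⟩ : ∃ U, iso U ∧ ∀ U', iso U' → Module.finrank ℂ U' ≤ Module.finrank ℂ U := by
    have hne : ∃ n, ∃ U, iso U ∧ Module.finrank ℂ U = n :=
      ⟨_, ⊥, ⟨fun g u hu => by simp_all, fun x hx y hy => by simp_all⟩, rfl⟩
    have hbd : ∀ n, (∃ U, iso U ∧ Module.finrank ℂ U = n) → n ≤ Module.finrank ℂ V := by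
      rintro n ⟨U, -, rfl⟩; exact Submodule.finrank_le U
    obtain ⟨U, hU, h⟩ := Nat.findGreatest_spec (P := fun n => ∃ U, iso U ∧ Module.finrank ℂ U = n)
      (hbd _ hne.choose_spec) hne.choose_spec
    refine ⟨U, hU, fun U' hU' => ?_⟩
    rw [h]
    exact Nat.le_findGreatest (hbd _ ⟨U', hU', rfl⟩) ⟨U', hU', rfl⟩
  obtain ⟨hUinv, hUiso⟩ := hU
  obtain ⟨K, hK, hKinv⟩ := exists_invariant_isCompl U hUinv
  let pair : K →ₗ[ℂ] Module.Dual ℂ U := (ω.domRestrict₁₂ K U)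
  have hpair : ∀ k u, pair k u = ω k u := fun k u => rfl
  have hskew : ∀ x y, ω y x = - ω x y := fun x y => (ha.neg_eq x y).symm
  have hinj : Function.Injective pair := by
    rw [← LinearMap.ker_eq_bot]
    by_contra hker
    let L : Submodule ℂ V := (LinearMap.ker pair).map K.subtype
    have hL : ∀ x ∈ L, x ∈ K ∧ ∀ u ∈ U, ω x u = 0 := by
      rintro _ ⟨k, hk, rfl⟩
      refine ⟨k.2, fun u hu => ?_⟩
      have := LinearMap.congr_fun (LinearMap.mem_ker.mp hk) ⟨u, hu⟩
      simpa [hpair] using this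
    have hL' : ∀ x ∈ K, (∀ u ∈ U, ω x u = 0) → x ∈ L := by
      intro x hx h
      refine ⟨⟨x, hx⟩, ?_, rfl⟩
      rw [SetLike.mem_coe, LinearMap.mem_ker]
      ext u
      exact h u u.2
    have hL0 : L ≠ ⊥ := fun h => hker (Submodule.map_injective_of_injective K.subtype_injective (by
      rw [Submodule.map_bot]; exact h))
    obtain ⟨σ, hσL, hσ0, hσ⟩ := exists_irreducible_sub (ρ := ρ) L hL0 (fun g x hx => by
      obtain ⟨h1, h2⟩ := hL x hx
      refine hL' _ (hKinv g x h1) fun u hu => ?_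
      have := hω g x (ρ g⁻¹ u)
      rw [h2 _ (hUinv _ _ hu)] at this
      simpa using this)
    have hσω := hN _ σ.toRepresentation hσ (ω.domRestrict₁₂ σ.toSubmodule σ.toSubmodule)
      (fun x => ha.self_eq_zero x.1) (fun g x y => hω g x.1 y.1)
    have hσiso : ∀ x ∈ σ.toSubmodule, ∀ y ∈ σ.toSubmodule, ω x y = 0 := fun x hx y hy =>
      LinearMap.congr_fun (LinearMap.congr_fun hσω ⟨x, hx⟩) ⟨y, hy⟩
    have hbig : iso (U ⊔ σ.toSubmodule) := by
      constructor
      · intro g x hx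
        obtain ⟨u, hu, s, hs, rfl⟩ := Submodule.mem_sup.mp hx
        rw [map_add]
        exact Submodule.add_mem_sup (hUinv g u hu) (σ.apply_mem_toSubmodule g hs)
      · intro x hx y hy
        obtain ⟨u, hu, s, hs, rfl⟩ := Submodule.mem_sup.mp hx
        obtain ⟨u', hu', s', hs', rfl⟩ := Submodule.mem_sup.mp hy
        have e1 := (hL _ (hσL hs)).2 u' hu'
        have e2 := (hL _ (hσL hs')).2 u hu
        have e3 := hskew s' u
        simp [hUiso u hu u' hu', hσiso s hs s' hs', e1, e3, e2]
    have hle := hmax _ hbig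
    have : U = U ⊔ σ.toSubmodule := Submodule.eq_of_le_of_finrank_le le_sup_left hle
    apply hσ0
    rw [eq_bot_iff, ← hK.inf_eq_bot]
    exact le_inf (this ▸ le_sup_right) (fun x hx => (hL x (hσL hx)).1)
  have hinj2 : Function.Injective (pair.flip : U →ₗ[ℂ] Module.Dual ℂ K) := by
    rw [← LinearMap.ker_eq_bot, LinearMap.ker_eq_bot']
    intro u hu
    have : (u : V) = 0 := by
      apply hnd
      intro y
      obtain ⟨a, ha', k, hk, rfl⟩ := Submodule.mem_sup.mp (hK.sup_eq_top ▸ Submodule.mem_top :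
        y ∈ U ⊔ K)
      have := LinearMap.congr_fun hu ⟨k, hk⟩
      rw [LinearMap.flip_apply, hpair] at this
      rw [map_add, hUiso u u.2 a ha', hskew k u]
      simpa using this
    exact_mod_cast this
  have hdim : Module.finrank ℂ K = Module.finrank ℂ (Module.Dual ℂ U) := by
    refine le_antisymm (LinearMap.finrank_le_finrank_of_injective hinj) ?_
    have := LinearMap.finrank_le_finrank_of_injective hinj2
    rw [Subspace.dual_finrank_eq] at this ⊢
    exact this
  let e := LinearMap.linearEquivOfInjective pair hinj hdim
  refine ⟨⟨U, fun g u hu => hUinv g u hu⟩, fun hV => ?_, fun g => ?_⟩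
  · by_contra hU0
    rw [not_nontrivial_iff_subsingleton] at hU0
    have h0 : Module.finrank ℂ U = 0 := Module.finrank_zero_of_subsingleton
    have h1 := Submodule.finrank_add_eq_of_isCompl hK
    rw [hdim, Subspace.dual_finrank_eq, h0] at h1
    exact (Module.finrank_pos (R := ℂ) (M := V)).ne h1
  · rw [Representation.character, trace_eq_add_of_isCompl hK (ρ g) (hUinv g) (hKinv g)]
    congr 1
    rw [← Representation.char_dual, Representation.character, ← LinearMap.trace_conj' _ e]
    congr 1
    ext f u
    obtain ⟨k, rfl⟩ := e.surjective f
    have he : ∀ k u, e k u = ω k u := fun k u => rfl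
    rw [LinearEquiv.conj_apply_apply, LinearEquiv.symm_apply_apply, he, Representation.dual_apply,
      Module.Dual.transpose_apply, LinearMap.comp_apply, he]
    change ω (ρ g k) u = ω k (ρ g⁻¹ u)
    rw [← hω g k]
    simp

end Rep

section Rep
variable {G : Type} [Group G] {V : Type} [AddCommGroup V] [Module ℂ V]
  {ρ : Representation ℂ G V}

theorem NoSymplectic.of_injective_of_card_le {N E : Type} [Group N] [Group E] [Finite E]
    (f : N →* E) (hf : Function.Injective f) (hN : NoSymplectic N) (hr : IsRealGroup N)
    (hcard : Nat.card E ≤ 2 * Nat.card N) : NoSymplectic E := by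
  intro V _ _ _ ρ h ω ha hω
  by_contra h0
  have : Finite N := Finite.of_injective f hf
  have := Fintype.ofFinite N
  have := Fintype.ofFinite E
  have hnt := h.nontrivial_space
  let ρN : Representation ℂ N V := ρ.comp f
  obtain ⟨U, hU, hchar⟩ := exists_lagrangian (ρ := ρN) hN ω ha (fun g x y => hω _ x y)
    (h.form_separating ω hω h0)
  let α := U.toRepresentation
  have hUnt := hU hnt
  have h2 : ∀ n, ρ.character (f n) = 2 * α.character n := by
    intro n
    have : ρ.character (f n) = α.character n + α.character n⁻¹ := hchar n
    rw [this, hr.char_inv, two_mul]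
  have hnorm : ∀ {H W : Type} [Group H] [Fintype H] [AddCommGroup W] [Module ℂ W]
      [FiniteDimensional ℂ W] (τ : Representation ℂ H W),
      ∑ g, τ.character g * τ.character g⁻¹ = ((∑ g, Complex.normSq (τ.character g) : ℝ) : ℂ) := by
    intro H W _ _ _ _ _ τ
    rw [Complex.ofReal_sum]
    refine Finset.sum_congr rfl fun g _ => ?_
    rw [char_inv_eq_conj, Complex.mul_conj]
  have hEsum : ∑ g, Complex.normSq (ρ.character g) = Nat.card E := by
    have := h.sum_char_mul_char_inv
    rw [hnorm] at this
    exact_mod_cast this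
  have hNsum : (Nat.card N : ℝ) ≤ ∑ n, Complex.normSq (α.character n) := by
    have hc : (Nat.card N : ℂ) ≠ 0 := by exact_mod_cast Nat.card_pos.ne'
    let _ : Invertible (Nat.card N : ℂ) := invertibleOfNonzero hc
    have h3 := Representation.card_inv_mul_sum_char_mul_char_eq_finrank α α
    rw [hnorm] at h3
    set d := Module.finrank ℂ (α.IntertwiningMap α)
    have h4 : ∑ n, Complex.normSq (α.character n) = Nat.card N * (d : ℝ) := by
      field_simp at h3
      exact_mod_cast h3
    have h5 : 0 < ∑ n, Complex.normSq (α.character n) := by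
      refine Finset.sum_pos' (fun _ _ => Complex.normSq_nonneg _) ⟨1, Finset.mem_univ _, ?_⟩
      rw [Representation.char_one, Complex.normSq_natCast]
      have : 0 < Module.finrank ℂ U.toSubmodule := Module.finrank_pos
      positivity
    have h6 : d ≠ 0 := by
      intro h; rw [h4, h] at h5; simp at h5
    rw [h4]
    have : (1 : ℝ) ≤ d := by exact_mod_cast Nat.one_le_iff_ne_zero.mpr h6
    nlinarith [(Nat.cast_nonneg (Nat.card N) : (0 : ℝ) ≤ _)]
  have hle : ∑ n, Complex.normSq (ρ.character (f n)) ≤ ∑ g, Complex.normSq (ρ.character g) := by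
    have hmap : ∑ n, Complex.normSq (ρ.character (f n)) =
        ∑ g ∈ Finset.univ.map ⟨f, hf⟩, Complex.normSq (ρ.character g) :=
      (Finset.sum_map Finset.univ ⟨f, hf⟩ fun g => Complex.normSq (ρ.character g)).symm
    rw [hmap]
    exact Finset.sum_le_sum_of_subset_of_nonneg (Finset.subset_univ _)
      fun _ _ _ => Complex.normSq_nonneg _
  simp_rw [h2, Complex.normSq_mul] at hle
  rw [← Finset.mul_sum, hEsum] at hle
  have h7 : (Nat.card E : ℝ) ≤ 2 * Nat.card N := by exact_mod_cast hcard
  have h8 : (0 : ℝ) < Nat.card N := by exact_mod_cast Nat.card_pos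
  have h9 : Complex.normSq 2 = 4 := by norm_num [Complex.normSq_apply]
  rw [h9] at hle
  linarith

theorem IsRealGroup.of_surjective {N E : Type} [Group N] [Group E]
    (f : N →* E) (hf : Function.Surjective f) (hr : IsRealGroup N) : IsRealGroup E := by
  intro e
  obtain ⟨n, rfl⟩ := hf e
  obtain ⟨j, hj⟩ := hr n
  exact ⟨f j, by rw [← map_inv, ← map_mul, ← map_mul, hj, map_inv]⟩

theorem Representation.IsIrreducible.eq_smul_one_of_commute [FiniteDimensional ℂ V]
    (h : ρ.IsIrreducible) (Z : Module.End ℂ V) (hZ : ∀ g x, Z (ρ g x) = ρ g (Z x)) :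
    ∃ z : ℂ, ∀ x, Z x = z • x := by
  have := h.nontrivial_space
  obtain ⟨c, hc⟩ := Module.End.exists_eigenvalue Z
  refine ⟨c, fun x => ?_⟩
  rcases h.eq_bot_or_eq_top_of_invariant (Z.eigenspace c) (fun g w hw => by
    rw [Module.End.mem_eigenspace_iff] at hw ⊢
    rw [hZ, hw, map_smul]) with h | h
  · exact absurd h hc
  · exact Module.End.mem_eigenspace_iff.mp (h ▸ Submodule.mem_top)

theorem exists_pos_scalar_of_noSymplectic {H : Type} [Group H] [Fintype H]
    [FiniteDimensional ℂ V] (hH : NoSymplectic H) (hr : IsRealGroup H) (f : H →* G)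
    (h : ρ.IsIrreducible)
    (hcomm : ∀ g x, (∑ a, ρ (f (a * a))) (ρ g x) = ρ g ((∑ a, ρ (f (a * a))) x)) :
    ∃ r : ℝ, 0 < r ∧ ∀ x, (∑ a, ρ (f (a * a))) x = (r : ℂ) • x := by
  obtain ⟨z, hz⟩ := h.eq_smul_one_of_commute _ hcomm
  have := h.nontrivial_space
  obtain ⟨σ, -, hσ0, hσ⟩ := exists_irreducible_sub (ρ := (ρ.comp f : Representation ℂ H V)) ⊤
    (by simp) (by simp)
  have hσnt : Nontrivial σ.toSubmodule := Submodule.nontrivial_iff_ne_bot.mpr hσ0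
  have h1 := hH.sum_char_sq hr hσ
  have h2 : ∑ a, σ.toRepresentation (a * a) = z • (1 : Module.End ℂ σ.toSubmodule) := by
    ext x
    have := hz x
    rw [LinearMap.sum_apply] at this ⊢
    rw [AddSubmonoidClass.coe_finsetSum]
    exact this
  have h3 : z * Module.finrank ℂ σ.toSubmodule = Nat.card H := by
    rw [← h1]
    simp only [Representation.character]
    rw [← map_sum, h2, map_smul, LinearMap.trace_one, smul_eq_mul]
  have h4 : (0 : ℝ) < Module.finrank ℂ σ.toSubmodule := by exact_mod_cast Module.finrank_pos
  have h5 : (0 : ℝ) < Nat.card H := by exact_mod_cast Nat.card_pos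
  refine ⟨Nat.card H / Module.finrank ℂ σ.toSubmodule, by positivity, fun x => ?_⟩
  rw [hz]
  congr 1
  have h6 : (Module.finrank ℂ σ.toSubmodule : ℂ) ≠ 0 := by exact_mod_cast h4.ne'
  push_cast
  rw [← h3]
  field_simp

theorem IsRealGroup.prod {H K : Type} [Group H] [Group K] (h1 : IsRealGroup H)
    (h2 : IsRealGroup K) : IsRealGroup (H × K) := by
  rintro ⟨a, b⟩
  obtain ⟨i, hi⟩ := h1 a
  obtain ⟨j, hj⟩ := h2 b
  exact ⟨(i, j), Prod.ext hi hj⟩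

theorem NoSymplectic.prod {H K : Type} [Group H] [Group K] [Finite H] [Finite K]
    (h1 : NoSymplectic H) (h2 : NoSymplectic K) (r1 : IsRealGroup H) (r2 : IsRealGroup K) :
    NoSymplectic (H × K) := by
  intro V _ _ _ ρ h ω ha hω
  by_contra h0
  have := Fintype.ofFinite H
  have := Fintype.ofFinite K
  obtain ⟨r, hr, hZ1⟩ := exists_pos_scalar_of_noSymplectic h1 r1 (MonoidHom.inl H K) h (by
    rintro ⟨c, d⟩ x
    rw [LinearMap.sum_apply, LinearMap.sum_apply, map_sum]
    refine Fintype.sum_equiv (MulAut.conj c⁻¹).toEquiv _ _ fun a => ?_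
    simp only [← Module.End.mul_apply, ← map_mul]
    congr 2
    simp [mul_assoc])
  obtain ⟨s, hs, hZ2⟩ := exists_pos_scalar_of_noSymplectic h2 r2 (MonoidHom.inr H K) h (by
    rintro ⟨c, d⟩ x
    rw [LinearMap.sum_apply, LinearMap.sum_apply, map_sum]
    refine Fintype.sum_equiv (MulAut.conj d⁻¹).toEquiv _ _ fun a => ?_
    simp only [← Module.End.mul_apply, ← map_mul]
    congr 2
    simp [mul_assoc])
  have h3 := sum_char_sq_of_symplectic (r1.prod r2) h ω ha hω h0
  have h4 : ∑ g : H × K, ρ (g * g) = ((r * s : ℝ) : ℂ) • (1 : Module.End ℂ V) := by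
    ext x
    have : (∑ g : H × K, ρ (g * g)) x =
        (∑ a, ρ (MonoidHom.inl H K (a * a))) ((∑ b, ρ (MonoidHom.inr H K (b * b))) x) := by
      rw [LinearMap.sum_apply, LinearMap.sum_apply, Fintype.sum_prod_type]
      refine Finset.sum_congr rfl fun a _ => ?_
      rw [LinearMap.sum_apply, map_sum]
      refine Finset.sum_congr rfl fun b _ => ?_
      rw [← Module.End.mul_apply, ← map_mul]
      simp
    rw [this, hZ2, hZ1, smul_smul]
    simp
  have h5 : ((r * s : ℝ) : ℂ) * Module.finrank ℂ V = -Nat.card (H × K) := by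
    rw [← h3]
    simp only [Representation.character]
    rw [← map_sum, h4, map_smul, LinearMap.trace_one, smul_eq_mul]
  have h6 : r * s * Module.finrank ℂ V = -Nat.card (H × K) := by exact_mod_cast h5
  have h7 : (0 : ℝ) < Nat.card (H × K) := by exact_mod_cast Nat.card_pos
  have h8 : 0 ≤ r * s * (Module.finrank ℂ V : ℝ) := by positivity
  linarith

theorem isRealGroup_of_dihedral {N : Type} [Group N] (y j : N) (hj : j * j = 1)
    (hy : j * y * j⁻¹ = y⁻¹) (hall : ∀ n : N, ∃ k : ℤ, n = y ^ k ∨ n = y ^ k * j) :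
    IsRealGroup N := by
  have hz : ∀ k : ℤ, j * y ^ k * j⁻¹ = y ^ (-k) := fun k => by
    rw [← conj_zpow, hy, _root_.inv_zpow, _root_.zpow_neg]
  have hji : j⁻¹ = j := inv_eq_of_mul_eq_one_left hj
  intro n
  obtain ⟨k, rfl | rfl⟩ := hall n
  · exact ⟨j, by rw [hz, _root_.zpow_neg]⟩
  · refine ⟨1, ?_⟩
    have := hz k
    rw [one_mul, inv_one, mul_one, _root_.mul_inv_rev, ← _root_.zpow_neg, ← this, hji, ← mul_assoc, ← mul_assoc,
      hj, one_mul]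

theorem noSymplectic_of_dihedral {N : Type} [Group N] (y j : N) (hj : j * j = 1)
    (hy : j * y * j⁻¹ = y⁻¹) (hall : ∀ n : N, ∃ k : ℤ, n = y ^ k ∨ n = y ^ k * j) :
    NoSymplectic N := by
  intro V _ _ _ ρ h ω ha hω
  have := h.nontrivial_space
  obtain ⟨c, hc⟩ := Module.End.exists_eigenvalue (ρ y)
  obtain ⟨v, hv⟩ := hc.exists_hasEigenvector
  have hv1 : ρ y v = c • v := hv.apply_eq_smul
  have hji : j⁻¹ = j := inv_eq_of_mul_eq_one_left hj
  have hjj : ∀ x, ρ j (ρ j x) = x := fun x => by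
    rw [← Module.End.mul_apply, ← map_mul, hj, map_one, Module.End.one_apply]
  have hc0 : c ≠ 0 := by
    rintro rfl
    apply hv.2
    have : ρ y⁻¹ (ρ y v) = v := by simp
    rw [← this, hv1]; simp
  have hv2 : ρ y⁻¹ v = c⁻¹ • v := by
    have : ρ y⁻¹ (ρ y v) = v := by simp
    rw [hv1, map_smul] at this
    rw [eq_inv_smul_iff₀ hc0, this]
  have hyj : y * j = j * y⁻¹ := by
    rw [← hy, hji, ← mul_assoc, ← mul_assoc, hj, one_mul]
  have hyj' : y⁻¹ * j = j * y := by
    rw [← hy, hji, mul_assoc, hj, mul_one]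
  have hmul : ∀ a b x, ρ (a * b) x = ρ a (ρ b x) := fun a b x => by
    rw [map_mul, Module.End.mul_apply]
  have hjv1 : ρ y (ρ j v) = c⁻¹ • ρ j v := by
    rw [← hmul, hyj, hmul, hv2, map_smul]
  have hjv2 : ρ y⁻¹ (ρ j v) = c • ρ j v := by
    rw [← hmul, hyj', hmul, hv1, map_smul]
  let W := Submodule.span ℂ {v, ρ j v}
  have hvW : v ∈ W := Submodule.subset_span (by simp)
  have hjW : ρ j v ∈ W := Submodule.subset_span (by simp)
  have hspan : ∀ a : N, ρ a v ∈ W → ρ a (ρ j v) ∈ W → ∀ w ∈ W, ρ a w ∈ W := by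
    intro a h1 h2 w hw
    have : W ≤ W.comap (ρ a) := Submodule.span_le.mpr (by
      rintro x (rfl | hx)
      · exact h1
      · rw [Set.mem_singleton_iff.mp hx]; exact h2)
    exact this hw
  have hWj := hspan j hjW (by rw [hjj]; exact hvW)
  have hWy := hspan y (by rw [hv1]; exact W.smul_mem _ hvW) (by rw [hjv1]; exact W.smul_mem _ hjW)
  have hWyi := hspan y⁻¹ (by rw [hv2]; exact W.smul_mem _ hvW)
    (by rw [hjv2]; exact W.smul_mem _ hjW)
  have hWk : ∀ k : ℤ, ∀ w ∈ W, ρ (y ^ k) w ∈ W := by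
    intro k
    induction k using Int.induction_on with
    | zero => simp
    | succ i ih => intro w hw; rw [_root_.zpow_add_one, hmul]; exact ih _ (hWy w hw)
    | pred i ih => intro w hw; rw [_root_.zpow_sub_one, hmul]; exact ih _ (hWyi w hw)
  have hW : ∀ g, ∀ w ∈ W, ρ g w ∈ W := by
    intro g w hw
    obtain ⟨k, rfl | rfl⟩ := hall g
    · exact hWk k w hw
    · rw [hmul]; exact hWk k _ (hWj w hw)
  have htop : W = ⊤ := (h.eq_bot_or_eq_top_of_invariant W hW).resolve_left fun h =>
    hv.2 ((Submodule.mem_bot ℂ).mp (h ▸ hvW))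
  have hz : ω v (ρ j v) = 0 := by
    have h1 := hω j v (ρ j v)
    rw [hjj] at h1
    have h2 := ha.neg_eq v (ρ j v)
    rw [h1] at h2
    linear_combination (-1/2 : ℂ) * h2
  have hz' : ω (ρ j v) v = 0 := by rw [← ha.neg_eq, hz, neg_zero]
  have hker : ∀ x, x = v ∨ x = ρ j v → ω x = 0 := by
    intro x hx
    have : W ≤ LinearMap.ker (ω x) := Submodule.span_le.mpr (by
      rintro z (rfl | hz1)
      · rcases hx with rfl | rfl
        · exact ha.self_eq_zero _
        · exact hz'
      · rw [Set.mem_singleton_iff.mp hz1]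
        rcases hx with rfl | rfl
        · exact hz
        · exact ha.self_eq_zero _)
    rw [htop] at this
    ext z
    exact this (Submodule.mem_top (x := z))
  have : W ≤ LinearMap.ker ω := Submodule.span_le.mpr (by
    rintro z (rfl | hz1)
    · exact hker _ (Or.inl rfl)
    · exact hker _ (Or.inr hz1))
  rw [htop] at this
  exact LinearMap.ker_eq_top.mp (top_le_iff.mp this)

end Rep

section TraceFn

/-- Functions of the form `t ↦ tr (X ρ(t))` with `X` of finite order commuting with `ρ`. -/
def IsTraceFn {T : Type} [Group T] (φ : T → ℂ) : Prop :=
  ∃ (W : Type) (_ : AddCommGroup W) (_ : Module ℂ W) (_ : FiniteDimensional ℂ W)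
    (ρ : Representation ℂ T W) (X : Module.End ℂ W) (n : ℕ), 0 < n ∧ X ^ n = 1 ∧
      (∀ t, X * ρ t = ρ t * X) ∧ ∀ t, φ t = LinearMap.trace ℂ W (X * ρ t)

variable {T : Type} [Group T]

theorem IsTraceFn.mul {φ ψ : T → ℂ} (hφ : IsTraceFn φ) (hψ : IsTraceFn ψ) :
    IsTraceFn fun t => φ t * ψ t := by
  obtain ⟨W, _, _, _, ρ, X, n, hn, hX, hc, h⟩ := hφ
  obtain ⟨W', _, _, _, ρ', X', n', hn', hX', hc', h'⟩ := hψ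
  refine ⟨TensorProduct ℂ W W', inferInstance, inferInstance, inferInstance, ρ.tprod ρ',
    TensorProduct.map X X', n * n', Nat.mul_pos hn hn', ?_, fun t => ?_, fun t => ?_⟩
  · rw [TensorProduct.map_pow, pow_mul, hX, one_pow, mul_comm n, pow_mul, hX', one_pow,
      TensorProduct.map_one]
  · rw [Representation.tprod_apply, ← TensorProduct.map_mul, ← TensorProduct.map_mul, hc, hc']
  · rw [Representation.tprod_apply, ← TensorProduct.map_mul, LinearMap.trace_tensorProduct', ← h, ← h']

theorem isTraceFn_one : IsTraceFn fun _ : T => (1 : ℂ) :=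
  ⟨ℂ, inferInstance, inferInstance, inferInstance, 1, 1, 1, one_pos, one_pow _, fun _ => rfl,
    fun t => by simp⟩

theorem IsTraceFn.pow {φ : T → ℂ} (hφ : IsTraceFn φ) (k : ℕ) : IsTraceFn fun t => φ t ^ k := by
  induction k with
  | zero => simpa using isTraceFn_one
  | succ k ih => simpa only [pow_succ] using ih.mul hφ

theorem isTraceFn_character {G V : Type} [Group G] [Finite G] [AddCommGroup V] [Module ℂ V]
    [FiniteDimensional ℂ V] (ρ : Representation ℂ G V) (f : T →* G) (x : G)
    (hx : ∀ t, x * f t = f t * x) : IsTraceFn fun t => ρ.character (x * f t) :=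
  ⟨V, inferInstance, inferInstance, inferInstance, ρ.comp f, ρ x, orderOf x, orderOf_pos x,
    by rw [← map_pow, pow_orderOf_eq_one, map_one],
    fun t => by
      change ρ x * ρ (f t) = ρ (f t) * ρ x
      rw [← map_mul, hx, map_mul],
    fun t => by
      change _ = LinearMap.trace ℂ V (ρ x * ρ (f t))
      rw [← map_mul]; rfl⟩

theorem isTraceFn_character_inv {G V : Type} [Group G] [Finite G] [AddCommGroup V] [Module ℂ V]
    [FiniteDimensional ℂ V] (ρ : Representation ℂ G V) (f : T →* G) (x : G)
    (hx : ∀ t, x * f t = f t * x) : IsTraceFn fun t => ρ.character (x * f t)⁻¹ := by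
  simpa only [Representation.char_dual] using isTraceFn_character ρ.dual f x hx

theorem isTraceFn_card_fixedBy (Ω : Type) [Finite Ω] [MulAction T Ω] :
    IsTraceFn fun t : T => (Nat.card (MulAction.fixedBy Ω t) : ℂ) := by
  have := Fintype.ofFinite Ω
  let ρ : Representation ℂ T (Ω → ℂ) :=
    { toFun := fun t => LinearMap.funLeft ℂ ℂ fun a => t⁻¹ • a
      map_one' := by ext; simp
      map_mul' := fun s t => by
        ext v a
        simp [LinearMap.funLeft_apply, mul_smul] }
  refine ⟨Ω → ℂ, inferInstance, inferInstance, inferInstance, ρ, 1, 1, one_pos, one_pow _,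
    fun _ => by rw [one_mul, mul_one], fun t => ?_⟩
  rw [one_mul, LinearMap.trace_eq_matrix_trace ℂ (Pi.basisFun ℂ Ω), Matrix.trace]
  have : ∀ i, (LinearMap.toMatrix (Pi.basisFun ℂ Ω) (Pi.basisFun ℂ Ω) (ρ t)).diag i =
      if t • i = i then 1 else 0 := fun i => by
    rw [Matrix.diag_apply, LinearMap.toMatrix_apply, Pi.basisFun_repr, Pi.basisFun_apply]
    change (Pi.single i 1 : Ω → ℂ) (t⁻¹ • i) = _
    rw [Pi.single_apply]
    congr 1
    rw [_root_.inv_smul_eq_iff, eq_comm (a := i)]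
  simp_rw [this, Finset.sum_boole]
  rw [Nat.card_eq_fintype_card, Fintype.card_subtype]
  rfl

theorem IsTraceFn.isIntegral_average [Fintype T] {φ : T → ℂ} (hφ : IsTraceFn φ) :
    IsIntegral ℤ ((Nat.card T : ℂ)⁻¹ * ∑ t, φ t) := by
  obtain ⟨W, _, _, _, ρ, X, n, hn, hX, hc, h⟩ := hφ
  have hT : (Nat.card T : ℂ) ≠ 0 := by exact_mod_cast Nat.card_pos.ne'
  let P : Module.End ℂ W := (Nat.card T : ℂ)⁻¹ • ∑ t, ρ t
  have hρP : ∀ t, ρ t * P = P := fun t => by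
    simp only [P, mul_smul_comm, Finset.mul_sum, ← map_mul]
    congr 1
    exact Fintype.sum_equiv (Equiv.mulLeft t) _ _ fun _ => rfl
  have hPP : P * P = P := by
    conv_lhs => enter [1]; simp only [P]
    rw [smul_mul_assoc, Finset.sum_mul]
    simp only [hρP, Finset.sum_const, Finset.card_univ]
    rw [← Nat.card_eq_fintype_card, ← Nat.cast_smul_eq_nsmul ℂ, inv_smul_smul₀ hT]
  have hXP : Commute X P := by
    change X * P = P * X
    simp only [P, mul_smul_comm, smul_mul_assoc, Finset.mul_sum, Finset.sum_mul, hc]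
  have hPn : ∀ k, P ^ (k + 1) = P := fun k => by
    induction k with
    | zero => simp
    | succ k ih => rw [pow_succ, ih, hPP]
  have := isIntegral_trace_of_pow_eq (X * P) n hn (by
    rw [hXP.mul_pow, pow_succ, hX, one_mul, hPn])
  convert this using 1
  simp only [P, mul_smul_comm, Finset.mul_sum, map_smul, map_sum, h, smul_eq_mul]

theorem isIntegral_character {G V : Type} [Group G] [Finite G] [AddCommGroup V] [Module ℂ V]
    [FiniteDimensional ℂ V] (ρ : Representation ℂ G V) (g : G) : IsIntegral ℤ (ρ.character g) :=
  isIntegral_trace_of_pow_eq _ (orderOf g) (orderOf_pos g) (by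
    rw [pow_succ, ← map_pow, pow_orderOf_eq_one, map_one, one_mul])

end TraceFn

section CosetFix
variable {C : Type} [Group C]

/-- The number of fixed points of `u` on the cosets of `P`. -/
def cosetFix (P : Subgroup C) (u : C) : ℕ := Nat.card (MulAction.fixedBy (C ⧸ P) u)

theorem card_mul_cosetFix (P : Subgroup C) (u : C) :
    Nat.card P * cosetFix P u = Nat.card {g : C // g⁻¹ * u * g ∈ P} := by
  rw [cosetFix, ← Nat.card_prod]
  refine Nat.card_congr ((QuotientGroup.preimageMkEquivSubgroupProdSet P _).symm.trans
    (Equiv.subtypeEquivRight fun g => ?_))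
  change u • (g : C ⧸ P) = g ↔ _
  rw [eq_comm, MulAction.Quotient.smul_coe, QuotientGroup.eq, smul_eq_mul, mul_assoc]

theorem cosetFix_inv (P : Subgroup C) (u : C) : cosetFix P u⁻¹ = cosetFix P u := by
  rw [cosetFix, MulAction.fixedBy_inv, cosetFix]

theorem cosetFix_map [Finite C] (P : Subgroup C) (θ : C ≃* C) (hθ : ∀ g, θ g ∈ P ↔ g ∈ P) (u : C) :
    cosetFix P (θ u) = cosetFix P u := by
  refine Nat.eq_of_mul_eq_mul_left (Nat.card_pos (α := P)) ?_
  rw [card_mul_cosetFix, card_mul_cosetFix]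
  refine (Nat.card_congr (θ.toEquiv.subtypeEquiv fun g => ?_)).symm
  change _ ↔ (θ g)⁻¹ * θ u * θ g ∈ P
  rw [← hθ, map_mul, map_mul, map_inv]

theorem odd_cosetFix [Finite C] (P : Subgroup C) (hP : Odd P.index) {u : C} {s : ℕ}
    (hu : u ^ 2 ^ s = 1) : Odd (cosetFix P u) := by
  have := Fintype.ofFinite (C ⧸ P)
  have h := Equiv.Perm.card_fixedPoints_modEq (p := 2) (n := s)
    (f := (MulAction.toEndHom u : Function.End (C ⧸ P))) (by rw [← map_pow, hu, map_one])
  have h2 : Fintype.card (C ⧸ P) = P.index := by rw [Subgroup.index, Nat.card_eq_fintype_card]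
  rw [h2] at h
  rw [Nat.odd_iff] at hP ⊢
  rw [← hP, h, cosetFix, Nat.card_eq_fintype_card]
  rfl

theorem sum_cosetFix_mul [Fintype C] (P : Subgroup C) (s : ℕ) (hP : ∀ t ∈ P, t ^ 2 ^ s = 1)
    (h : C → ℂ) (hh : ∀ g u, h (g * u * g⁻¹) = h u) :
    Nat.card P * ∑ u with u ^ 2 ^ s = 1, (cosetFix P u : ℂ) * h u
      = Nat.card C * ∑ t : P, h t := by
  have h1 : ∀ u : C, (Nat.card P : ℂ) * ((cosetFix P u : ℂ) * h u) =
      ∑ g : C, if g⁻¹ * u * g ∈ P then h u else 0 := fun u => by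
    rw [← mul_assoc, ← Nat.cast_mul, card_mul_cosetFix, ← Finset.sum_filter, Finset.sum_const,
      Nat.card_eq_fintype_card, Fintype.card_subtype, nsmul_eq_mul]
  have h2 : ∀ g : C, ∑ u with u ^ 2 ^ s = 1, (if g⁻¹ * u * g ∈ P then h u else 0) =
      ∑ t : P, h t := fun g => by
    rw [← Finset.sum_filter, Finset.filter_filter]
    refine Finset.sum_bij' (fun u hu => ⟨g⁻¹ * u * g, (Finset.mem_filter.mp hu).2.2⟩)
      (fun t _ => g * t * g⁻¹) (fun _ _ => Finset.mem_univ _) (fun t _ => ?_) (fun u _ => ?_)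
      (fun t _ => ?_) (fun u _ => ?_)
    · rw [Finset.mem_filter]
      refine ⟨Finset.mem_univ _, ?_, ?_⟩
      · rw [conj_pow, hP t t.2]; simp
      · convert t.2 using 1; group
    · group
    · ext; simp only; group
    · rw [← hh g (g⁻¹ * u * g)]; congr 1; group
  rw [Finset.mul_sum]
  simp_rw [h1]
  rw [Finset.sum_comm]
  simp_rw [h2]
  rw [Finset.sum_const, Finset.card_univ, nsmul_eq_mul, Nat.card_eq_fintype_card]

end CosetFix

section LocalSum
variable {C : Type} [Group C]

theorem cosetFix_conj [Finite C] (P : Subgroup C) (g u : C) :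
    cosetFix P (g * u * g⁻¹) = cosetFix P u := by
  refine Nat.eq_of_mul_eq_mul_left (Nat.card_pos (α := P)) ?_
  rw [card_mul_cosetFix, card_mul_cosetFix]
  refine Nat.card_congr ((Equiv.mulLeft g⁻¹).subtypeEquiv fun a => ?_)
  rw [Equiv.coe_mulLeft]
  simp only [_root_.mul_inv_rev, mul_assoc, inv_inv]

theorem exists_integral_sum_eq_two_mul [Fintype C] (P : Subgroup C) (s : ℕ)
    (hP : ∀ t ∈ P, t ^ 2 ^ s = 1) (hPs : Nat.card P ∣ 2 ^ s) (hidx : Odd P.index) (h : C → ℂ)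
    (hh : ∀ g u, h (g * u * g⁻¹) = h u) (hintegral : ∀ u, IsIntegral ℤ (h u)) (α α' : P → ℂ)
    (hα : IsTraceFn α) (hα' : IsTraceFn α') (τ : P ≃ P)
    (hτ : ∀ t, cosetFix P (τ t : C) = cosetFix P (t : C)) (hαα : ∀ t, α' t = α (τ t))
    (hsq : ∀ t : P, h t = (α t + α' t) ^ 2) :
    ∃ β : ℂ, IsIntegral ℤ β ∧ ∑ u with u ^ 2 ^ s = 1, h u = 2 * Nat.card P * β := by
  obtain ⟨k, hk⟩ : ∃ k, Nat.totient (2 ^ (s + 1)) = k + 1 :=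
    ⟨_, (Nat.succ_pred_eq_of_pos (Nat.totient_pos.mpr (by positivity))).symm⟩
  obtain ⟨e, he⟩ := hPs
  have hc : ∀ u : C, ∃ c : ℤ, u ^ 2 ^ s = 1 →
      (cosetFix P u : ℤ) ^ (k + 1) = 1 + 2 ^ (s + 1) * c := fun u => by
    by_cases hu : u ^ 2 ^ s = 1
    · have hodd := odd_cosetFix P hidx hu
      have h1 := Nat.ModEq.pow_totient
        (Nat.Coprime.pow_right (s + 1) hodd.coprime_two_right)
      rw [hk, ← Int.natCast_modEq_iff] at h1
      obtain ⟨c, hc⟩ := h1.symm.dvd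
      refine ⟨c, fun _ => ?_⟩
      push_cast at hc
      linear_combination hc
    · exact ⟨0, fun h => absurd h hu⟩
  choose c hc using hc
  have hP0 : (Nat.card P : ℂ) ≠ 0 := by exact_mod_cast Nat.card_pos.ne'
  have hf : IsTraceFn fun t : P => (cosetFix P (t : C) : ℂ) ^ k :=
    (isTraceFn_card_fixedBy (T := P) (C ⧸ P)).pow k
  have hy1 := ((hf.mul hα).mul hα).isIntegral_average
  have hy2 := ((hf.mul hα).mul hα').isIntegral_average
  have hy3 : ∑ t : P, (cosetFix P (t : C) : ℂ) ^ k * α' t ^ 2 =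
      ∑ t : P, (cosetFix P (t : C) : ℂ) ^ k * α t ^ 2 := by
    refine Fintype.sum_equiv τ _ _ fun t => ?_
    rw [hτ, hαα]
  set y1 := (Nat.card P : ℂ)⁻¹ * ∑ t : P, (cosetFix P (t : C) : ℂ) ^ k * α t * α t with hy1d
  set y2 := (Nat.card P : ℂ)⁻¹ * ∑ t : P, (cosetFix P (t : C) : ℂ) ^ k * α t * α' t with hy2d
  have hY : ∑ t : P, (cosetFix P (t : C) : ℂ) ^ k * h t = 2 * Nat.card P * (y1 + y2) := by
    have e1 : ∑ t : P, (cosetFix P (t : C) : ℂ) ^ k * h t =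
        ∑ t : P, (cosetFix P (t : C) : ℂ) ^ k * α t ^ 2 +
        ∑ t : P, (cosetFix P (t : C) : ℂ) ^ k * α' t ^ 2 +
        2 * ∑ t : P, (cosetFix P (t : C) : ℂ) ^ k * α t * α' t := by
      rw [Finset.mul_sum, ← Finset.sum_add_distrib, ← Finset.sum_add_distrib]
      refine Finset.sum_congr rfl fun t _ => ?_
      rw [hsq]; ring
    rw [e1, hy3, hy1d, hy2d]
    simp only [sq, ← mul_assoc]
    field_simp
    ring
  have hsum := sum_cosetFix_mul P s hP (fun u => (cosetFix P u : ℂ) ^ k * h u) fun g u => by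
    rw [cosetFix_conj, hh]
  have hcard : (Nat.card C : ℂ) = Nat.card P * P.index := by
    rw [← Nat.cast_mul, Subgroup.card_mul_index]
  rw [hY, hcard, mul_assoc] at hsum
  have hsum := mul_left_cancel₀ hP0 hsum
  have hdecomp : ∑ u with u ^ 2 ^ s = 1, (cosetFix P u : ℂ) * ((cosetFix P u : ℂ) ^ k * h u) =
      ∑ u with u ^ 2 ^ s = 1, h u + 2 ^ (s + 1) * ∑ u with u ^ 2 ^ s = 1, (c u : ℂ) * h u := by
    rw [Finset.mul_sum, ← Finset.sum_add_distrib]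
    refine Finset.sum_congr rfl fun u hu => ?_
    have := hc u (Finset.mem_filter.mp hu).2
    have : (cosetFix P u : ℂ) ^ (k + 1) = 1 + 2 ^ (s + 1) * c u := by exact_mod_cast this
    rw [← mul_assoc, ← pow_succ', this]; ring
  refine ⟨P.index * (y1 + y2) - e * ∑ u with u ^ 2 ^ s = 1, (c u : ℂ) * h u, ?_, ?_⟩
  · refine (((isIntegral_algebraMap (R := ℤ) (x := (P.index : ℤ))).mul (hy1.add hy2)).sub
      ((isIntegral_algebraMap (R := ℤ) (x := (e : ℤ))).mul (IsIntegral.sum _ fun u _ =>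
        (isIntegral_algebraMap (R := ℤ) (x := c u)).mul (hintegral u))))
  · rw [hdecomp] at hsum
    have he' : (2 : ℂ) ^ s = Nat.card P * e := by exact_mod_cast he
    rw [pow_succ, he'] at hsum
    linear_combination hsum

end LocalSum

section Local
variable {G : Type} [Group G]

theorem ConjClasses.card_carrier_mul_card_centralizer [Finite G] (x : G) :
    Nat.card (ConjClasses.mk x).carrier * Nat.card (Subgroup.centralizer {x}) = Nat.card G := by
  rw [Subgroup.nat_card_centralizer_nat_card_stabilizer, ← ConjAct.orbit_eq_carrier_conjClasses,
    Nat.card_coe_set_eq, ← MulAction.index_stabilizer, mul_comm, Subgroup.card_mul_index]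
  rfl

theorem conj_inv_eq_self_of_conj_eq_inv {x j : G} (hj : j * x * j⁻¹ = x⁻¹) :
    j * x⁻¹ * j⁻¹ = x := by
  have : j * x⁻¹ * j⁻¹ = (j * x * j⁻¹)⁻¹ := by group
  rw [this, hj, inv_inv]

theorem inv_conj_eq_inv_of_conj_eq_inv {x j : G} (hj : j * x * j⁻¹ = x⁻¹) :
    j⁻¹ * x * j⁻¹⁻¹ = x⁻¹ := by
  conv_lhs => rw [← conj_inv_eq_self_of_conj_eq_inv hj]
  group

theorem conj_mem_centralizer {x j c : G} (hj : j * x * j⁻¹ = x⁻¹)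
    (hc : c ∈ Subgroup.centralizer {x}) : j * c * j⁻¹ ∈ Subgroup.centralizer {x} := by
  rw [Subgroup.mem_centralizer_singleton_iff] at hc ⊢
  have h2 : Commute c x := hc
  have := (Commute.conj_iff j).2 h2.inv_right
  rwa [conj_inv_eq_self_of_conj_eq_inv hj] at this

/-- Conjugation by an element that inverts `x`, on the centralizer of `x`. -/
def centralizerConj (x j : G) (hj : j * x * j⁻¹ = x⁻¹) :
    Subgroup.centralizer {x} ≃* Subgroup.centralizer {x} where
  toFun := fun c => ⟨j * c * j⁻¹, conj_mem_centralizer hj c.2⟩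
  invFun := fun c => ⟨j⁻¹ * c * j, by
    simpa using conj_mem_centralizer (inv_conj_eq_inv_of_conj_eq_inv hj) c.2⟩
  left_inv := fun c => by ext; simp only; group
  right_inv := fun c => by ext; simp only; group
  map_mul' := fun c d => by ext; simp only [Subgroup.coe_mul]; group

end Local

section Local
variable {G : Type} [Group G]

theorem exists_integral_local_sum [Fintype G] {V : Type} [AddCommGroup V] [Module ℂ V]
    [FiniteDimensional ℂ V] {ρ : Representation ℂ G V} (h : ρ.IsIrreducible)
    (ω : LinearMap.BilinForm ℂ V) (ha : ω.IsAlt) (hω : ∀ g x y, ω (ρ g x) (ρ g y) = ω x y)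
    (h0 : ω ≠ 0) {s r : ℕ} (hr : Odd r) (hs : Nat.card G = 2 ^ s * r) (x : G) (P E : Subgroup G)
    (j : G) (hP2 : IsPGroup 2 P) (hPC : P ≤ Subgroup.centralizer {x})
    (hidx : Odd (P.relIndex (Subgroup.centralizer {x}))) (hxE : x ∈ E) (hPE : P ≤ E) (hjE : j ∈ E)
    (hjP : ∀ t, j * t * j⁻¹ ∈ P ↔ t ∈ P) (hjx : j * x * j⁻¹ = x⁻¹) (hE : NoSymplectic E) :
    ∃ β : ℂ, IsIntegral ℤ β ∧ ∑ u : Subgroup.centralizer {x} with u ^ 2 ^ s = 1,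
      ρ.character (x * u) ^ 2 = 2 * Nat.card P * β := by
  set C := Subgroup.centralizer {x} with hC
  let P' := P.subgroupOf C
  have hPcard : Nat.card P' = Nat.card P := Nat.card_congr (Subgroup.subgroupOfEquivOfLe hPC).toEquiv
  have hPs : Nat.card P ∣ 2 ^ s := by
    obtain ⟨n, hn⟩ := IsPGroup.iff_card.mp hP2
    have h1 : Nat.card P ∣ 2 ^ s * r := hs ▸ Subgroup.card_subgroup_dvd_card P
    refine Nat.Coprime.dvd_of_dvd_mul_right ?_ h1
    rw [hn]
    exact Nat.Coprime.pow_left n hr.coprime_two_left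
  have hxu : ∀ u : C, x * (u : G) = u * x := fun u =>
    (Subgroup.mem_centralizer_singleton_iff.mp u.2).symm
  obtain ⟨U, -, hU⟩ := exists_lagrangian (ρ := (ρ.comp E.subtype : Representation ℂ E V)) hE ω ha
    (fun g y z => hω _ y z) (h.form_separating ω hω h0)
  let α := U.toRepresentation
  let f : P' →* E := (Subgroup.inclusion hPE).comp (Subgroup.subgroupOfEquivOfLe hPC).toMonoidHom
  let xE : E := ⟨x, hxE⟩
  have hf : ∀ t : P', ((f t : E) : G) = ((t : C) : G) := fun t => rfl
  have hxf : ∀ t, xE * f t = f t * xE := fun t => Subtype.ext (hxu t)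
  let θ := centralizerConj x j hjx
  have hθ : ∀ t : C, ((θ t : C) : G) = j * t * j⁻¹ := fun t => rfl
  have hθP : ∀ t, θ t ∈ P' ↔ t ∈ P' := fun t => hjP t
  let τ : P' ≃ P' := (θ.toEquiv.subtypeEquiv fun t => (hθP t).symm).trans (Equiv.inv P')
  have hτ : ∀ t : P', ((τ t : P') : C) = (θ t)⁻¹ := fun t => rfl
  rw [← hPcard]
  convert exists_integral_sum_eq_two_mul P' s (fun t ht => ?_) (hPcard ▸ hPs) hidx
    (fun u => ρ.character (x * u) ^ 2) (fun g u => ?_) (fun u => (isIntegral_character ρ _).pow 2)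
    (fun t => α.character (xE * f t)) (fun t => α.character (xE * f t)⁻¹)
    (isTraceFn_character α f xE hxf) (isTraceFn_character_inv α f xE hxf) τ (fun t => ?_)
    (fun t => ?_) (fun t => ?_) using 1
  · congr!
  · have h1 : (⟨t, ht⟩ : P') ^ 2 ^ s = 1 := by
      obtain ⟨e, he⟩ := hPs
      rw [he, ← hPcard, pow_mul, pow_card_eq_one', one_pow]
    simpa using congrArg Subtype.val h1
  · congr 1
    rw [← ρ.char_conj (x * u) g]
    congr 1
    rw [← mul_assoc (g : G), ← hxu g]
    simp [mul_assoc]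
  · rw [hτ, cosetFix_inv, cosetFix_map P' θ hθP]
  · rw [← α.char_conj _ ⟨j, hjE⟩]
    congr 1
    refine Subtype.ext ?_
    have h2 := hxu (θ (t : C))⁻¹
    change j * (x * (t : C))⁻¹ * j⁻¹ = x * ((τ t : P') : C)
    rw [hτ, h2, Subgroup.coe_inv, hθ, ← conj_inv_eq_self_of_conj_eq_inv hjx]
    simp [mul_assoc, hjx]
  · exact congrArg (· ^ 2) (hU (xE * f t))

theorem NoSymplectic.of_local [Finite G] (hG : IsRealGroup G)
    (hE : ∀ x : G, Odd (orderOf x) → ∃ (P E : Subgroup G) (j : G), IsPGroup 2 P ∧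
      P ≤ Subgroup.centralizer {x} ∧ Odd (P.relIndex (Subgroup.centralizer {x})) ∧ x ∈ E ∧ P ≤ E ∧
      j ∈ E ∧ (∀ t, j * t * j⁻¹ ∈ P ↔ t ∈ P) ∧ j * x * j⁻¹ = x⁻¹ ∧ NoSymplectic E) :
    NoSymplectic G := by
  intro V _ _ _ ρ h ω ha hω
  by_contra h0
  have := Fintype.ofFinite G
  obtain ⟨s, r, hr, hs⟩ := Nat.exists_eq_two_pow_mul_odd (Nat.card_pos (α := G)).ne'
  obtain ⟨e, he2, her⟩ := Nat.chineseRemainder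
    (Nat.Coprime.pow_left s (Nat.coprime_two_left.mpr hr)) 0 1
  have hpow : ∀ (g : G) (a b : ℕ), a ≡ b [MOD 2 ^ s * r] → g ^ a = g ^ b := fun g a b hab =>
    pow_eq_pow_iff_modEq.mpr (hab.of_dvd (hs ▸ orderOf_dvd_natCard g))
  have h2e : ∀ g : G, (g ^ 2 ^ s) ^ e = g ^ 2 ^ s := fun g => by
    rw [← pow_mul]
    refine hpow _ _ _ ?_
    simpa using her.mul_left' (2 ^ s)
  have hre : ∀ g : G, (g ^ e) ^ r = 1 := fun g => by
    rw [← pow_mul, ← pow_zero g]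
    refine hpow _ _ _ ?_
    simpa using he2.mul_right' r
  have hee : ∀ x : G, x ^ r = 1 → x ^ e = x := fun x hx => by
    conv_rhs => rw [← pow_one x]
    exact pow_eq_pow_iff_modEq.mpr (her.of_dvd (orderOf_dvd_of_pow_eq_one hx))
  have hue : ∀ u : G, u ^ 2 ^ s = 1 → u ^ e = 1 := fun u hu => by
    rw [← pow_zero u]
    exact pow_eq_pow_iff_modEq.mpr (he2.of_dvd (orderOf_dvd_of_pow_eq_one hu))
  have hT : ∀ x : G, ∃ β : ℂ, IsIntegral ℤ β ∧
      Nat.card (ConjClasses.mk x).carrier * ∑ g with g ^ e = x, ρ.character g ^ 2 =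
        2 ^ (s + 1) * β := fun x => by
    by_cases hx : x ^ r = 1
    · have hodd : Odd (orderOf x) := hr.of_dvd_nat (orderOf_dvd_of_pow_eq_one hx)
      obtain ⟨P, E, j, hP2, hPC, hidx, hxE, hPE, hjE, hjP, hjx, hEN⟩ := hE x hodd
      obtain ⟨β, hβ, hsum⟩ := exists_integral_local_sum h ω ha hω h0 hr hs x P E j hP2 hPC hidx hxE
        hPE hjE hjP hjx hEN
      have hcl := ConjClasses.card_carrier_mul_card_centralizer x
      have hdiv : 2 ^ s ∣ Nat.card (ConjClasses.mk x).carrier * Nat.card P := by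
        refine Nat.Coprime.dvd_of_dvd_mul_right
          (Nat.Coprime.pow_left s (Nat.coprime_two_left.mpr hidx)) ?_
        have h1 : Nat.card P * P.relIndex (Subgroup.centralizer {x}) =
            Nat.card (Subgroup.centralizer {x}) := by
          rw [← Subgroup.relIndex_bot_left, ← Subgroup.relIndex_bot_left,
            Subgroup.relIndex_mul_relIndex _ _ _ bot_le hPC]
        rw [mul_assoc, h1, hcl, hs]
        exact dvd_mul_right _ _
      obtain ⟨n, hn⟩ := hdiv
      have hfib : ∑ g with g ^ e = x, ρ.character g ^ 2 =
          ∑ u : Subgroup.centralizer {x} with u ^ 2 ^ s = 1, ρ.character (x * u) ^ 2 := by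
        symm
        refine Finset.sum_bij (fun u _ => x * (u : G)) (fun u hu => ?_) (fun u _ v _ huv => ?_)
          (fun g hg => ?_) (fun _ _ => rfl)
        · have hu1 := congrArg Subtype.val (Finset.mem_filter.mp hu).2
          have hc : Commute x (u : G) := (Subgroup.mem_centralizer_singleton_iff.mp u.2).symm
          rw [Finset.mem_filter, hc.mul_pow, hee x hx, hue u (by simpa using hu1), mul_one]
          exact ⟨Finset.mem_univ _, rfl⟩
        · exact Subtype.ext (mul_left_cancel huv)
        · have hg := (Finset.mem_filter.mp hg).2
          have hc : Commute x g := by rw [← hg]; exact (Commute.refl g).pow_left e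
          have hcu : Commute x⁻¹ g := hc.inv_left
          refine ⟨⟨x⁻¹ * g, ?_⟩, ?_, ?_⟩
          · rw [Subgroup.mem_centralizer_singleton_iff, mul_assoc, ← hc.eq]; group
          · rw [Finset.mem_filter]
            refine ⟨Finset.mem_univ _, Subtype.ext ?_⟩
            change (x⁻¹ * g) ^ 2 ^ s = 1
            rw [hcu.mul_pow, inv_pow, ← hg, ← pow_mul, mul_comm e, pow_mul, h2e, inv_mul_cancel]
          · group
      refine ⟨n * β, (isIntegral_algebraMap (R := ℤ) (x := (n : ℤ))).mul hβ, ?_⟩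
      rw [hfib, hsum]
      have hn' : (Nat.card (ConjClasses.mk x).carrier : ℂ) * Nat.card P = 2 ^ s * n := by
        exact_mod_cast hn
      rw [pow_succ]
      linear_combination (2 * β) * hn'
    · refine ⟨0, isIntegral_zero, ?_⟩
      rw [Finset.sum_eq_zero, mul_zero, mul_zero]
      intro g hg
      exact absurd ((Finset.mem_filter.mp hg).2 ▸ hre g) hx
  have hTconj : ∀ a x : G, ∑ g with g ^ e = a * x * a⁻¹, ρ.character g ^ 2 =
      ∑ g with g ^ e = x, ρ.character g ^ 2 := fun a x => by
    symm
    refine Finset.sum_equiv (MulAut.conj a).toEquiv (fun g => ?_) (fun g _ => ?_)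
    · simp
    · change _ = ρ.character (a * g * a⁻¹) ^ 2
      rw [ρ.char_conj]
  choose β hβ hTβ using hT
  have htotal : ∑ g, ρ.character g ^ 2 =
      ∑ c : ConjClasses G, 2 ^ (s + 1) * β c.exists_rep.choose := by
    rw [← Finset.sum_fiberwise Finset.univ (fun g => g ^ e),
      ← Finset.sum_fiberwise Finset.univ ConjClasses.mk]
    refine Finset.sum_congr rfl fun c _ => ?_
    have hc := c.exists_rep.choose_spec
    set x := c.exists_rep.choose
    rw [← hTβ x, Finset.sum_congr rfl (g := fun _ => ∑ g with g ^ e = x, ρ.character g ^ 2),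
      Finset.sum_const, nsmul_eq_mul]
    · congr 2
      rw [← hc, Nat.card_eq_fintype_card, ← Set.toFinset_card]
      congr 1
      ext y
      simp [ConjClasses.mem_carrier_iff_mk_eq]
    · intro y hy
      have : IsConj x y := ConjClasses.mk_eq_mk_iff_isConj.mp (hc.trans (by simpa [eq_comm] using hy))
      obtain ⟨a, rfl⟩ := isConj_iff.mp this
      exact hTconj a x
  rw [h.sum_char_sq hG, ← Finset.mul_sum, hs, pow_succ] at htotal
  push_cast at htotal
  rw [mul_assoc] at htotal
  have h2 := mul_left_cancel₀ (pow_ne_zero s (two_ne_zero : (2 : ℂ) ≠ 0)) htotal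
  obtain ⟨k, hk⟩ := hr
  have hintegral : IsIntegral ℤ ((1 / 2 : ℚ)) := by
    have h3 : IsIntegral ℤ (algebraMap ℚ ℂ (1 / 2)) := by
      have : algebraMap ℚ ℂ (1 / 2) = ∑ c : ConjClasses G, β c.exists_rep.choose - (k : ℤ) := by
        have h4 : algebraMap ℚ ℂ (1 / 2) = 1 / 2 := by rw [eq_ratCast]; norm_num
        rw [hk] at h2
        rw [h4]
        push_cast at h2 ⊢
        linear_combination (1 / 2 : ℂ) * h2
      rw [this]
      exact (IsIntegral.sum _ fun c _ => hβ _).sub isIntegral_algebraMap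
    exact (isIntegral_algebraMap_iff (algebraMap ℚ ℂ).injective).mp h3
  obtain ⟨n, hn⟩ := IsIntegrallyClosed.isIntegral_iff.mp hintegral
  have : (2 * n : ℤ) = 1 := by
    have : (n : ℚ) = 1 / 2 := hn
    have : (2 * n : ℚ) = 1 := by rw [this]; norm_num
    exact_mod_cast this
  omega

end Local

section TwoGroups

theorem exists_central_involution {Q : Type} [Group Q] [Finite Q] (hQ : IsPGroup 2 Q)
    (N : Subgroup Q) [N.Normal] (hN : N ≠ ⊥) :
    ∃ b ∈ N, b ≠ 1 ∧ b * b = 1 ∧ ∀ d, d * b * d⁻¹ = b := by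
  have hnt : Nontrivial N := (Subgroup.nontrivial_iff_ne_bot N).mpr hN
  have h2 : 2 ∣ Nat.card N := by
    obtain ⟨n, hn0, hn⟩ := (hQ.to_subgroup N).nontrivial_iff_card.mp hnt
    exact hn ▸ dvd_pow_self 2 hn0.ne'
  obtain ⟨b, hb, hb1⟩ := (hQ.of_equiv ConjAct.toConjAct).exists_fixed_point_of_prime_dvd_card_of_fixed_point
    N h2 (a := 1) (fun g => smul_one g)
  have hcomm : ∀ d : Q, Commute d (b : Q) := fun d => by
    have := congrArg Subtype.val (hb (ConjAct.toConjAct d))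
    rw [ConjAct.Subgroup.val_conj_smul, ConjAct.toConjAct_smul] at this
    exact mul_inv_eq_iff_eq_mul.mp this
  have hb2 : ((b : Q)) ≠ 1 := fun h => hb1 (Subtype.ext h.symm)
  have hex : ∃ k, (b : Q) ^ 2 ^ k = 1 := by
    obtain ⟨k, hk⟩ := hQ (b : Q)
    exact ⟨k, hk⟩
  have hk := Nat.find_spec hex
  have hk0 : Nat.find hex ≠ 0 := fun h => hb2 (by rw [h] at hk; simpa using hk)
  obtain ⟨m, hm⟩ := Nat.exists_eq_succ_of_ne_zero hk0
  refine ⟨b ^ 2 ^ m, N.pow_mem b.2 _, Nat.find_min hex (by omega), ?_, fun d => ?_⟩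
  · rw [hm, Nat.succ_eq_add_one, pow_succ, pow_mul, sq] at hk
    exact hk
  · rw [mul_inv_eq_iff_eq_mul]
    exact (hcomm d).pow_right _

variable {G : Type} [Group G]

theorem exists_mem_centralizing_mod [Finite G] {D A K : Subgroup G} (hD : IsPGroup 2 D) (hAK : A ≤ K)
    (hKD : K ≤ D) (hA : ∀ d ∈ D, ∀ a ∈ A, d * a * d⁻¹ ∈ A) (hK : ∀ d ∈ D, ∀ a ∈ K, d * a * d⁻¹ ∈ K)
    (hne : A ≠ K) :
    ∃ b ∈ K, b ∉ A ∧ b * b ∈ A ∧ ∀ d ∈ D, d * b * d⁻¹ * b⁻¹ ∈ A := by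
  have : (A.subgroupOf D).Normal := ⟨fun a ha d => hA d d.2 a ha⟩
  have : (K.subgroupOf D).Normal := ⟨fun a ha d => hK d d.2 a ha⟩
  let π := QuotientGroup.mk' (A.subgroupOf D)
  have hmem (x : D) (hx : π x = 1) : (x : G) ∈ A := (QuotientGroup.eq_one_iff x).mp hx
  have hπ : Function.Surjective π := QuotientGroup.mk'_surjective _
  have hN : ((K.subgroupOf D).map π).Normal := Subgroup.Normal.map inferInstance π hπ
  have hNbot : (K.subgroupOf D).map π ≠ ⊥ := by
    intro h
    refine hne (le_antisymm hAK fun k hk => ?_)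
    have : π ⟨k, hKD hk⟩ ∈ (K.subgroupOf D).map π := Subgroup.mem_map_of_mem π hk
    rw [h, Subgroup.mem_bot] at this
    exact hmem _ this
  obtain ⟨β, ⟨b, hbK, rfl⟩, hβ1, hβ2, hβc⟩ :=
    exists_central_involution (hD.to_quotient (A.subgroupOf D)) _ hNbot
  refine ⟨b, hbK, fun h => hβ1 ((QuotientGroup.eq_one_iff (N := A.subgroupOf D) b).mpr h), ?_, fun d hd => ?_⟩
  · rw [← map_mul] at hβ2
    exact hmem _ hβ2
  · have := hβc (π ⟨d, hd⟩)
    rw [← mul_inv_eq_one, ← map_inv, ← map_inv, ← map_mul, ← map_mul, ← map_mul] at this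
    exact hmem _ this

theorem exists_conj_mem_of_isPGroup [Finite G] {H D : Subgroup G} (hD : IsPGroup 2 D)
    (hidx : ¬ 2 ∣ D.relIndex H) (hDH : D ≤ H) {u : G} (huH : u ∈ H) {k : ℕ} (hu : u ^ 2 ^ k = 1) :
    ∃ h ∈ H, h * u * h⁻¹ ∈ D := by
  have hD' : IsPGroup 2 (D.subgroupOf H) :=
    hD.of_equiv (Subgroup.subgroupOfEquivOfLe hDH).symm
  let P : Sylow 2 H := hD'.toSylow hidx
  let v : H := ⟨u, huH⟩
  have hv : v ^ 2 ^ k = 1 := Subtype.ext hu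
  have hU : IsPGroup 2 (Subgroup.zpowers v) := by
    rintro ⟨_, n, rfl⟩
    refine ⟨k, Subtype.ext ?_⟩
    change (v ^ n) ^ 2 ^ k = 1
    rw [← zpow_natCast, ← _root_.zpow_mul, mul_comm, _root_.zpow_mul, zpow_natCast, hv,
      _root_.one_zpow]
  obtain ⟨Q, hQ⟩ := hU.exists_le_sylow
  obtain ⟨h, hh⟩ := MulAction.exists_smul_eq H Q P
  refine ⟨h, h.2, ?_⟩
  have h1 : h * v * h⁻¹ ∈ P := by
    rw [← hh, Sylow.smul_def]
    exact ⟨v, hQ (Subgroup.mem_zpowers v), rfl⟩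
  exact h1

theorem exists_sylow_subgroup [Finite G] (H : Subgroup G) :
    ∃ D ≤ H, IsPGroup 2 D ∧ ¬ 2 ∣ D.relIndex H := by
  let P : Sylow 2 H := default
  refine ⟨(P : Subgroup H).map H.subtype, Subgroup.map_subtype_le _,
    P.2.map H.subtype, ?_⟩
  rw [Subgroup.relIndex, Subgroup.subgroupOf, Subgroup.comap_map_eq_self_of_injective
    H.subtype_injective]
  exact P.not_dvd_index

/-- A finite abelian `2`-group with at most one involution is cyclic. -/
theorem isCyclic_of_sq_eq_one {A : Type} [Group A] [Finite A] (hA : IsPGroup 2 A)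
    (hc : ∀ a b : A, a * b = b * a) (z : A) (hz : ∀ a : A, a * a = 1 → a = 1 ∨ a = z) :
    IsCyclic A := by
  have := Fintype.ofFinite A
  have key : ∀ k, Finset.card {a : A | a ^ 2 ^ k = 1} ≤ 2 ^ k := by
    intro k
    induction k with
    | zero => simp [Finset.card_le_one]
    | succ k ih =>
      rw [show 2 ^ (k + 1) = 2 * 2 ^ k from pow_succ' 2 k]
      refine (Finset.card_le_mul_card_image_of_maps_to (f := fun a => a * a)
        (t := {a : A | a ^ 2 ^ k = 1}) (fun a ha => ?_) 2 fun b _ => ?_).trans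
        (Nat.mul_le_mul_left 2 ih)
      · simp only [Finset.mem_filter, Finset.mem_univ, true_and] at ha ⊢
        rw [← sq, ← pow_mul, ha]
      · by_cases hb : ∃ a : A, a * a = b
        · obtain ⟨a0, rfl⟩ := hb
          refine (Finset.card_le_card (t := {a0, a0 * z}) fun a ha => ?_).trans Finset.card_le_two
          have ha := (Finset.mem_filter.mp ha).2
          have : a0⁻¹ * a * (a0⁻¹ * a) = 1 := by
            rw [mul_assoc, ← mul_assoc a, hc a, mul_assoc a0⁻¹ a a, ha]; group
          rcases hz _ this with h | h
          · rw [inv_mul_eq_one.mp h]; simp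
          · rw [inv_mul_eq_iff_eq_mul.mp h]; simp
        · rw [Finset.card_eq_zero.mpr]
          · omega
          · rw [Finset.filter_eq_empty_iff]
            exact fun a _ h => hb ⟨a, h⟩
  refine isCyclic_of_card_pow_eq_one_le fun n hn => ?_
  obtain ⟨k, m, hm, rfl⟩ := Nat.exists_eq_two_pow_mul_odd hn.ne'
  refine (Finset.card_le_card fun a ha => ?_).trans
    ((key k).trans (Nat.le_mul_of_pos_right _ hm.pos))
  simp only [Finset.mem_filter, Finset.mem_univ, true_and] at ha ⊢
  obtain ⟨s, hs⟩ := hA a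
  have h1 : orderOf (a ^ 2 ^ k) ∣ m := orderOf_dvd_of_pow_eq_one (by rw [← pow_mul, ha])
  have h2 : orderOf (a ^ 2 ^ k) ∣ 2 ^ s := orderOf_dvd_of_pow_eq_one (by
    rw [← pow_mul, mul_comm, pow_mul, hs, one_pow])
  exact orderOf_eq_one_iff.mp
    (Nat.eq_one_of_dvd_coprimes (Nat.Coprime.pow_left s (Nat.coprime_two_left.mpr hm)) h2 h1)

end TwoGroups

section TwoGroups

variable {G : Type} [Group G]

theorem eq_one_of_zpow_odd_eq_one {u : G} {n : ℤ} {k : ℕ} (h1 : u ^ (2 * n + 1) = 1)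
    (h2 : u ^ 2 ^ k = 1) : u = 1 := by
  obtain ⟨a, b, hab⟩ : IsCoprime (2 * n + 1) ((2 : ℤ) ^ k) :=
    IsCoprime.pow_right ⟨1, -n, by ring⟩
  have h3 : u ^ ((2 : ℤ) ^ k) = 1 := by exact_mod_cast h2
  rw [← zpow_one u, ← hab, _root_.zpow_add, mul_comm a, mul_comm b, _root_.zpow_mul,
    _root_.zpow_mul, h1, h3]
  simp

theorem mem_of_maximal_abelian_normal {D D0 A : Subgroup G}
    (hmax : ∀ A' : Subgroup G, A ≤ A' → A' ≤ D0 → (∀ a ∈ A', ∀ b ∈ A', a * b = b * a) →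
      (∀ d ∈ D, ∀ a ∈ A', d * a * d⁻¹ ∈ A') → A' ≤ A)
    (hAD : A ≤ D0) (hc : ∀ a ∈ A, ∀ b ∈ A, a * b = b * a) (hn : ∀ d ∈ D, ∀ a ∈ A, d * a * d⁻¹ ∈ A)
    {b : G} (hb : b ∈ D0) (hbA : ∀ a ∈ A, a * b = b * a) (hbD : ∀ d ∈ D, d * b * d⁻¹ * b⁻¹ ∈ A) :
    b ∈ A := by
  have hAle : A ≤ Subgroup.closure (A ∪ {b}) := fun a ha => Subgroup.subset_closure (Or.inl ha)
  have hbmem : b ∈ Subgroup.closure ((A : Set G) ∪ {b}) := Subgroup.subset_closure (Or.inr rfl)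
  refine hmax (Subgroup.closure (A ∪ {b})) hAle
    ((Subgroup.closure_le _).mpr ?_) ?_ (fun d hd => ?_) hbmem
  · rintro x (hx | rfl)
    exacts [hAD hx, hb]
  · have h1 : Subgroup.closure ((A : Set G) ∪ {b}) ≤ Subgroup.centralizer ((A : Set G) ∪ {b}) := by
      refine (Subgroup.closure_le _).mpr ?_
      rintro x (hx | rfl) y (hy | rfl)
      exacts [hc y hy x hx, (hbA x hx).symm, hbA y hy, rfl]
    have h2 : Subgroup.closure ((A : Set G) ∪ {b}) ≤
        Subgroup.centralizer (Subgroup.closure ((A : Set G) ∪ {b}) : Set G) :=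
      (Subgroup.closure_le_centralizer_centralizer _).trans (Subgroup.centralizer_le h1)
    exact fun x hx y hy => h2 hy x hx
  · have : Subgroup.closure ((A : Set G) ∪ {b}) ≤
        (Subgroup.closure ((A : Set G) ∪ {b})).comap (MulAut.conj d).toMonoidHom := by
      refine (Subgroup.closure_le _).mpr ?_
      rintro x (hx | rfl)
      · exact hAle (hn d hd x hx)
      · have := mul_mem (hAle (hbD d hd)) hbmem
        rwa [_root_.inv_mul_cancel_right] at this
    exact fun a ha => this ha

variable [Finite G] {D D0 : Subgroup G} {z : G}

theorem exists_maximal_abelian_normal (D D0 : Subgroup G) :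
    ∃ A : Subgroup G, A ≤ D0 ∧ (∀ a ∈ A, ∀ b ∈ A, a * b = b * a) ∧
      (∀ d ∈ D, ∀ a ∈ A, d * a * d⁻¹ ∈ A) ∧
      ∀ A' : Subgroup G, A ≤ A' → A' ≤ D0 → (∀ a ∈ A', ∀ b ∈ A', a * b = b * a) →
      (∀ d ∈ D, ∀ a ∈ A', d * a * d⁻¹ ∈ A') → A' ≤ A := by
  obtain ⟨A, -, hA⟩ := (Set.toFinite {A : Subgroup G | A ≤ D0 ∧
    (∀ a ∈ A, ∀ b ∈ A, a * b = b * a) ∧ ∀ d ∈ D, ∀ a ∈ A, d * a * d⁻¹ ∈ A}).exists_le_maximal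
    (a := ⊥) ⟨bot_le, by simp [Subgroup.mem_bot], by simp [Subgroup.mem_bot]⟩
  exact ⟨A, hA.1.1, hA.1.2.1, hA.1.2.2, fun A' h1 h2 h3 h4 => hA.2 ⟨h2, h3, h4⟩ h1⟩

/-- The alternative to the existence of a non-central involution that is fixed by `D` up to
multiplication by `z`: the group `D0` has a cyclic subgroup of index at most two which is
normalized by `D`. -/
theorem exists_cyclic_of_no_involution (hD : IsPGroup 2 D) (hD0 : D0 ≤ D)
    (hn0 : ∀ d ∈ D, ∀ a ∈ D0, d * a * d⁻¹ ∈ D0) (hz0 : z ∈ D0) (hz2 : z * z = 1) (hz1 : z ≠ 1)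
    (hzc : ∀ g, g * z = z * g)
    (hno : ∀ t ∈ D0, t * t = 1 → t ≠ 1 → t ≠ z →
      ∃ d ∈ D, d * t * d⁻¹ ≠ t ∧ d * t * d⁻¹ ≠ z * t) :
    ∃ c ∈ D0, (∀ d ∈ D, d * c * d⁻¹ ∈ Subgroup.zpowers c) ∧
      ∃ b ∈ D0, ∀ g ∈ D0, g ∈ Subgroup.zpowers c ∨ g * b⁻¹ ∈ Subgroup.zpowers c := by
  obtain ⟨A, hAD, hAc, hAn, hmax⟩ := exists_maximal_abelian_normal D D0
  have hstar {b : G} := mem_of_maximal_abelian_normal (b := b) hmax hAD hAc hAn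
  have hzA : z ∈ A := hstar hz0 (fun a _ => hzc a) fun d _ => by
    rw [hzc d]; simp
  have hzz : z⁻¹ = z := inv_eq_of_mul_eq_one_left hz2
  have hzpow : ∀ x ∈ Subgroup.zpowers z, x = 1 ∨ x = z := by
    rintro _ ⟨n, rfl⟩
    rcases Int.even_or_odd' n with ⟨k, rfl | rfl⟩
    · left; simp only [_root_.zpow_mul, zpow_two, hz2, _root_.one_zpow]
    · right; simp only [_root_.zpow_mul, zpow_two, hz2, _root_.one_zpow, _root_.zpow_add, zpow_one, one_mul]
  have hinv : ∀ a ∈ A, a * a = 1 → a = 1 ∨ a = z := by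
    intro a ha ha2
    by_contra hcon
    let K : Subgroup G :=
      { carrier := {a | a ∈ A ∧ a * a = 1}
        one_mem' := ⟨one_mem A, one_mul 1⟩
        mul_mem' := fun {a b} h1 h2 => ⟨mul_mem h1.1 h2.1, by
          rw [mul_assoc, ← mul_assoc b, hAc b h2.1 a h1.1, mul_assoc a b b, h2.2, mul_one, h1.2]⟩
        inv_mem' := fun {a} h => ⟨inv_mem h.1, by
          rw [← _root_.mul_inv_rev, h.2, inv_one]⟩ }
    obtain ⟨t, htK, htz, -, htd⟩ := exists_mem_centralizing_mod (A := Subgroup.zpowers z) (K := K)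
      hD ((Subgroup.zpowers_le).mpr ⟨hzA, hz2⟩) (fun x hx => hD0 (hAD hx.1))
      (fun d _ x hx => by
        rcases hzpow x hx with rfl | rfl
        · simp
        · rw [hzc, _root_.mul_inv_cancel_right]; exact hx)
      (fun d hd x hx => ⟨hAn d hd x hx.1, by
        rw [conj_mul, hx.2]; simp⟩)
      (fun h => hcon (hzpow a (h ▸ ⟨ha, ha2⟩)))
    obtain ⟨d, hd, h1, h2⟩ := hno t (hAD htK.1) htK.2
      (fun h => htz (h ▸ one_mem _)) (fun h => htz (h ▸ Subgroup.mem_zpowers z))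
    rcases hzpow _ (htd d hd) with h | h
    · exact h1 (mul_inv_eq_one.mp h)
    · exact h2 (mul_inv_eq_iff_eq_mul.mp h)
  have hcyc : IsCyclic A := isCyclic_of_sq_eq_one (hD.to_le (hAD.trans hD0))
    (fun a b => Subtype.ext (hAc a a.2 b b.2)) ⟨z, hzA⟩ fun a ha => by
      rcases hinv a a.2 (congrArg Subtype.val ha) with h | h
      exacts [Or.inl (Subtype.ext h), Or.inr (Subtype.ext h)]
  obtain ⟨c, rfl⟩ := (Subgroup.isCyclic_iff_exists_zpowers_eq_top A).mp hcyc
  have hcA := Subgroup.mem_zpowers c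
  have hcD := hAD hcA
  have hcent : ∀ b ∈ D0, b * c = c * b → b ∈ Subgroup.zpowers c := by
    intro b hb hbc
    have hcomm {b : G} (hbc : b * c = c * b) : ∀ a ∈ Subgroup.zpowers c, a * b = b * a := by
      rintro _ ⟨n, rfl⟩
      exact ((show Commute b c from hbc).zpow_right n).eq.symm
    by_contra hbA
    have hK : ∀ d ∈ D, ∀ a ∈ D0 ⊓ Subgroup.centralizer (Subgroup.zpowers c : Set G),
        d * a * d⁻¹ ∈ D0 ⊓ Subgroup.centralizer (Subgroup.zpowers c : Set G) := by
      rintro d hd a ⟨ha, hac⟩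
      refine ⟨hn0 d hd a ha, fun x hx => ?_⟩
      have := hac _ (hAn d⁻¹ (inv_mem hd) x hx)
      rw [inv_inv] at this
      calc x * (d * a * d⁻¹) = d * (d⁻¹ * x * d * a) * d⁻¹ := by group
        _ = _ := by rw [this]; group
    obtain ⟨b', hb', hb'A, -, hb'd⟩ := exists_mem_centralizing_mod
      (K := D0 ⊓ Subgroup.centralizer (Subgroup.zpowers c : Set G)) hD
      (fun a ha => ⟨hAD ha, fun x hx => hAc x hx a ha⟩) (inf_le_left.trans hD0) hAn hK
      (fun h => hbA (h ▸ ⟨hb, hcomm hbc⟩))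
    exact hb'A (hstar hb'.1 hb'.2 hb'd)
  refine ⟨c, hcD, fun d hd => hAn d hd c hcA, ?_⟩
  obtain ⟨k, hk⟩ := (IsPGroup.iff_orderOf.mp hD) ⟨c, hD0 hcD⟩
  rw [Subgroup.orderOf_mk] at hk
  have hck : c ^ 2 ^ k = 1 := hk ▸ pow_orderOf_eq_one c
  by_cases hk2 : k < 2
  · have hc2 : c * c = 1 := by
      rw [← sq]
      exact orderOf_dvd_iff_pow_eq_one.mp (hk ▸ pow_dvd_pow 2 (by omega) : orderOf c ∣ 2 ^ 1)
    refine ⟨1, one_mem _, fun g hg => Or.inl (hcent g hg ?_)⟩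
    rcases hinv c hcA hc2 with h | h
    · rw [h]; simp
    · rw [h]; exact hzc g
  obtain ⟨l, rfl⟩ : ∃ l, k = l + 2 := ⟨k - 2, by omega⟩
  obtain ⟨w, hw⟩ : ∃ w, w = c ^ 2 ^ l := ⟨_, rfl⟩
  have hwA : w ∈ Subgroup.zpowers c := hw ▸ pow_mem hcA _
  have hw2 : w * w = z := by
    have h4 : (w * w) * (w * w) = 1 := by
      rw [hw, ← pow_add, ← pow_add, ← hck]
      congr 1
      rw [pow_add]; ring
    refine (hinv _ (mul_mem hwA hwA) h4).resolve_left fun h => ?_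
    rw [hw, ← pow_add] at h
    have := orderOf_dvd_of_pow_eq_one h
    rw [hk, pow_add] at this
    have := Nat.le_of_dvd (by positivity) this
    have : 0 < 2 ^ l := by positivity
    omega
  have hroot : ∀ a ∈ Subgroup.zpowers c, a * a = z → a = w ∨ a = z * w := by
    intro a ha ha2
    have : a * w⁻¹ * (a * w⁻¹) = 1 := by
      rw [mul_assoc, ← mul_assoc w⁻¹, hAc w⁻¹ (inv_mem hwA) a ha, mul_assoc a w⁻¹, ← mul_assoc a a,
        ha2, ← _root_.mul_inv_rev, hw2, _root_.mul_inv_cancel]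
    rcases hinv _ (mul_mem ha (inv_mem hwA)) this with h | h
    exacts [Or.inl (mul_inv_eq_one.mp h), Or.inr (mul_inv_eq_iff_eq_mul.mp h)]
  have hwd : ∀ d ∈ D, d * w * d⁻¹ = w ∨ d * w * d⁻¹ = z * w := fun d hd =>
    hroot _ (hAn d hd w hwA) (by rw [conj_mul, hw2, hzc, _root_.mul_inv_cancel_right])
  have hwcent : ∀ b ∈ D0, b * w = w * b → b ∈ Subgroup.zpowers c := by
    intro b hb hbw
    by_contra hbA
    have hK : ∀ d ∈ D, ∀ a ∈ D0 ⊓ Subgroup.centralizer {w},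
        d * a * d⁻¹ ∈ D0 ⊓ Subgroup.centralizer {w} := by
      rintro d hd a ⟨ha, hac⟩
      refine ⟨hn0 d hd a ha, ?_⟩
      have hac : w * a = a * w := hac w rfl
      rintro x (hx : x = w)
      rw [hx]
      have h1 : (d * a * d⁻¹) * (d * w * d⁻¹) = (d * w * d⁻¹) * (d * a * d⁻¹) := by
        rw [conj_mul, conj_mul, hac]
      rcases hwd d hd with h | h
      · rw [h] at h1; exact h1.symm
      · rw [h, ← mul_assoc (d * a * d⁻¹), hzc, mul_assoc z, mul_assoc z] at h1
        exact (mul_left_cancel h1).symm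
    obtain ⟨b, ⟨hbD, hbw⟩, hbA, hbb, hbd⟩ := exists_mem_centralizing_mod
      (K := D0 ⊓ Subgroup.centralizer {w}) hD
      (fun a ha => ⟨hAD ha, by rintro _ rfl; exact hAc _ hwA a ha⟩) (inf_le_left.trans hD0) hAn hK
      (fun h => hbA (h ▸ ⟨hb, by rintro _ rfl; exact hbw.symm⟩))
    have hbw : w * b = b * w := hbw w rfl
    obtain ⟨i, hi⟩ := hAn b (hD0 hbD) c hcA
    have hi : b * c * b⁻¹ = c ^ i := hi.symm
    have hbcn (n : ℤ) : b * c ^ n * b⁻¹ = c ^ (i * n) := by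
      rw [← conj_zpow, hi, ← _root_.zpow_mul]
    have hi4 : (4 : ℤ) ∣ i - 1 := by
      have h1 : c ^ ((i - 1) * 2 ^ l) = 1 := by
        have := hbcn (2 ^ l)
        rw [show c ^ ((2 : ℤ) ^ l) = w by rw [hw]; exact_mod_cast rfl, ← hbw,
          _root_.mul_inv_cancel_right] at this
        rw [sub_mul, _root_.zpow_sub, ← this, one_mul, hw]
        simp [← zpow_natCast]
      have := orderOf_dvd_iff_zpow_eq_one.mpr h1
      rw [hk, pow_add] at this
      push_cast at this
      rw [mul_comm] at this
      exact Int.dvd_of_mul_dvd_mul_right (by positivity) this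
    obtain ⟨n, hn⟩ := hi4
    have hbbc : b * (b * c * b⁻¹) * b⁻¹ = c := by
      have := hAc _ hbb c hcA
      calc _ = (b * b * c) * (b * b)⁻¹ := by group
        _ = c := by rw [this]; group
    have hu2 : c ^ (i - 1) * c ^ (i - 1) = 1 := by
      have h1 : c ^ ((i - 1) * (i + 1)) = 1 := by
        rw [hi, hbcn] at hbbc
        rw [show (i - 1) * (i + 1) = i * i - 1 by ring, _root_.zpow_sub, hbbc]; simp
      rw [← zpow_two, ← _root_.zpow_mul]
      refine eq_one_of_zpow_odd_eq_one (n := n) (k := l + 2) ?_ ?_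
      · rw [← _root_.zpow_mul, ← h1]
        congr 1
        rw [show i = 4 * n + 1 by omega]; ring
      · rw [← zpow_natCast, ← _root_.zpow_mul, mul_comm, _root_.zpow_mul, zpow_natCast, hck,
          _root_.one_zpow]
    have hbc : b * c * b⁻¹ = z * c := by
      rw [hi, ← sub_add_cancel i 1, _root_.zpow_add, zpow_one]
      rcases hinv _ (zpow_mem hcA _) hu2 with h | h
      · refine absurd (hcent b hbD ?_) hbA
        rw [← sub_add_cancel i 1, _root_.zpow_add, zpow_one, h, one_mul] at hi
        exact mul_inv_eq_iff_eq_mul.mp hi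
      · rw [h]
    have hzn (n : ℤ) : (z * c) ^ n = z ^ n * c ^ n := (show Commute z c from (hzc c).symm).mul_zpow n
    obtain ⟨l', hl'⟩ : ∃ l' : ℤ, b * b = c ^ (2 * l') := by
      obtain ⟨e, he⟩ := hbb
      have he : c ^ e = b * b := he
      rcases Int.even_or_odd' e with ⟨f, rfl | rfl⟩
      · exact ⟨f, he.symm⟩
      · exfalso
        have h1 : b * c ^ (2 * f + 1) * b⁻¹ = c ^ (2 * f + 1) := by rw [he]; group
        rw [← conj_zpow, hbc, hzn, mul_eq_right, _root_.zpow_add, _root_.zpow_mul, zpow_two, hz2] at h1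
        exact hz1 (by simpa using h1)
    obtain ⟨s, hsA, hs⟩ : ∃ s ∈ Subgroup.zpowers c, (b * s) * (b * s) = 1 := by
      have h1 : (b * c ^ (-l')) * (b * c ^ (-l')) = z ^ (-l') := by
        calc (b * c ^ (-l')) * (b * c ^ (-l')) = (b * c ^ (-l') * b⁻¹) * (b * b) * c ^ (-l') := by
              group
          _ = z ^ (-l') := by
              rw [← conj_zpow, hbc, hzn, hl', mul_assoc, mul_assoc, ← _root_.zpow_add,
                ← _root_.zpow_add, show -l' + (2 * l' + -l') = 0 by ring, zpow_zero, mul_one]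
      rcases hzpow _ ⟨-l', h1.symm⟩ with h | h
      · exact ⟨_, zpow_mem hcA _, h⟩
      · refine ⟨c ^ (-l') * w, mul_mem (zpow_mem hcA _) hwA, ?_⟩
        have h2 : w * (b * c ^ (-l')) = (b * c ^ (-l')) * w := by
          rw [← mul_assoc, hbw, mul_assoc, mul_assoc, hAc w hwA _ (zpow_mem hcA _)]
        rw [← mul_assoc b, mul_assoc _ w, ← mul_assoc w, h2, mul_assoc _ w w, ← mul_assoc, h, hw2,
          hz2]
    have htA : b * s ∉ Subgroup.zpowers c := fun h =>
      hbA (by simpa using mul_mem h (inv_mem hsA))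
    obtain ⟨d, hd, h1, h2⟩ := hno (b * s) (mul_mem hbD (hAD hsA)) hs
      (fun h => htA (h ▸ one_mem _)) (fun h => htA (h ▸ hzA))
    obtain ⟨a, ha⟩ : ∃ a, a = d * (b * s) * d⁻¹ * (b * s)⁻¹ := ⟨_, rfl⟩
    have haA : a ∈ Subgroup.zpowers c := by
      have h3 : a = (d * b * d⁻¹ * b⁻¹) * (b * ((d * s * d⁻¹) * s⁻¹) * b⁻¹) := by rw [ha]; group
      rw [h3]
      exact mul_mem (hbd d hd) (hAn b (hD0 hbD) _ (mul_mem (hAn d hd s hsA) (inv_mem hsA)))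
    have hainv : b * a * b⁻¹ = a⁻¹ := by
      have h3 : (a * (b * s)) * (a * (b * s)) = 1 := by
        rw [ha, _root_.inv_mul_cancel_right, conj_mul, hs]; simp
      have h4 : b * a * b⁻¹ = (b * s) * a * (b * s)⁻¹ := by
        calc b * a * b⁻¹ = b * (a * s) * s⁻¹ * b⁻¹ := by group
          _ = _ := by rw [hAc a haA s hsA]; group
      rw [h4, show (b * s)⁻¹ = b * s from inv_eq_of_mul_eq_one_left hs]
      refine eq_inv_of_mul_eq_one_right ?_
      rw [← h3]; group
    have ha4 : (a * a) * (a * a) = 1 := by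
      obtain ⟨e, he⟩ := haA
      have he : c ^ e = a := he
      have h3 : a * a = z ^ (-e) := by
        have h4 : z ^ e * a = a⁻¹ := by rw [← hainv, ← he, ← conj_zpow, hbc, hzn]
        rw [_root_.zpow_neg, eq_inv_iff_mul_eq_one, mul_assoc,
          ← ((show Commute a z from hzc a).zpow_right e).eq.symm, h4, _root_.mul_inv_cancel]
      rcases hzpow _ ⟨-e, h3.symm⟩ with h | h
      · rw [h, mul_one]
      · rw [h, hz2]
    have ha2 : a * a = 1 := by
      refine (hinv _ (mul_mem haA haA) ha4).resolve_right fun h => hz1 ?_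
      have h5 : b * a * b⁻¹ = a := by
        rw [mul_inv_eq_iff_eq_mul]
        rcases hroot a haA h with h | h
        · rw [h, hbw]
        · rw [h, ← mul_assoc, hzc, mul_assoc, ← hbw, mul_assoc]
      rw [h5, eq_inv_iff_mul_eq_one, h] at hainv
      exact hainv
    rcases hinv a haA ha2 with h | h
    · exact h1 (mul_inv_eq_one.mp (ha ▸ h))
    · exact h2 (mul_inv_eq_iff_eq_mul.mp (ha ▸ h))
  by_cases hall : ∀ b ∈ D0, b * w = w * b
  · exact ⟨1, one_mem _, fun g hg => Or.inl (hwcent g hg (hall g hg))⟩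
  · push Not at hall
    obtain ⟨b, hb, hbw⟩ := hall
    refine ⟨b, hb, fun g hg => ?_⟩
    by_cases hgw : g * w = w * g
    · exact Or.inl (hwcent g hg hgw)
    right
    have key : ∀ b ∈ D0, b * w ≠ w * b → b * w * b⁻¹ = z * w := fun b hb h =>
      (hwd b (hD0 hb)).resolve_left fun h' => h (mul_inv_eq_iff_eq_mul.mp h')
    refine hwcent _ (mul_mem hg (inv_mem hb)) ?_
    have h1 := key b hb hbw
    have h2 := key g hg hgw
    have h3 : b⁻¹ * w * b = z * w := by
      calc b⁻¹ * w * b = b⁻¹ * (z * (z * w)) * b := by rw [← mul_assoc z, hz2, one_mul]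
        _ = b⁻¹ * (z * b) * w := by rw [← h1]; group
        _ = z * w := by rw [← hzc, _root_.inv_mul_cancel_left]
    calc g * b⁻¹ * w = g * (b⁻¹ * w * b) * b⁻¹ := by group
      _ = (g * z) * w * b⁻¹ := by rw [h3]; group
      _ = z * (g * w * g⁻¹) * g * b⁻¹ := by rw [hzc]; group
      _ = w * (g * b⁻¹) := by rw [h2, ← mul_assoc z, hz2, one_mul, mul_assoc]

end TwoGroups

section Involutions

variable {G : Type} [Group G]

/-- The elements of `G` conjugating `x` to `x` or `x⁻¹`. -/
def invCentralizer (x : G) : Subgroup G where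
  carrier := {g | g * x * g⁻¹ = x ∨ g * x * g⁻¹ = x⁻¹}
  one_mem' := by simp
  mul_mem' := by
    intro a b ha hb
    have h : a * b * x * (a * b)⁻¹ = a * (b * x * b⁻¹) * a⁻¹ := by group
    have h' : a * x⁻¹ * a⁻¹ = (a * x * a⁻¹)⁻¹ := by group
    rw [Set.mem_ofPred_eq, h]
    rcases ha with ha | ha <;> rcases hb with hb | hb <;> simp [ha, hb, h']
  inv_mem' := by
    intro a ha
    rcases ha with ha | ha
    · left
      conv_lhs => rw [← ha]
      group
    · right
      exact inv_conj_eq_inv_of_conj_eq_inv ha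

theorem mem_centralizer_singleton {x g : G} :
    g ∈ Subgroup.centralizer {x} ↔ g * x * g⁻¹ = x := by
  rw [Subgroup.mem_centralizer_singleton_iff, mul_inv_eq_iff_eq_mul]

theorem centralizer_le_invCentralizer (x : G) : Subgroup.centralizer {x} ≤ invCentralizer x :=
  fun _ h => Or.inl (mem_centralizer_singleton.mp h)

theorem conj_conj_eq_inv {x j h : G} (hj : j * x * j⁻¹ = x⁻¹) (hh : h ∈ invCentralizer x) :
    (h * j * h⁻¹) * x * (h * j * h⁻¹)⁻¹ = x⁻¹ := by
  have e : (h * j * h⁻¹) * x * (h * j * h⁻¹)⁻¹ = h * (j * (h⁻¹ * x * h⁻¹⁻¹) * j⁻¹) * h⁻¹ := by group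
  have e' : h * x⁻¹ * h⁻¹ = (h * x * h⁻¹)⁻¹ := by group
  rcases inv_mem hh with h1 | h1
  · rw [e, h1, hj]
    rcases hh with h2 | h2
    · rw [e', h2]
    · have : x⁻¹ = x := by
        rw [← h2]
        conv_lhs => rw [← h1]
        group
      rw [e', h2, inv_inv, this]
  · rw [e, h1, conj_inv_eq_self_of_conj_eq_inv hj]
    have := inv_conj_eq_inv_of_conj_eq_inv h1
    rwa [inv_inv] at this

theorem relIndex_centralizer_eq {H : Subgroup G} {x j : G} (hH : H ≤ invCentralizer x)
    (hj : j * x * j⁻¹ = x⁻¹) (hjH : j ∈ H) (hx : x⁻¹ ≠ x) :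
    (H ⊓ Subgroup.centralizer {x}).relIndex H = 2 := by
  refine Subgroup.relIndex_eq_two_iff.mpr ⟨j, hjH, fun b hb => ?_⟩
  have e : b * j * x * (b * j)⁻¹ = (b * x * b⁻¹)⁻¹ := by
    calc b * j * x * (b * j)⁻¹ = b * (j * x * j⁻¹) * b⁻¹ := by group
      _ = _ := by rw [hj]; group
  have e1 : b * j ∈ H ⊓ Subgroup.centralizer {x} ↔ (b * x * b⁻¹)⁻¹ = x := by
    rw [Subgroup.mem_inf, mem_centralizer_singleton, e]
    exact and_iff_right (mul_mem hb hjH)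
  have e2 : b ∈ H ⊓ Subgroup.centralizer {x} ↔ b * x * b⁻¹ = x := by
    rw [Subgroup.mem_inf, mem_centralizer_singleton]
    exact and_iff_right hb
  rw [e1, e2]
  rcases hH hb with h | h
  · exact Or.inr ⟨h, by rw [h]; exact hx⟩
  · exact Or.inl ⟨by rw [h, inv_inv], by rw [h]; exact hx⟩

theorem odd_relIndex_centralizer {D : Subgroup G} {x j : G} (hD : D ≤ invCentralizer x)
    (hidx : ¬ 2 ∣ D.relIndex (invCentralizer x)) (hj : j * x * j⁻¹ = x⁻¹) (hjD : j ∈ D) :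
    Odd ((D ⊓ Subgroup.centralizer {x}).relIndex (Subgroup.centralizer {x})) := by
  rw [← Nat.not_even_iff_odd, even_iff_two_dvd]
  by_cases hx : x⁻¹ = x
  · have h : Subgroup.centralizer {x} = invCentralizer x :=
      le_antisymm (centralizer_le_invCentralizer x) fun g hg => by
        rw [mem_centralizer_singleton]
        rcases hg with h | h
        · exact h
        · rw [h, hx]
    rwa [Subgroup.inf_relIndex_right, h]
  · have h1 := Subgroup.relIndex_mul_relIndex _ _ _
      (inf_le_right : D ⊓ Subgroup.centralizer {x} ≤ _) (centralizer_le_invCentralizer x)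
    have h2 := Subgroup.relIndex_mul_relIndex _ _ _
      (inf_le_left : D ⊓ Subgroup.centralizer {x} ≤ _) hD
    have h3 := relIndex_centralizer_eq le_rfl hj (hD hjD) hx
    rw [inf_eq_right.mpr (centralizer_le_invCentralizer x)] at h3
    rw [relIndex_centralizer_eq hD hj hjD hx] at h2
    rw [h3, ← h2, mul_comm] at h1
    rwa [Nat.eq_of_mul_eq_mul_left two_pos h1]

theorem exists_zpow_mul_eq {x c : G} (hxc : Commute x c) (hx : Odd (orderOf x)) {k : ℕ}
    (hc : c ^ 2 ^ k = 1) : (∃ e : ℤ, (x * c) ^ e = x) ∧ ∃ f : ℤ, (x * c) ^ f = c := by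
  have h1 : IsCoprime ((orderOf x : ℕ) : ℤ) ((2 ^ k : ℕ) : ℤ) :=
    Nat.isCoprime_iff_coprime.mpr (Nat.Coprime.pow_right k (Nat.coprime_two_right.mpr hx))
  obtain ⟨a, b, hab⟩ := h1
  have hx1 : x ^ (a * (orderOf x : ℤ)) = 1 := by
    rw [mul_comm, _root_.zpow_mul, zpow_natCast, pow_orderOf_eq_one, _root_.one_zpow]
  have hc1 : c ^ (b * ((2 ^ k : ℕ) : ℤ)) = 1 := by
    rw [mul_comm, _root_.zpow_mul, zpow_natCast, hc, _root_.one_zpow]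
  have hx2 : x ^ (b * ((2 ^ k : ℕ) : ℤ)) = x := by
    conv_rhs => rw [← zpow_one x, ← hab, _root_.zpow_add, hx1, one_mul]
  have hc2 : c ^ (a * (orderOf x : ℤ)) = c := by
    conv_rhs => rw [← zpow_one c, ← hab, _root_.zpow_add, hc1, mul_one]
  exact ⟨⟨_, by rw [hxc.mul_zpow, hx2, hc1, mul_one]⟩, ⟨_, by rw [hxc.mul_zpow, hx1, hc2, one_mul]⟩⟩

theorem mem_zpowers_sup {y : G} {H : Subgroup G} (hH : ∀ d ∈ H, d * y * d⁻¹ ∈ Subgroup.zpowers y)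
    (g : G) : g ∈ Subgroup.zpowers y ⊔ H ↔ ∃ k : ℤ, ∃ d ∈ H, g = y ^ k * d := by
  have hH' : ∀ d ∈ H, ∀ a ∈ Subgroup.zpowers y, d * a * d⁻¹ ∈ Subgroup.zpowers y := by
    rintro d hd _ ⟨n, rfl⟩
    change d * y ^ n * d⁻¹ ∈ _
    rw [← conj_zpow]
    exact zpow_mem (hH d hd) n
  have hle : H ≤ Subgroup.normalizer (Subgroup.zpowers y : Set G) := fun d hd =>
    Subgroup.mem_normalizer_iff.mpr fun a => ⟨hH' d hd a, fun h => by
      have := hH' d⁻¹ (inv_mem hd) _ h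
      rwa [show d⁻¹ * (d * a * d⁻¹) * d⁻¹⁻¹ = a by group] at this⟩
  rw [← SetLike.mem_coe, Subgroup.coe_mul_of_right_le_normalizer_left _ _ hle, Set.mem_mul]
  constructor
  · rintro ⟨_, ⟨k, rfl⟩, d, hd, rfl⟩
    exact ⟨k, d, hd, rfl⟩
  · rintro ⟨k, d, hd, rfl⟩
    exact ⟨_, ⟨k, rfl⟩, d, hd, rfl⟩

variable [Finite G]

theorem card_le_two_mul_of_subset {N E : Subgroup G} {b : G}
    (h : ∀ g ∈ E, g ∈ N ∨ g * b⁻¹ ∈ N) : Nat.card E ≤ 2 * Nat.card N := by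
  have h1 : (E : Set G) ⊆ (N : Set G) ∪ (fun n => n * b) '' (N : Set G) := fun g hg =>
    (h g hg).imp id fun h => ⟨_, h, by simp⟩
  calc Nat.card E = (E : Set G).ncard := rfl
    _ ≤ _ := Set.ncard_le_ncard h1 (Set.toFinite _)
    _ ≤ _ := Set.ncard_union_le _ _
    _ ≤ (N : Set G).ncard + (N : Set G).ncard :=
      Nat.add_le_add_left (Set.ncard_image_le (Set.toFinite _)) _
    _ = 2 * Nat.card N := by rw [two_mul]; rfl

/-- A group generated by a cyclic subgroup and a group `D` normalizing it has no symplectic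
representations if it is twice as large as a dihedral subgroup. -/
theorem noSymplectic_zpowers_sup {D : Subgroup G} {y j b : G}
    (hD : ∀ d ∈ D, d * y * d⁻¹ ∈ Subgroup.zpowers y) (hjD : j ∈ D) (hj : j * j = 1)
    (hy : j * y * j⁻¹ = y⁻¹)
    (h : ∀ d ∈ D, (d ∈ Subgroup.zpowers y ∨ d * b⁻¹ ∈ Subgroup.zpowers y) ∨
      j * d ∈ Subgroup.zpowers y ∨ j * d * b⁻¹ ∈ Subgroup.zpowers y) :
    NoSymplectic ↥(Subgroup.zpowers y ⊔ D) := by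
  have hjz : ∀ d ∈ Subgroup.zpowers j, d * y * d⁻¹ ∈ Subgroup.zpowers y := by
    intro d hd
    exact hD d ((Subgroup.zpowers_le.mpr hjD) hd)
  have hle : Subgroup.zpowers y ⊔ Subgroup.zpowers j ≤ Subgroup.zpowers y ⊔ D :=
    sup_le_sup_left (Subgroup.zpowers_le.mpr hjD) _
  have hyN : y ∈ Subgroup.zpowers y ⊔ Subgroup.zpowers j :=
    (le_sup_left : Subgroup.zpowers y ≤ _) (Subgroup.mem_zpowers y)
  have hjN : j ∈ Subgroup.zpowers y ⊔ Subgroup.zpowers j :=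
    (le_sup_right : Subgroup.zpowers j ≤ _) (Subgroup.mem_zpowers j)
  have hall : ∀ n : ↥(Subgroup.zpowers y ⊔ Subgroup.zpowers j), ∃ k : ℤ,
      n = (⟨y, hyN⟩ : ↥(Subgroup.zpowers y ⊔ Subgroup.zpowers j)) ^ k ∨
      n = (⟨y, hyN⟩ : ↥(Subgroup.zpowers y ⊔ Subgroup.zpowers j)) ^ k * ⟨j, hjN⟩ := by
    rintro ⟨g, hg⟩
    obtain ⟨k, _, ⟨n, rfl⟩, rfl⟩ := (mem_zpowers_sup hjz g).mp hg
    refine ⟨k, ?_⟩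
    rcases Int.even_or_odd' n with ⟨m, rfl | rfl⟩
    · left
      exact Subtype.ext (by simp [_root_.zpow_mul, (sq j).trans hj])
    · right
      exact Subtype.ext (by simp [_root_.zpow_add, _root_.zpow_mul, (sq j).trans hj])
  refine NoSymplectic.of_injective_of_card_le (Subgroup.inclusion hle)
    (Subgroup.inclusion_injective hle)
    (noSymplectic_of_dihedral _ _ (Subtype.ext hj) (Subtype.ext hy) hall)
    (isRealGroup_of_dihedral _ _ (Subtype.ext hj) (Subtype.ext hy) hall)
    (card_le_two_mul_of_subset (b := b) fun g hg => ?_)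
  obtain ⟨k, d, hd, rfl⟩ := (mem_zpowers_sup hD g).mp hg
  have hyk : y ^ k ∈ Subgroup.zpowers y ⊔ Subgroup.zpowers j := zpow_mem hyN k
  have hle' : Subgroup.zpowers y ≤ Subgroup.zpowers y ⊔ Subgroup.zpowers j := le_sup_left
  have hjj (d : G) : j * (j * d) = d := by rw [← mul_assoc, hj, one_mul]
  rcases h d hd with (h | h) | h | h
  · exact Or.inl (mul_mem hyk (hle' h))
  · exact Or.inr (by rw [mul_assoc]; exact mul_mem hyk (hle' h))
  · exact Or.inl (mul_mem hyk (by simpa only [hjj] using mul_mem hjN (hle' h)))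
  · refine Or.inr ?_
    rw [mul_assoc]
    exact mul_mem hyk (by simpa only [mul_assoc, hjj] using mul_mem hjN (hle' h))

theorem NoSymplectic.of_involutions {z : G} (hz2 : z * z = 1) (hz1 : z ≠ 1)
    (hzc : ∀ g, g * z = z * g) (hinv : ∀ y : G, ∃ j, j * j = 1 ∧ j * y * j⁻¹ = y⁻¹)
    (hE : ∀ t : G, t * t = 1 → t ≠ 1 → t ≠ z → ∀ E : Subgroup G,
      (∀ g, g ∈ E ↔ g * t * g⁻¹ = t ∨ g * t * g⁻¹ = z * t) → NoSymplectic E) :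
    NoSymplectic G := by
  refine NoSymplectic.of_local (fun y => (hinv y).imp fun _ h => h.2) fun x hx => ?_
  obtain ⟨D, hDC, hDp, hDidx⟩ := exists_sylow_subgroup (invCentralizer x)
  have hzz : ∀ g, g * z * g⁻¹ = z := fun g => by rw [hzc, _root_.mul_inv_cancel_right]
  have hzD : z ∈ D := by
    obtain ⟨h, -, hh⟩ := exists_conj_mem_of_isPGroup hDp hDidx hDC (u := z) (k := 1)
      (Or.inl (by rw [← hzc, _root_.mul_inv_cancel_right])) (by rw [pow_one, sq, hz2])
    rwa [hzz] at hh
  have hconj : ∀ j ∈ invCentralizer x, j * j = 1 → ∀ H ≤ invCentralizer x, D ≤ H → j ∈ H →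
      ∃ h ∈ H, h * j * h⁻¹ ∈ D := by
    intro j _ hj H hH hDH hjH
    have : ¬ 2 ∣ D.relIndex H := fun h => hDidx
      (Subgroup.relIndex_mul_relIndex D H _ hDH hH ▸ h.mul_right _)
    exact exists_conj_mem_of_isPGroup hDp this hDH hjH (k := 1) (by rw [pow_one, sq, hj])
  have hn0 : ∀ d ∈ D, ∀ a ∈ D ⊓ Subgroup.centralizer {x},
      d * a * d⁻¹ ∈ D ⊓ Subgroup.centralizer {x} := by
    rintro d hd a ⟨ha, hac⟩
    refine ⟨D.mul_mem (D.mul_mem hd ha) (D.inv_mem hd), mem_centralizer_singleton.mpr ?_⟩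
    have hac := mem_centralizer_singleton.mp hac
    have e : (d * a * d⁻¹) * x * (d * a * d⁻¹)⁻¹ = d * (a * (d⁻¹ * x * d⁻¹⁻¹) * a⁻¹) * d⁻¹ := by
      group
    have e1 : a * x⁻¹ * a⁻¹ = (a * x * a⁻¹)⁻¹ := by group
    have e2 : d * (d⁻¹ * x * d⁻¹⁻¹) * d⁻¹ = x := by group
    rcases inv_mem (hDC hd) with h | h
    · rw [h] at e e2
      rw [e, hac, e2]
    · rw [h] at e e2
      rw [e, e1, hac, e2]
  have main : ∀ (E : Subgroup G) (j : G), j ∈ D → j ∈ E → j * x * j⁻¹ = x⁻¹ → x ∈ E →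
      D ⊓ Subgroup.centralizer {x} ≤ E → NoSymplectic E → ∃ (P E : Subgroup G) (j : G),
      IsPGroup 2 P ∧ P ≤ Subgroup.centralizer {x} ∧
      Odd (P.relIndex (Subgroup.centralizer {x})) ∧ x ∈ E ∧ P ≤ E ∧
      j ∈ E ∧ (∀ t, j * t * j⁻¹ ∈ P ↔ t ∈ P) ∧ j * x * j⁻¹ = x⁻¹ ∧ NoSymplectic E := by
    intro E j hjD hjE hj hxE hle hNE
    refine ⟨D ⊓ Subgroup.centralizer {x}, E, j, hDp.to_le inf_le_left, inf_le_right,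
      odd_relIndex_centralizer hDC hDidx hj hjD, hxE, hle, hjE, fun t => ⟨fun h => ?_,
        hn0 j hjD t⟩, hj, hNE⟩
    have := hn0 j⁻¹ (inv_mem hjD) _ h
    rwa [show j⁻¹ * (j * t * j⁻¹) * j⁻¹⁻¹ = t by group] at this
  by_cases hI : ∃ t ∈ D ⊓ Subgroup.centralizer {x}, t * t = 1 ∧ t ≠ 1 ∧ t ≠ z ∧
      ∀ d ∈ D, d * t * d⁻¹ = t ∨ d * t * d⁻¹ = z * t
  · obtain ⟨t, ⟨htD, htx⟩, ht2, ht1, htz, ht⟩ := hI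
    obtain ⟨j0, hj02, hj0⟩ := hinv x
    obtain ⟨h, hh, hjD⟩ := hconj j0 (Or.inr hj0) hj02 _ le_rfl hDC (Or.inr hj0)
    have hzt (a : G) : a * (z * t) * a⁻¹ = z * (a * t * a⁻¹) := by
      rw [← mul_assoc, hzc, mul_assoc z a, mul_assoc z]
    let E : Subgroup G :=
      { carrier := {g | g * t * g⁻¹ = t ∨ g * t * g⁻¹ = z * t}
        one_mem' := by simp
        mul_mem' := by
          intro a b ha hb
          have h : a * b * t * (a * b)⁻¹ = a * (b * t * b⁻¹) * a⁻¹ := by group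
          rw [Set.mem_ofPred_eq, h]
          rcases ha with ha | ha <;> rcases hb with hb | hb
          · exact Or.inl (by rw [hb, ha])
          · exact Or.inr (by rw [hb, hzt, ha])
          · exact Or.inr (by rw [hb, ha])
          · exact Or.inl (by rw [hb, hzt, ha, ← mul_assoc, hz2, one_mul])
        inv_mem' := by
          intro a ha
          have e : a⁻¹ * (a * t * a⁻¹) * a⁻¹⁻¹ = t := by group
          rcases ha with ha | ha
          · exact Or.inl (by rwa [ha] at e)
          · rw [ha, hzt] at e
            exact Or.inr (by
              rw [← one_mul (a⁻¹ * t * a⁻¹⁻¹), ← hz2, mul_assoc z z, e]) }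
    refine main E _ hjD (ht _ hjD) (conj_conj_eq_inv hj0 hh) ?_ (fun d hd => ht d hd.1)
      (hE t ht2 ht1 htz E fun g => Iff.rfl)
    left
    have := mem_centralizer_singleton.mp htx
    rw [mul_inv_eq_iff_eq_mul] at this ⊢
    exact this.symm
  · push Not at hI
    have hxP : x ∈ Subgroup.centralizer {x} := mem_centralizer_singleton.mpr (by group)
    obtain ⟨c, ⟨hcD, hcx⟩, hcn, b, hb, hDb⟩ := exists_cyclic_of_no_involution
      (D0 := D ⊓ Subgroup.centralizer {x}) hDp inf_le_left hn0
      ⟨hzD, mem_centralizer_singleton.mpr (by rw [← hzc, _root_.mul_inv_cancel_right])⟩ hz2 hz1 hzc hI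
    have hxc : Commute x c := (mul_inv_eq_iff_eq_mul.mp (mem_centralizer_singleton.mp hcx)).symm
    obtain ⟨k, hk⟩ := hDp ⟨c, hcD⟩
    have hk : c ^ 2 ^ k = 1 := congrArg Subtype.val hk
    obtain ⟨⟨e, he⟩, f, hf⟩ := exists_zpow_mul_eq hxc hx hk
    obtain ⟨j0, hj02, hj0⟩ := hinv (x * c)
    have hj0x : j0 * x * j0⁻¹ = x⁻¹ := by
      rw [← he, ← conj_zpow, hj0, _root_.inv_zpow]
    have hj0c : j0 * c * j0⁻¹ = c⁻¹ := by
      rw [← hf, ← conj_zpow, hj0, _root_.inv_zpow]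
    have hnorm : ∀ d : G, d * c * d⁻¹ ∈ Subgroup.zpowers c → d⁻¹ * c * d⁻¹⁻¹ ∈ Subgroup.zpowers c →
        d ∈ Subgroup.normalizer (Subgroup.zpowers c : Set G) := by
      have h1 : ∀ d : G, d * c * d⁻¹ ∈ Subgroup.zpowers c → ∀ a ∈ Subgroup.zpowers c,
          d * a * d⁻¹ ∈ Subgroup.zpowers c := by
        rintro d hd _ ⟨n, rfl⟩
        change d * c ^ n * d⁻¹ ∈ _
        rw [← conj_zpow]
        exact zpow_mem hd n
      refine fun d hd hd' => Subgroup.mem_normalizer_iff.mpr fun a => ⟨h1 d hd a, fun h => ?_⟩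
      have := h1 _ hd' _ h
      rwa [show d⁻¹ * (d * a * d⁻¹) * d⁻¹⁻¹ = a by group] at this
    obtain ⟨h, ⟨hhC, hhn⟩, hjD⟩ := hconj j0 (Or.inr hj0x) hj02
      (invCentralizer x ⊓ Subgroup.normalizer (Subgroup.zpowers c : Set G)) inf_le_left
      (fun d hd => ⟨hDC hd, hnorm d (hcn d hd) (hcn _ (inv_mem hd))⟩)
      ⟨Or.inr hj0x, hnorm j0 (by rw [hj0c]; exact inv_mem (Subgroup.mem_zpowers c)) (by
        rw [inv_conj_eq_inv_of_conj_eq_inv hj0c]; exact inv_mem (Subgroup.mem_zpowers c))⟩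
    obtain ⟨j, hj⟩ : ∃ j, j = h * j0 * h⁻¹ := ⟨_, rfl⟩
    rw [← hj] at hjD
    have hj2 : j * j = 1 := by rw [hj, conj_mul, hj02]; simp
    have hjx : j * x * j⁻¹ = x⁻¹ := hj ▸ conj_conj_eq_inv hj0x hhC
    have hjc : j * c * j⁻¹ = c⁻¹ := by
      obtain ⟨n, hn⟩ := (Subgroup.mem_normalizer_iff.mp (inv_mem hhn) c).mp
        (Subgroup.mem_zpowers c)
      have hn : c ^ n = h⁻¹ * c * h⁻¹⁻¹ := hn
      calc j * c * j⁻¹ = h * (j0 * (h⁻¹ * c * h⁻¹⁻¹) * j0⁻¹) * h⁻¹ := by rw [hj]; group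
        _ = h * (c ^ n)⁻¹ * h⁻¹ := by rw [← hn, ← conj_zpow, hj0c, _root_.inv_zpow]
        _ = c⁻¹ := by rw [hn]; group
    have hxy : x ∈ Subgroup.zpowers (x * c) := ⟨e, he⟩
    have hcy : c ∈ Subgroup.zpowers (x * c) := ⟨f, hf⟩
    have hcy' : Subgroup.zpowers c ≤ Subgroup.zpowers (x * c) := Subgroup.zpowers_le.mpr hcy
    refine main (Subgroup.zpowers (x * c) ⊔ D) j hjD
      ((le_sup_right : D ≤ _) hjD) hjx ((le_sup_left : Subgroup.zpowers (x * c) ≤ _) hxy)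
      (inf_le_left.trans le_sup_right) (noSymplectic_zpowers_sup (b := b) (fun d hd => ?_) hjD hj2
        ?_ fun d hd => ?_)
    · rw [← conj_mul]
      refine mul_mem ?_ (hcy' (hcn d hd))
      rcases hDC hd with h | h
      · rwa [h]
      · rw [h]; exact inv_mem hxy
    · rw [← conj_mul, hjx, hjc, ← _root_.mul_inv_rev, hxc.eq]
    · rcases hDC hd with h | h
      · exact Or.inl ((hDb d ⟨hd, mem_centralizer_singleton.mpr h⟩).imp (@hcy' _) (@hcy' _))
      · have : j * d * x * (j * d)⁻¹ = x := by
          rw [_root_.mul_inv_rev, ← mul_assoc, mul_assoc j d, mul_assoc j, h]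
          exact conj_inv_eq_self_of_conj_eq_inv hjx
        exact Or.inr ((hDb _ ⟨mul_mem hjD hd, mem_centralizer_singleton.mpr this⟩).imp
          (@hcy' _) (@hcy' _))

end Involutions

section Inversion

open Polynomial (aeval X)

variable {F : Type} [Field F] {V : Type} [AddCommGroup V] [Module F V]

theorem exists_comp_eq_of_ker_le {M V' : Type} [AddCommGroup M] [Module F M] [AddCommGroup V']
    [Module F V'] (Φ : M →ₗ[F] V) (Ψ : M →ₗ[F] V') (h : ∀ x, Φ x = 0 → Ψ x = 0) :
    ∃ j : V →ₗ[F] V', ∀ x, j (Φ x) = Ψ x := by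
  obtain ⟨g, hg⟩ := LinearMap.exists_rightInverse_of_surjective Φ.rangeRestrict
    (LinearMap.range_eq_top.mpr Φ.surjective_rangeRestrict)
  obtain ⟨j, hj⟩ := LinearMap.exists_extend (Ψ ∘ₗ g)
  refine ⟨j, fun x => ?_⟩
  have h1 : j (Φ x) = Ψ (g (Φ.rangeRestrict x)) := LinearMap.congr_fun hj (Φ.rangeRestrict x)
  have h2 : Φ (g (Φ.rangeRestrict x) - x) = 0 := by
    have : Φ (g (Φ.rangeRestrict x)) = Φ x :=
      congrArg Subtype.val (LinearMap.congr_fun hg (Φ.rangeRestrict x))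
    rw [map_sub, this, sub_self]
  rw [h1, ← sub_eq_zero, ← map_sub, h _ h2]

/-- `T` is an isometry of the nondegenerate symmetric form `B` with inverse `S`. -/
structure IsIsometryPair (B : LinearMap.BilinForm F V) (T S : Module.End F V) : Prop where
  symm : ∀ x y, B x y = B y x
  nondeg : ∀ x, (∀ y, B x y = 0) → x = 0
  mul_inv : T * S = 1
  inv_mul : S * T = 1
  adj : ∀ x y, B (T x) y = B x (S y)

/-- `W` is stable under `T` and the restriction of `B` to `W` is nondegenerate. -/
structure IsGoodSub (B : LinearMap.BilinForm F V) (T : Module.End F V) (W : Submodule F V) :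
    Prop where
  stable : ∀ x ∈ W, T x ∈ W
  nondeg : ∀ x ∈ W, (∀ y ∈ W, B x y = 0) → x = 0

/-- There is an involutive isometry of `W` which conjugates `T` to its inverse `S`. -/
def InvertedOn (B : LinearMap.BilinForm F V) (T S : Module.End F V) (W : Submodule F V) : Prop :=
  ∃ j : Module.End F V, (∀ x ∈ W, j x ∈ W ∧ j (j x) = x ∧ j (T x) = S (j x)) ∧
    ∀ x ∈ W, ∀ y ∈ W, B (j x) (j y) = B x y

variable {B : LinearMap.BilinForm F V} {T S : Module.End F V} {W : Submodule F V}

theorem aeval_mul_apply (T : Module.End F V) (f g : Polynomial F) (x : V) :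
    aeval T (f * g) x = aeval T f (aeval T g x) := by
  rw [map_mul, Module.End.mul_apply]

theorem aeval_comm (T : Module.End F V) (f g : Polynomial F) (x : V) :
    aeval T f (aeval T g x) = aeval T g (aeval T f x) := by
  rw [← aeval_mul_apply, mul_comm, aeval_mul_apply]

theorem aeval_mem_of_stable (h : ∀ x ∈ W, T x ∈ W) (f : Polynomial F) {x : V} (hx : x ∈ W) :
    aeval T f x ∈ W := by
  induction f using Polynomial.induction_on' with
  | add p q hp hq => rw [map_add]; exact W.add_mem hp hq
  | monomial n a =>
    rw [Polynomial.aeval_monomial, Module.End.mul_apply, Module.algebraMap_end_apply]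
    refine W.smul_mem _ ?_
    induction n with
    | zero => simpa using hx
    | succ n ih => rw [pow_succ', Module.End.mul_apply]; exact h _ ih

namespace IsIsometryPair

theorem swap (h : IsIsometryPair B T S) : IsIsometryPair B S T where
  symm := h.symm
  nondeg := h.nondeg
  mul_inv := h.inv_mul
  inv_mul := h.mul_inv
  adj x y := by rw [h.symm, ← h.adj, h.symm]

theorem aeval_adj (h : IsIsometryPair B T S) (f : Polynomial F) (x y : V) :
    B (aeval T f x) y = B x (aeval S f y) := by
  induction f using Polynomial.induction_on' with
  | add p q hp hq => simp only [map_add, LinearMap.add_apply, hp, hq]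
  | monomial n a =>
    simp only [Polynomial.aeval_monomial, Module.End.mul_apply, Module.algebraMap_end_apply,
      map_smul, LinearMap.smul_apply]
    congr 1
    induction n generalizing y with
    | zero => simp
    | succ n ih => rw [pow_succ', Module.End.mul_apply, h.adj, ih, pow_succ, Module.End.mul_apply]

theorem aeval_eq_zero (h : IsIsometryPair B T S) {f : Polynomial F} (hf : aeval T f = 0) :
    aeval S f = 0 := by
  refine LinearMap.ext fun y => h.nondeg _ fun x => ?_
  rw [h.symm, ← h.aeval_adj, hf, LinearMap.zero_apply, map_zero, LinearMap.zero_apply]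

variable [FiniteDimensional F V]

theorem exists_poly (h : IsIsometryPair B T S) :
    ∃ e : Polynomial F, aeval T e = S ∧ aeval S e = T := by
  let R : Submodule F (Module.End F V) := LinearMap.range (aeval T : Polynomial F →ₐ[F] _).toLinearMap
  have hR : ∀ x ∈ R, LinearMap.mulLeft F T x ∈ R := by
    rintro _ ⟨f, rfl⟩
    exact ⟨X * f, by simp⟩
  have hinj : Function.Injective ((LinearMap.mulLeft F T).restrict hR) := by
    intro x y hxy
    have : T * x = T * y := congrArg Subtype.val hxy
    have := congrArg (S * ·) this
    simp only [← mul_assoc, h.inv_mul, one_mul] at this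
    exact Subtype.ext this
  obtain ⟨⟨_, e, rfl⟩, he⟩ := LinearMap.injective_iff_surjective.mp hinj ⟨1, 1, by simp⟩
  have he : T * aeval T e = 1 := congrArg Subtype.val he
  have h1 : aeval T e = S := by
    rw [← one_mul (aeval T e), ← h.inv_mul, mul_assoc, he, mul_one]
  refine ⟨e, h1, ?_⟩
  have h2 : aeval S e * S = 1 := by
    have := h.aeval_eq_zero (f := e * X - 1) (by
      rw [map_sub, map_mul, Polynomial.aeval_X, map_one, h1, h.inv_mul, sub_self])
    rwa [map_sub, map_mul, Polynomial.aeval_X, map_one, sub_eq_zero] at this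
  rw [← mul_one (aeval S e), ← h.inv_mul, ← mul_assoc, h2, one_mul]

theorem symm_stable (h : IsIsometryPair B T S) (hW : ∀ x ∈ W, T x ∈ W) : ∀ x ∈ W, S x ∈ W := by
  obtain ⟨e, he, -⟩ := h.exists_poly
  exact fun x hx => he ▸ aeval_mem_of_stable hW e hx

theorem aeval_aeval_comm (h : IsIsometryPair B T S) (f g : Polynomial F) (x : V) :
    aeval T f (aeval S g x) = aeval S g (aeval T f x) := by
  obtain ⟨e, he, -⟩ := h.exists_poly
  rw [← he, ← Polynomial.aeval_comp, aeval_comm]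

end IsIsometryPair

theorem IsGoodSub.exists_repr [FiniteDimensional F V] (hW : IsGoodSub B T W) (φ : V →ₗ[F] F) :
    ∃ u ∈ W, ∀ y ∈ W, B u y = φ y := by
  let L : W →ₗ[F] Module.Dual F W := (B.compl₁₂ W.subtype W.subtype)
  have hL : Function.Injective L := by
    rw [injective_iff_map_eq_zero]
    intro x hx
    exact Subtype.ext (hW.nondeg x x.2 fun y hy => LinearMap.congr_fun hx ⟨y, hy⟩)
  obtain ⟨u, hu⟩ := (LinearMap.injective_iff_surjective_of_finrank_eq_finrank
    Subspace.dual_finrank_eq.symm).mp hL (φ ∘ₗ W.subtype)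
  exact ⟨u, u.2, fun y hy => LinearMap.congr_fun hu ⟨y, hy⟩⟩

/-- The orthogonal complement of `U` inside `W`. -/
def orthIn (B : LinearMap.BilinForm F V) (W U : Submodule F V) : Submodule F V where
  carrier := {x | x ∈ W ∧ ∀ y ∈ U, B x y = 0}
  zero_mem' := ⟨W.zero_mem, fun y _ => by simp⟩
  add_mem' := fun ha hb => ⟨W.add_mem ha.1 hb.1, fun y hy => by simp [ha.2 y hy, hb.2 y hy]⟩
  smul_mem' := fun c _ ha => ⟨W.smul_mem c ha.1, fun y hy => by simp [ha.2 y hy]⟩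

theorem IsGoodSub.orth [FiniteDimensional F V] (h : IsIsometryPair B T S) (hW : IsGoodSub B T W)
    {U : Submodule F V} (hU : IsGoodSub B T U) (hUW : U ≤ W) :
    IsGoodSub B T (orthIn B W U) ∧
      ∀ x ∈ W, ∃ u ∈ U, ∃ v ∈ orthIn B W U, x = u + v := by
  have hdec : ∀ x ∈ W, ∃ u ∈ U, ∃ v ∈ orthIn B W U, x = u + v := by
    intro x hx
    obtain ⟨u, hu, hux⟩ := hU.exists_repr (B x)
    exact ⟨u, hu, x - u, ⟨W.sub_mem hx (hUW hu), fun y hy => by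
      rw [map_sub, LinearMap.sub_apply, hux y hy, sub_self]⟩, by abel⟩
  refine ⟨⟨fun x hx => ⟨hW.stable x hx.1, fun y hy => ?_⟩, fun x hx hx0 => ?_⟩, hdec⟩
  · rw [h.adj]
    exact hx.2 _ (h.symm_stable hU.stable y hy)
  · refine hW.nondeg x hx.1 fun y hy => ?_
    obtain ⟨u, hu, v, hv, rfl⟩ := hdec y hy
    rw [map_add, hx.2 u hu, hx0 v hv, add_zero]

theorem InvertedOn.of_orth [FiniteDimensional F V] (h : IsIsometryPair B T S)
    (hW : IsGoodSub B T W) {U : Submodule F V} (hU : IsGoodSub B T U) (hUW : U ≤ W)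
    (hj : InvertedOn B T S U) (hj' : InvertedOn B T S (orthIn B W U)) : InvertedOn B T S W := by
  obtain ⟨hO, hdec⟩ := hW.orth h hU hUW
  obtain ⟨j, h1, h2⟩ := hj
  obtain ⟨j', h1', h2'⟩ := hj'
  let Φ : U × orthIn B W U →ₗ[F] V := U.subtype.coprod (orthIn B W U).subtype
  let Ψ : U × orthIn B W U →ₗ[F] V :=
    (j ∘ₗ U.subtype).coprod (j' ∘ₗ (orthIn B W U).subtype)
  obtain ⟨J, hJ⟩ := exists_comp_eq_of_ker_le Φ Ψ (by
    rintro ⟨⟨u, hu⟩, ⟨v, hv⟩⟩ h0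
    have h0 : u + v = 0 := h0
    have hu0 : u = 0 := by
      refine hU.nondeg u hu fun y hy => ?_
      rw [eq_neg_of_add_eq_zero_left h0, map_neg, LinearMap.neg_apply, hv.2 y hy, neg_zero]
    have hv0 : v = 0 := by rwa [hu0, zero_add] at h0
    change j u + j' v = 0
    rw [hu0, hv0, map_zero, map_zero, add_zero])
  have hJ : ∀ u ∈ U, ∀ v ∈ orthIn B W U, J (u + v) = j u + j' v := fun u hu v hv =>
    hJ (⟨u, hu⟩, ⟨v, hv⟩)
  have hort : ∀ u ∈ U, ∀ v ∈ orthIn B W U, B u v = 0 := fun u hu v hv => by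
    rw [h.symm]; exact hv.2 u hu
  refine ⟨J, fun x hx => ?_, fun x hx y hy => ?_⟩
  · obtain ⟨u, hu, v, hv, rfl⟩ := hdec x hx
    obtain ⟨a1, a2, a3⟩ := h1 u hu
    obtain ⟨b1, b2, b3⟩ := h1' v hv
    rw [hJ u hu v hv, hJ _ a1 _ b1, map_add T, hJ _ (hU.stable u hu) _ (hO.stable v hv), a2, a3, b2,
      b3, map_add]
    exact ⟨W.add_mem (hUW a1) b1.1, rfl, rfl⟩
  · obtain ⟨u, hu, v, hv, rfl⟩ := hdec x hx
    obtain ⟨u', hu', v', hv', rfl⟩ := hdec y hy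
    rw [hJ u hu v hv, hJ u' hu' v' hv']
    simp only [map_add, LinearMap.add_apply]
    rw [h2 u hu u' hu', h2' v hv v' hv', hort u hu v' hv', hv.2 u' hu',
      hort _ (h1 u hu).1 _ (h1' v' hv').1, (h1' v hv).1.2 _ (h1 u' hu').1]

/-- The submodule generated by `v` and `w` under `T`. -/
def cyclicPair (T : Module.End F V) (v w : V) : (Polynomial F × Polynomial F) →ₗ[F] V :=
  (LinearMap.applyₗ (R := F) v ∘ₗ (aeval T : Polynomial F →ₐ[F] Module.End F V).toLinearMap).coprod
    (LinearMap.applyₗ (R := F) w ∘ₗ (aeval T : Polynomial F →ₐ[F] Module.End F V).toLinearMap)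

theorem cyclicPair_apply (T : Module.End F V) (v w : V) (x : Polynomial F × Polynomial F) :
    cyclicPair T v w x = aeval T x.1 v + aeval T x.2 w := rfl

theorem cyclicPair_stable (T : Module.End F V) (v w : V) :
    ∀ x ∈ LinearMap.range (cyclicPair T v w), T x ∈ LinearMap.range (cyclicPair T v w) := by
  rintro _ ⟨⟨f, g⟩, rfl⟩
  exact ⟨(X * f, X * g), by simp [cyclicPair_apply]⟩

theorem cyclicPair_le {v w : V} (hW : ∀ x ∈ W, T x ∈ W) (hv : v ∈ W) (hw : w ∈ W) :
    LinearMap.range (cyclicPair T v w) ≤ W := by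
  rintro _ ⟨⟨f, g⟩, rfl⟩
  exact W.add_mem (aeval_mem_of_stable hW f hv) (aeval_mem_of_stable hW g hw)

variable [FiniteDimensional F V]

theorem InvertedOn.of_cyclicPair (h : IsIsometryPair B T S) {v w : V}
    (hW : IsGoodSub B T (LinearMap.range (cyclicPair T v w)))
    (hodd : ∀ f : Polynomial F, B (aeval S f v) w = -B (aeval T f v) w) :
    InvertedOn B T S (LinearMap.range (cyclicPair T v w)) := by
  obtain ⟨e, he, he'⟩ := h.exists_poly
  have hmix : ∀ f g : Polynomial F, B (aeval S f v) (aeval S g w) = -B (aeval T f v) (aeval T g w) := by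
    intro f g
    have e1 : B (aeval S f v) (aeval S g w) = B (aeval S (g.comp e * f) v) w := by
      rw [aeval_mul_apply, Polynomial.aeval_comp, he', h.aeval_adj]
    have e2 : B (aeval T f v) (aeval T g w) = B (aeval T (g.comp e * f) v) w := by
      rw [aeval_mul_apply, Polynomial.aeval_comp, he, h.swap.aeval_adj]
    rw [e1, e2, hodd]
  have hself : ∀ (f g : Polynomial F) (v : V), B (aeval S f v) (aeval S g v) = B (aeval T f v) (aeval T g v) := by
    intro f g v
    rw [h.swap.aeval_adj f v, h.symm (aeval T f v), h.aeval_adj g v, h.aeval_aeval_comm]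
  let Φ := cyclicPair T v w
  let Ψ := cyclicPair S v (-w)
  have hgram : ∀ x y, B (Ψ x) (Ψ y) = B (Φ x) (Φ y) := by
    intro x y
    simp only [Φ, Ψ, cyclicPair_apply, map_neg, map_add, LinearMap.add_apply, LinearMap.neg_apply]
    rw [hself, hself, hmix, h.symm (aeval S x.2 w), hmix, h.symm (aeval T x.2 w) (aeval T y.1 v)]
    ring
  have hΨ : ∀ f g : Polynomial F, Ψ (f, g) = Φ (f.comp e, -g.comp e) := by
    intro f g
    simp [Φ, Ψ, cyclicPair_apply, Polynomial.aeval_comp, he]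
  have hΦ : ∀ f g : Polynomial F, Φ (f, g) = Ψ (f.comp e, -g.comp e) := by
    intro f g
    simp [Φ, Ψ, cyclicPair_apply, Polynomial.aeval_comp, he']
  obtain ⟨j, hj⟩ := exists_comp_eq_of_ker_le Φ Ψ (by
    rintro ⟨f, g⟩ h0
    refine hW.nondeg _ ⟨_, (hΨ f g).symm⟩ ?_
    rintro _ ⟨⟨f', g'⟩, rfl⟩
    change B _ (Φ (f', g')) = 0
    rw [hΦ, hgram, h0, map_zero, LinearMap.zero_apply])
  refine ⟨j, ?_, ?_⟩
  · rintro _ ⟨⟨f, g⟩, rfl⟩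
    change j (Φ (f, g)) ∈ _ ∧ j (j (Φ (f, g))) = Φ (f, g) ∧ j (T (Φ (f, g))) = S (j (Φ (f, g)))
    have hT : T (Φ (f, g)) = Φ (X * f, X * g) := by simp [Φ, cyclicPair_apply]
    have hS : S (Ψ (f, g)) = Ψ (X * f, X * g) := by simp [Ψ, cyclicPair_apply]
    refine ⟨?_, ?_, ?_⟩
    · rw [hj, hΨ]
      exact ⟨_, rfl⟩
    · rw [hj, hΨ, hj, ← hΦ]
    · rw [hT, hj, hj, hS]
  · rintro _ ⟨x, rfl⟩ _ ⟨y, rfl⟩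
    change B (j (Φ x)) (j (Φ y)) = B (Φ x) (Φ y)
    rw [hj, hj, hgram]

end Inversion

section Inversion

open Polynomial (aeval X C)

variable {F : Type} [Field F] {V : Type} [AddCommGroup V] [Module F V]
variable {B : LinearMap.BilinForm F V} {T S : Module.End F V} {W : Submodule F V}

theorem Irreducible.pow_dvd_or_bezout {p : Polynomial F} (hp : Irreducible p) (k : ℕ)
    (f : Polynomial F) : p ^ (k + 1) ∣ f ∨ ∃ a b, a * f + b * p ^ (k + 1) = p ^ k := by
  rcases eq_or_ne f 0 with rfl | hf
  · exact Or.inl (dvd_zero _)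
  obtain ⟨n, g, hg, rfl⟩ := WfDvdMonoid.max_power_factor hf hp
  rcases le_or_gt (k + 1) n with h | h
  · exact Or.inl ((pow_dvd_pow p h).mul_right g)
  · right
    obtain ⟨a, b, hab⟩ := ((hp.coprime_iff_not_dvd.mpr hg).pow_left (m := k + 1))
    refine ⟨b * p ^ (k - n), a * p ^ k, ?_⟩
    have : p ^ k = p ^ (k - n) * p ^ n := by rw [← pow_add, Nat.sub_add_cancel (by omega)]
    calc _ = p ^ (k - n) * p ^ n * (b * g) + a * p ^ k * p ^ (k + 1) := by ring
      _ = p ^ k * (a * p ^ (k + 1) + b * g) := by rw [← this]; ring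
      _ = p ^ k := by rw [hab, mul_one]

theorem exists_aeval_eq_pow {p : Polynomial F} (hp : Irreducible p) {k : ℕ} {v : V}
    (hv : aeval T (p ^ (k + 1)) v = 0) {f : Polynomial F} (hf : aeval T f v ≠ 0) :
    ∃ a : Polynomial F, aeval T a (aeval T f v) = aeval T (p ^ k) v := by
  rcases hp.pow_dvd_or_bezout k f with ⟨c, rfl⟩ | ⟨a, b, hab⟩
  · rw [mul_comm, aeval_mul_apply, hv, map_zero] at hf
    exact absurd rfl hf
  · refine ⟨a, ?_⟩
    rw [← hab, map_add, LinearMap.add_apply, aeval_mul_apply, aeval_mul_apply, hv, map_zero,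
      add_zero]

theorem eq_zero_of_isCoprime {f g : Polynomial F} (h : IsCoprime f g) {x : V}
    (hf : aeval T f x = 0) (hg : aeval T g x = 0) : x = 0 := by
  obtain ⟨a, b, hab⟩ := h
  have := congrArg (fun q => aeval T q x) hab
  simpa [aeval_mul_apply, hf, hg] using this.symm

theorem exists_irreducible_aeval_eq_zero (hW : ∀ x ∈ W, T x ∈ W) {f : Polynomial F} (hf : f ≠ 0)
    {x : V} (hx : x ∈ W) (hx0 : x ≠ 0) (hfx : aeval T f x = 0) :
    ∃ p : Polynomial F, Irreducible p ∧ ∃ x ∈ W, x ≠ 0 ∧ aeval T p x = 0 := by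
  induction f using WfDvdMonoid.induction_on_irreducible generalizing x with
  | zero => exact absurd rfl hf
  | unit u hu =>
    exact absurd (eq_zero_of_isCoprime (isCoprime_self.mpr hu) hfx hfx) hx0
  | mul a i ha hi ih =>
    by_cases h : aeval T a x = 0
    · exact ih ha hx hx0 h
    · exact ⟨i, hi, _, aeval_mem_of_stable hW a hx, h, by rwa [← aeval_mul_apply]⟩

/-- The `p`-primary part of `W` for `T` is killed by `p ^ (k + 1)`, and it is dually paired with
the `p`-primary part for `S`. -/
structure IsPrimaryPair (B : LinearMap.BilinForm F V) (T S : Module.End F V) (W : Submodule F V)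
    (p : Polynomial F) (k : ℕ) : Prop where
  irr : Irreducible p
  sep : ∀ x ∈ W, aeval T (p ^ (k + 1)) x = 0 →
    (∀ y ∈ W, aeval S (p ^ (k + 1)) y = 0 → B x y = 0) → x = 0
  exists_ne : ∃ v ∈ W, aeval T (p ^ (k + 1)) v = 0 ∧ aeval T (p ^ k) v ≠ 0

theorem IsGoodSub.exists_isPrimaryPair [FiniteDimensional F V] (h : IsIsometryPair B T S)
    (hW : IsGoodSub B T W) (hne : W ≠ ⊥) : ∃ p k, IsPrimaryPair B T S W p k := by
  obtain ⟨x₀, hx₀, hx₀0⟩ := W.exists_mem_ne_zero_of_ne_bot hne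
  have hμ : minpoly F T ≠ 0 := minpoly.ne_zero (Algebra.IsIntegral.isIntegral T)
  have hμT : aeval T (minpoly F T) = 0 := minpoly.aeval F T
  have hμS := h.aeval_eq_zero hμT
  obtain ⟨p, hp, x₁, hx₁, hx₁0, hpx⟩ := exists_irreducible_aeval_eq_zero hW.stable hμ hx₀ hx₀0
    (by rw [hμT, LinearMap.zero_apply])
  obtain ⟨N, m₁, hm₁, hμm⟩ := WfDvdMonoid.max_power_factor hμ hp
  have hcop : ∀ n, IsCoprime (p ^ n) m₁ := fun n => (hp.coprime_iff_not_dvd.mpr hm₁).pow_left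
  rw [hμm] at hμT hμS
  have hkill : ∀ (R : Module.End F V), aeval R (p ^ N * m₁) = 0 → ∀ x n,
      aeval R (p ^ n) x = 0 → aeval R (p ^ N) x = 0 := by
    intro R hR x n hn
    refine eq_zero_of_isCoprime (T := R) (hcop n) ?_ ?_
    · rw [aeval_comm, hn, map_zero]
    · rw [← aeval_mul_apply, mul_comm, hR, LinearMap.zero_apply]
  have hsep : ∀ (R Q : Module.End F V), IsIsometryPair B R Q → IsGoodSub B R W →
      aeval Q (p ^ N * m₁) = 0 → ∀ x ∈ W, ∀ n, aeval R (p ^ n) x = 0 →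
      (∀ y ∈ W, aeval Q (p ^ N) y = 0 → B x y = 0) → x = 0 := by
    intro R Q hRQ hWR hQ x hx n hn hy
    refine eq_zero_of_isCoprime (T := R) (hcop n) hn ?_
    refine hWR.nondeg _ (aeval_mem_of_stable hWR.stable _ hx) fun y hyW => ?_
    rw [hRQ.aeval_adj]
    refine hy _ (aeval_mem_of_stable (hRQ.symm_stable hWR.stable) _ hyW) ?_
    rw [← aeval_mul_apply, hQ, LinearMap.zero_apply]
  have hex : ∃ M, ∀ x ∈ W, ∀ n, aeval T (p ^ n) x = 0 → aeval T (p ^ M) x = 0 :=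
    ⟨N, fun x _ n => hkill T hμT x n⟩
  obtain ⟨M, hM, hmin⟩ : ∃ M, (∀ x ∈ W, ∀ n, aeval T (p ^ n) x = 0 → aeval T (p ^ M) x = 0) ∧
      ∀ M' < M, ¬ ∀ x ∈ W, ∀ n, aeval T (p ^ n) x = 0 → aeval T (p ^ M') x = 0 :=
    ⟨Nat.find hex, Nat.find_spec hex, fun _ => Nat.find_min hex⟩
  obtain _ | k := M
  · exact absurd (by simpa using hM x₁ hx₁ 1 (by simpa using hpx)) hx₁0
  have h1 := hmin k (Nat.lt_succ_self k)
  push Not at h1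
  obtain ⟨v, hv, n, hvn, hvk⟩ := h1
  refine ⟨p, k, hp, fun x hx hxk hxy => ?_, v, hv, hM v hv n hvn, hvk⟩
  refine hsep T S h hW hμS x hx _ hxk fun y hy hyN => hxy y hy ?_
  have hWS : IsGoodSub B S W := ⟨h.symm_stable hW.stable, hW.nondeg⟩
  refine hsep S T h.swap hWS hμT _ (aeval_mem_of_stable hWS.stable _ hy) N ?_ fun z hz hzN => ?_
  · rw [aeval_comm, hyN, map_zero]
  · rw [h.swap.aeval_adj, hM z hz N hzN, map_zero]

theorem IsIsometryPair.apply_eq_zero_of_isCoprime (h : IsIsometryPair B T S) {e f : Polynomial F}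
    (he : aeval T e = S) (hf : IsCoprime f (f.comp e)) {x y : V} (hx : aeval T f x = 0)
    (hy : aeval T f y = 0) : B x y = 0 := by
  obtain ⟨a, b, hab⟩ := hf
  have h1 : x = aeval S f (aeval T b x) := by
    have := congrArg (fun q => aeval T q x) hab
    simp only [map_add, LinearMap.add_apply, aeval_mul_apply, hx, map_zero, zero_add, map_one,
      Module.End.one_apply] at this
    rw [← he, ← Polynomial.aeval_comp, aeval_comm T (f.comp e)]
    exact this.symm
  rw [h1, h.swap.aeval_adj, hy, map_zero]

variable [FiniteDimensional F V]

theorem IsPrimaryPair.exists_inverted_of_isCoprime (h2 : (2 : F) ≠ 0) (h : IsIsometryPair B T S)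
    (hW : IsGoodSub B T W) {p e : Polynomial F} {k : ℕ} (hP : IsPrimaryPair B T S W p k)
    (he : aeval T e = S) (he' : aeval S e = T) (hc : IsCoprime p (p.comp e)) :
    ∃ U ≤ W, U ≠ ⊥ ∧ IsGoodSub B T U ∧ InvertedOn B T S U := by
  obtain ⟨v, hv, hvk, hvk'⟩ := hP.exists_ne
  have hcK : IsCoprime (p ^ (k + 1)) ((p ^ (k + 1)).comp e) := by
    rw [Polynomial.pow_comp]; exact hc.pow
  obtain ⟨w, hw, hwk, hvw⟩ : ∃ w ∈ W, aeval S (p ^ (k + 1)) w = 0 ∧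
      B (aeval T (p ^ k) v) w ≠ 0 := by
    by_contra! hcon
    refine hvk' (hP.sep _ (aeval_mem_of_stable hW.stable _ hv) ?_ hcon)
    rw [aeval_comm, hvk, map_zero]
  have hTv : ∀ f : Polynomial F, aeval T (p ^ (k + 1)) (aeval T f v) = 0 := fun f => by
    rw [aeval_comm, hvk, map_zero]
  have hSw : ∀ f : Polynomial F, aeval S (p ^ (k + 1)) (aeval T f w) = 0 := fun f => by
    rw [← h.aeval_aeval_comm, hwk, map_zero]
  have hTS : ∀ (f : Polynomial F) x, aeval S f x = aeval T (f.comp e) x := fun f x => by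
    rw [Polynomial.aeval_comp, he]
  have hST : ∀ (f : Polynomial F) x, aeval T f x = aeval S (f.comp e) x := fun f x => by
    rw [Polynomial.aeval_comp, he']
  have hvv : ∀ f g : Polynomial F, B (aeval T f v) (aeval T g v) = 0 := fun f g =>
    h.apply_eq_zero_of_isCoprime he hcK (hTv f) (hTv g)
  have hww : ∀ f g : Polynomial F, B (aeval T f w) (aeval T g w) = 0 := fun f g =>
    h.swap.apply_eq_zero_of_isCoprime he' hcK (hSw f) (hSw g)
  have hrange : LinearMap.range (cyclicPair T (v + w) (v - w)) =
      LinearMap.range (cyclicPair T v w) := by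
    apply le_antisymm
    · rintro _ ⟨⟨f, g⟩, rfl⟩
      exact ⟨(f + g, f - g), by simp [cyclicPair_apply]; abel⟩
    · rintro _ ⟨⟨f, g⟩, rfl⟩
      refine ⟨(C (2⁻¹ : F) * (f + g), C (2⁻¹ : F) * (f - g)), ?_⟩
      have e1 : aeval T f v = (2⁻¹ : F) • ((2 : F) • aeval T f v) := by
        rw [smul_smul, inv_mul_cancel₀ h2, one_smul]
      have e2 : aeval T g w = (2⁻¹ : F) • ((2 : F) • aeval T g w) := by
        rw [smul_smul, inv_mul_cancel₀ h2, one_smul]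
      simp only [cyclicPair_apply, map_add, map_sub, map_mul, Polynomial.aeval_C,
        Module.algebraMap_end_apply, Module.End.mul_apply, LinearMap.add_apply,
        LinearMap.sub_apply]
      conv_rhs => rw [e1, e2]
      module
  have hgood : IsGoodSub B T (LinearMap.range (cyclicPair T v w)) := by
    refine ⟨cyclicPair_stable T v w, ?_⟩
    rintro _ ⟨⟨f, g⟩, rfl⟩ hx
    have hx1 : ∀ b : Polynomial F, B (aeval T f v) (aeval T b w) = 0 := fun b => by
      simpa [cyclicPair_apply, hww] using hx _ ⟨(0, b), rfl⟩
    have hx2 : ∀ b : Polynomial F, B (aeval T g w) (aeval T b v) = 0 := fun b => by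
      simpa [cyclicPair_apply, hvv] using hx _ ⟨(b, 0), rfl⟩
    have hf : aeval T f v = 0 := by
      by_contra hf
      obtain ⟨a, ha⟩ := exists_aeval_eq_pow hP.irr hvk hf
      rw [← ha, h.aeval_adj, hTS] at hvw
      exact hvw (hx1 _)
    have hg : aeval T g w = 0 := by
      by_contra hg
      rw [hST] at hg
      obtain ⟨a, ha⟩ := exists_aeval_eq_pow hP.irr hwk hg
      rw [h.aeval_adj, ← ha, h.symm, h.swap.aeval_adj, ← hST] at hvw
      exact hvw (hx2 _)
    change aeval T f v + aeval T g w = 0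
    rw [hf, hg, add_zero]
  refine ⟨_, cyclicPair_le hW.stable hv hw, fun hbot => hvk' ?_, hgood, ?_⟩
  · have : v ∈ LinearMap.range (cyclicPair T v w) := ⟨(1, 0), by simp [cyclicPair_apply]⟩
    rw [hbot, Submodule.mem_bot] at this
    rw [this, map_zero]
  · rw [← hrange] at hgood ⊢
    refine InvertedOn.of_cyclicPair h hgood fun f => ?_
    have a1 := hvv (f.comp e) 1
    have a2 := hww (f.comp e) 1
    have a3 := hvv f 1
    have a4 := hww f 1
    rw [← hTS] at a1 a2
    simp only [map_one, Module.End.one_apply] at a1 a2 a3 a4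
    simp only [map_add, map_sub, LinearMap.add_apply, a1, a2, a3, a4]
    rw [h.swap.aeval_adj, h.swap.aeval_adj, h.symm v, h.symm w]
    ring

end Inversion

section Inversion

open Polynomial (aeval X C)

variable {F : Type} [Field F] {V : Type} [AddCommGroup V] [Module F V]
variable {B : LinearMap.BilinForm F V} {T S : Module.End F V} {W : Submodule F V}

theorem InvertedOn.cyclic [FiniteDimensional F V] (h : IsIsometryPair B T S) {p : Polynomial F}
    (hp : Irreducible p) {k : ℕ} (hW : ∀ x ∈ W, T x ∈ W) {v : V} (hv : v ∈ W)
    (hvk : aeval T (p ^ (k + 1)) v = 0) {f : Polynomial F}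
    (hvf : B (aeval T (p ^ k) v) (aeval T f v) ≠ 0) :
    ∃ U ≤ W, U ≠ ⊥ ∧ IsGoodSub B T U ∧ InvertedOn B T S U := by
  obtain ⟨e, he, -⟩ := h.exists_poly
  have hgood : IsGoodSub B T (LinearMap.range (cyclicPair T v 0)) := by
    refine ⟨cyclicPair_stable T v 0, ?_⟩
    rintro _ ⟨⟨g, g'⟩, rfl⟩ hx
    simp only [cyclicPair_apply, map_zero, add_zero] at hx ⊢
    by_contra hg
    obtain ⟨a, ha⟩ := exists_aeval_eq_pow hp hvk hg
    rw [← ha, h.aeval_adj, ← he, ← Polynomial.aeval_comp, ← aeval_mul_apply] at hvf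
    exact hvf (hx _ ⟨(a.comp e * f, 0), by simp [cyclicPair_apply]⟩)
  refine ⟨_, cyclicPair_le hW hv W.zero_mem, fun hbot => hvf ?_, hgood,
    InvertedOn.of_cyclicPair h hgood fun f => by simp⟩
  have : v ∈ LinearMap.range (cyclicPair T v 0) := ⟨(1, 0), by simp [cyclicPair_apply]⟩
  rw [hbot, Submodule.mem_bot] at this
  rw [this, map_zero, map_zero, LinearMap.zero_apply]

theorem aeval_eq_eval_smul {s : F} {x : V} (hx : T x = s • x) (f : Polynomial F) :
    aeval T f x = f.eval s • x := by
  obtain ⟨g, hg⟩ := Polynomial.X_sub_C_dvd_sub_C_eval (a := s) (p := f)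
  have h1 : aeval T (X - C s) x = 0 := by
    simp [hx, Module.algebraMap_end_apply]
  have h2 : aeval T (f - C (f.eval s)) x = 0 := by
    rw [hg, mul_comm, aeval_mul_apply, h1, map_zero]
  simpa [sub_eq_zero, Module.algebraMap_end_apply] using h2

variable [FiniteDimensional F V]

theorem InvertedOn.of_alternating (h2 : (2 : F) ≠ 0) (h : IsIsometryPair B T S)
    (hW : IsGoodSub B T W) {p : Polynomial F} (hp : Irreducible p) {k : ℕ}
    (hk : ∀ x ∈ W, aeval T (p ^ (k + 1)) x = 0) (hkS : ∀ x ∈ W, aeval S (p ^ (k + 1)) x = 0)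
    {v : V} (hv : v ∈ W)
    (hvk : aeval T (p ^ k) v ≠ 0)
    (halt : ∀ v ∈ W, ∀ f : Polynomial F, B (aeval T (p ^ k) v) (aeval T f v) = 0) :
    ∃ U ≤ W, U ≠ ⊥ ∧ IsGoodSub B T U ∧ InvertedOn B T S U := by
  obtain ⟨e, he, he'⟩ := h.exists_poly
  have hTW := hW.stable
  have hSW := h.symm_stable hTW
  set N := aeval T (p ^ k) with hN
  have hskew : ∀ x ∈ W, ∀ y ∈ W, ∀ f : Polynomial F,
      B (N x) (aeval T f y) = -B (N y) (aeval T f x) := by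
    intro x hx y hy f
    have := halt (x + y) (W.add_mem hx hy) f
    simp only [map_add, LinearMap.add_apply, halt x hx, halt y hy, add_zero, zero_add] at this
    rw [add_comm] at this
    exact eq_neg_of_add_eq_zero_left this
  have hskew1 : ∀ x ∈ W, ∀ y ∈ W, B (N x) y = -B (N y) x := fun x hx y hy => by
    simpa using hskew x hx y hy 1
  have hTSN : ∀ x ∈ W, T (N x) = S (N x) := by
    intro x hx
    rw [← sub_eq_zero]
    have hNx := aeval_mem_of_stable hTW (p ^ k) hx
    refine hW.nondeg _ (W.sub_mem (hTW _ hNx) (hSW _ hNx)) fun y hy => ?_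
    have e1 := hskew x hx y hy X
    have e2 := hskew1 x hx (S y) (hSW y hy)
    have e3 : N (S y) = S (N y) := by
      have := h.aeval_aeval_comm (p ^ k) X y
      rwa [Polynomial.aeval_X] at this
    rw [Polynomial.aeval_X] at e1
    rw [e3, h.swap.adj] at e2
    rw [map_sub, LinearMap.sub_apply, h.adj, h.swap.adj, e1, e2, sub_self]
  obtain ⟨s, hps⟩ : ∃ s : F, p ∣ X - C s := by
    have hdvd : p ∣ (X - C 1) * (X - C (-1)) := by
      by_contra hnd
      refine hvk (eq_zero_of_isCoprime (T := T) (hp.coprime_iff_not_dvd.mpr hnd) ?_ ?_)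
      · rw [hN, ← aeval_mul_apply, ← pow_succ']
        exact hk v hv
      · have e1 : T (T (N v)) = N v := by
          rw [hTSN v hv, ← Module.End.mul_apply, h.mul_inv, Module.End.one_apply]
        simp only [map_mul, map_sub, map_one, map_neg, Polynomial.aeval_X, Module.End.mul_apply,
          LinearMap.sub_apply, LinearMap.neg_apply, Module.End.one_apply, e1]
        abel
    rcases hp.prime.dvd_or_dvd hdvd with h1 | h1
    · exact ⟨1, h1⟩
    · exact ⟨-1, h1⟩
  have hTN : ∀ x ∈ W, T (N x) = s • N x := by
    intro x hx
    obtain ⟨c, hc⟩ := hps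
    have e1 : aeval T (X - C s) (N x) = 0 := by
      rw [hc, hN, ← aeval_mul_apply, show p * c * p ^ k = c * p ^ (k + 1) by ring,
        aeval_mul_apply, hk x hx, map_zero]
    simpa [sub_eq_zero, Module.algebraMap_end_apply] using e1
  have hdvd_of_eval : ∀ f : Polynomial F, f.eval s = 0 → p ∣ f := fun f hf =>
    hps.trans (Polynomial.dvd_iff_isRoot.mpr hf)
  obtain ⟨w₀, hw₀, hvw₀⟩ : ∃ w₀ ∈ W, B (N v) w₀ ≠ 0 := by
    by_contra! hcon
    exact hvk (hW.nondeg _ (aeval_mem_of_stable hTW _ hv) hcon)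
  obtain ⟨σ, hσ⟩ := exists_comp_eq_of_ker_le
    (LinearMap.applyₗ (R := F) v ∘ₗ (aeval T : Polynomial F →ₐ[F] Module.End F V).toLinearMap)
    (LinearMap.applyₗ (R := F) v ∘ₗ (aeval S : Polynomial F →ₐ[F] Module.End F V).toLinearMap)
    (by
      intro f hf
      change aeval T f v = 0 at hf
      change aeval S f v = 0
      rcases hp.pow_dvd_or_bezout k f with ⟨c, rfl⟩ | ⟨a, b, hab⟩
      · rw [mul_comm, aeval_mul_apply, hkS v hv, map_zero]
      · refine absurd ?_ hvk
        rw [hN, ← hab, map_add, LinearMap.add_apply, aeval_mul_apply, hf, aeval_mul_apply, hk v hv,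
          map_zero, map_zero, add_zero])
  have hσ : ∀ f : Polynomial F, σ (aeval T f v) = aeval S f v := hσ
  obtain ⟨w, hw, hwφ⟩ := hW.exists_repr (B.flip w₀ - B.flip w₀ ∘ₗ σ)
  have hwφ : ∀ y ∈ W, B y w = B y w₀ - B (σ y) w₀ := fun y hy => by
    rw [h.symm]; exact hwφ y hy
  have hvw : B (N v) w ≠ 0 := by
    rw [hwφ _ (aeval_mem_of_stable hTW _ hv), hσ, h.swap.aeval_adj, ← hN, h.symm v,
      hskew1 w₀ hw₀ v hv, sub_neg_eq_add, ← two_mul]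
    exact mul_ne_zero h2 hvw₀
  have hgood : IsGoodSub B T (LinearMap.range (cyclicPair T v w)) := by
    refine ⟨cyclicPair_stable T v w, ?_⟩
    rintro _ ⟨⟨f, g⟩, rfl⟩ hx
    have hx1 : ∀ b : Polynomial F, B (aeval T f v + aeval T g w) (aeval S b v) = 0 := fun b => by
      rw [← he, ← Polynomial.aeval_comp]
      exact hx _ ⟨(b.comp e, 0), by simp [cyclicPair_apply]⟩
    have hx2 : ∀ b : Polynomial F, B (aeval T f v + aeval T g w) (aeval S b w) = 0 := fun b => by
      rw [← he, ← Polynomial.aeval_comp]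
      exact hx _ ⟨(0, b.comp e), by simp [cyclicPair_apply]⟩
    have hdiv : ∀ i ≤ k + 1, p ^ i ∣ f ∧ p ^ i ∣ g := by
      intro i
      induction i with
      | zero => simp
      | succ i ih =>
        intro hi
        obtain ⟨⟨f', hf'⟩, ⟨g', hg'⟩⟩ := ih (by omega)
        have hpow : p ^ k = p ^ (k - i) * p ^ i := by
          rw [← pow_add, Nat.sub_add_cancel (by omega)]
        have key : aeval T (p ^ (k - i)) (aeval T f v + aeval T g w) =
            f'.eval s • N v + g'.eval s • N w := by
          rw [map_add, ← aeval_eq_eval_smul (hTN v hv), ← aeval_eq_eval_smul (hTN w hw), hN,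
            hpow, hf', hg']
          simp only [← aeval_mul_apply]
          congr 3 <;> ring
        have k1 := hx1 (p ^ (k - i))
        have k2 := hx2 (p ^ (k - i))
        have z1 := halt v hv 1
        have z2 := halt w hw 1
        have z3 := hskew1 w hw v hv
        rw [map_one, Module.End.one_apply] at z1 z2
        rw [← h.aeval_adj, key, map_add, LinearMap.add_apply, map_smul, map_smul,
          LinearMap.smul_apply, LinearMap.smul_apply, smul_eq_mul, smul_eq_mul] at k1 k2
        rw [z1, mul_zero, zero_add, z3, mul_neg, neg_eq_zero] at k1
        rw [z2, mul_zero, add_zero] at k2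
        have q1 := hdvd_of_eval _ ((mul_eq_zero.mp k2).resolve_right hvw)
        have q2 := hdvd_of_eval _ ((mul_eq_zero.mp k1).resolve_right hvw)
        rw [hf', hg', pow_succ]
        exact ⟨mul_dvd_mul_left _ q1, mul_dvd_mul_left _ q2⟩
    obtain ⟨⟨f', hf'⟩, ⟨g', hg'⟩⟩ := hdiv (k + 1) le_rfl
    change aeval T f v + aeval T g w = 0
    rw [hf', hg', mul_comm, aeval_mul_apply, hk v hv, mul_comm, aeval_mul_apply, hk w hw,
      map_zero, map_zero, add_zero]
  refine ⟨_, cyclicPair_le hTW hv hw, fun hbot => hvk ?_, hgood,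
    InvertedOn.of_cyclicPair h hgood fun f => ?_⟩
  · have : v ∈ LinearMap.range (cyclicPair T v w) := ⟨(1, 0), by simp [cyclicPair_apply]⟩
    rw [hbot, Submodule.mem_bot] at this
    rw [this, map_zero]
  · have e1 : aeval S f v = aeval T (f.comp e) v := by rw [Polynomial.aeval_comp, he]
    have e2 : aeval S (f.comp e) v = aeval T f v := by rw [Polynomial.aeval_comp, he']
    rw [hwφ _ (aeval_mem_of_stable hSW f hv), hwφ _ (aeval_mem_of_stable hTW f hv), hσ, e1, hσ, e2]
    ring

theorem IsPrimaryPair.exists_inverted_of_dvd (h2 : (2 : F) ≠ 0) (h : IsIsometryPair B T S)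
    (hW : IsGoodSub B T W) {p e : Polynomial F} {k : ℕ} (hP : IsPrimaryPair B T S W p k)
    (he : aeval T e = S) (he' : aeval S e = T) (hd : p ∣ p.comp e) :
    ∃ U ≤ W, U ≠ ⊥ ∧ IsGoodSub B T U ∧ InvertedOn B T S U := by
  obtain ⟨r, hr⟩ : p ^ (k + 1) ∣ (p ^ (k + 1)).comp e := by
    rw [Polynomial.pow_comp]; exact pow_dvd_pow_of_dvd hd _
  have hTS : ∀ x, aeval T (p ^ (k + 1)) x = 0 → aeval S (p ^ (k + 1)) x = 0 := fun x hx => by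
    rw [← he, ← Polynomial.aeval_comp, hr, mul_comm, aeval_mul_apply, hx, map_zero]
  have hST : ∀ x, aeval S (p ^ (k + 1)) x = 0 → aeval T (p ^ (k + 1)) x = 0 := fun x hx => by
    rw [← he', ← Polynomial.aeval_comp, hr, mul_comm, aeval_mul_apply, hx, map_zero]
  let W' : Submodule F V := W ⊓ LinearMap.ker (aeval T (p ^ (k + 1)))
  have hW' : IsGoodSub B T W' := by
    refine ⟨fun x hx => ⟨hW.stable x hx.1, ?_⟩, fun x hx hxy =>
      hP.sep x hx.1 hx.2 fun y hy hyS => hxy y ⟨hy, hST y hyS⟩⟩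
    have := aeval_comm T (p ^ (k + 1)) X x
    rw [Polynomial.aeval_X, hx.2, map_zero] at this
    exact this
  have key : ∃ U ≤ W', U ≠ ⊥ ∧ IsGoodSub B T U ∧ InvertedOn B T S U := by
    obtain ⟨v, hv, hvk, hvk'⟩ := hP.exists_ne
    by_cases hc : ∃ v ∈ W', ∃ f : Polynomial F, B (aeval T (p ^ k) v) (aeval T f v) ≠ 0
    · obtain ⟨v, hv, f, hvf⟩ := hc
      exact InvertedOn.cyclic h hP.irr hW'.stable hv hv.2 hvf
    · push Not at hc
      exact InvertedOn.of_alternating h2 h hW' hP.irr (fun x hx => hx.2) (fun x hx => hTS x hx.2)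
        (⟨hv, hvk⟩ : v ∈ W') hvk' hc
  obtain ⟨U, hU, h'⟩ := key
  exact ⟨U, hU.trans inf_le_left, h'⟩

theorem IsGoodSub.invertedOn (h2 : (2 : F) ≠ 0) (h : IsIsometryPair B T S)
    (hW : IsGoodSub B T W) : InvertedOn B T S W := by
  induction hn : Module.finrank F W using Nat.strong_induction_on generalizing W with
  | _ n ih =>
  rcases eq_or_ne W ⊥ with rfl | hne
  · exact ⟨0, fun x hx => by simp [(Submodule.mem_bot F).mp hx],
      fun x hx y hy => by simp [(Submodule.mem_bot F).mp hx]⟩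
  obtain ⟨e, he, he'⟩ := h.exists_poly
  obtain ⟨p, k, hP⟩ := hW.exists_isPrimaryPair h hne
  obtain ⟨U, hUW, hU0, hU, hUj⟩ : ∃ U ≤ W, U ≠ ⊥ ∧ IsGoodSub B T U ∧ InvertedOn B T S U := by
    rcases hP.irr.isCoprime_or_dvd (p.comp e) with hc | hd
    · exact hP.exists_inverted_of_isCoprime h2 h hW he he' hc
    · exact hP.exists_inverted_of_dvd h2 h hW he he' hd
  refine InvertedOn.of_orth h hW hU hUW hUj (ih _ ?_ (hW.orth h hU hUW).1 rfl)
  rw [← hn]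
  obtain ⟨u, hu, hu0⟩ := U.exists_mem_ne_zero_of_ne_bot hU0
  refine Submodule.finrank_lt_finrank_of_lt (lt_of_le_of_ne (fun x hx => hx.1) fun heq => ?_)
  refine hu0 (hU.nondeg u hu fun y hy => ?_)
  have : u ∈ orthIn B W U := by rw [heq]; exact hUW hu
  exact this.2 y hy

/-- Wonenburger's theorem: an isometry is conjugate to its inverse by an involutive isometry. -/
theorem IsIsometryPair.exists_inverting (h2 : (2 : F) ≠ 0) (h : IsIsometryPair B T S) :
    ∃ j : Module.End F V, j * j = 1 ∧ j * T = S * j ∧ ∀ x y, B (j x) (j y) = B x y := by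
  obtain ⟨j, h1, h3⟩ := IsGoodSub.invertedOn (W := ⊤) h2 h
    ⟨fun _ _ => trivial, fun x _ hx => h.nondeg x fun y => hx y trivial⟩
  exact ⟨j, LinearMap.ext fun x => (h1 x trivial).2.1, LinearMap.ext fun x => (h1 x trivial).2.2,
    fun x y => h3 x trivial y trivial⟩

end Inversion

section IsomGroup

variable {F : Type} [Field F] {V : Type} [AddCommGroup V] [Module F V]

/-- The group of linear automorphisms preserving a bilinear form. -/
def isomGroup (B : LinearMap.BilinForm F V) : Subgroup (V ≃ₗ[F] V) where
  carrier := {g | ∀ x y, B (g x) (g y) = B x y}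
  one_mem' := fun _ _ => rfl
  mul_mem' := fun {a b} ha hb x y => (ha (b x) (b y)).trans (hb x y)
  inv_mem' := fun {a} ha x y => by
    rw [← ha (a⁻¹ x) (a⁻¹ y)]
    exact congrArg₂ (fun u v => B u v) (a.apply_symm_apply x) (a.apply_symm_apply y)

/-- A symmetric bilinear form with trivial radical. -/
structure IsSymmNondeg (B : LinearMap.BilinForm F V) : Prop where
  symm : ∀ x y, B x y = B y x
  nondeg : ∀ x, (∀ y, B x y = 0) → x = 0

variable {B : LinearMap.BilinForm F V}

theorem isomGroup_mem_iff {g : V ≃ₗ[F] V} : g ∈ isomGroup B ↔ ∀ x y, B (g x) (g y) = B x y :=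
  Iff.rfl

theorem finite_isomGroup [Finite F] [FiniteDimensional F V] (B : LinearMap.BilinForm F V) :
    Finite (isomGroup B) := by
  have := Module.finite_of_finite F (M := V)
  have : Finite (V ≃ₗ[F] V) := DFunLike.finite _
  infer_instance

theorem IsSymmNondeg.exists_inverting [FiniteDimensional F V] (h2 : (2 : F) ≠ 0)
    (hB : IsSymmNondeg B) (y : isomGroup B) :
    ∃ j : isomGroup B, j * j = 1 ∧ j * y * j⁻¹ = y⁻¹ := by
  obtain ⟨⟨g, hg⟩, rfl⟩ : ∃ g, g = y := ⟨y, rfl⟩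
  have hp : IsIsometryPair B g.toLinearMap g.symm.toLinearMap := by
    refine ⟨hB.symm, hB.nondeg, LinearMap.ext fun x => g.apply_symm_apply x,
      LinearMap.ext fun x => g.symm_apply_apply x, fun x y => ?_⟩
    rw [← hg x]
    exact congrArg (B (g x)) (g.apply_symm_apply y).symm
  obtain ⟨j, hjj, hj, hjB⟩ := hp.exists_inverting h2
  let j' : V ≃ₗ[F] V := LinearEquiv.ofLinearMap j j hjj hjj
  have hj' : j' * j' = 1 := LinearEquiv.ext fun x => LinearMap.congr_fun hjj x
  have hinv : j'⁻¹ = j' := inv_eq_of_mul_eq_one_left hj'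
  refine ⟨⟨j', hjB⟩, Subtype.ext hj', Subtype.ext ?_⟩
  change j' * g * j'⁻¹ = g⁻¹
  rw [_root_.mul_inv_eq_iff_eq_mul]
  exact LinearEquiv.ext fun x => LinearMap.congr_fun hj x

theorem IsSymmNondeg.isRealGroup [FiniteDimensional F V] (h2 : (2 : F) ≠ 0)
    (hB : IsSymmNondeg B) : IsRealGroup (isomGroup B) := fun y =>
  (hB.exists_inverting h2 y).imp fun _ h => h.2

variable {V₁ V₂ : Type} [AddCommGroup V₁] [Module F V₁] [AddCommGroup V₂] [Module F V₂]

/-- Isometries of two orthogonal summands, glued together. -/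
def isomGroupProd {B₁ : LinearMap.BilinForm F V₁} {B₂ : LinearMap.BilinForm F V₂}
    (e : (V₁ × V₂) ≃ₗ[F] V) (he : ∀ p q, B (e p) (e q) = B₁ p.1 q.1 + B₂ p.2 q.2) :
    isomGroup B₁ × isomGroup B₂ →* isomGroup B where
  toFun p := ⟨e.symm.trans ((LinearEquiv.prodCongr (p.1 : V₁ ≃ₗ[F] V₁) (p.2 : V₂ ≃ₗ[F] V₂)).trans e),
    fun x y => by
      obtain ⟨x, rfl⟩ := e.surjective x
      obtain ⟨y, rfl⟩ := e.surjective y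
      simp only [LinearEquiv.trans_apply, LinearEquiv.symm_apply_apply, he,
        LinearEquiv.prodCongr_apply]
      rw [p.1.2, p.2.2]⟩
  map_one' := by
    ext x
    simp [LinearEquiv.prodCongr_apply]
  map_mul' p q := by
    ext x
    simp [LinearEquiv.prodCongr_apply]

theorem isomGroupProd_apply {B₁ : LinearMap.BilinForm F V₁} {B₂ : LinearMap.BilinForm F V₂}
    (e : (V₁ × V₂) ≃ₗ[F] V) (he : ∀ p q, B (e p) (e q) = B₁ p.1 q.1 + B₂ p.2 q.2)
    (p : isomGroup B₁ × isomGroup B₂) (x : V₁ × V₂) :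
    (isomGroupProd e he p : V ≃ₗ[F] V) (e x) =
      e ((p.1 : V₁ ≃ₗ[F] V₁) x.1, (p.2 : V₂ ≃ₗ[F] V₂) x.2) := by
  simp [isomGroupProd, LinearEquiv.prodCongr_apply]

theorem isomGroupProd_injective {B₁ : LinearMap.BilinForm F V₁} {B₂ : LinearMap.BilinForm F V₂}
    (e : (V₁ × V₂) ≃ₗ[F] V) (he : ∀ p q, B (e p) (e q) = B₁ p.1 q.1 + B₂ p.2 q.2) :
    Function.Injective (isomGroupProd e he) := by
  intro p q hpq
  have key : ∀ x : V₁ × V₂, ((p.1 : V₁ ≃ₗ[F] V₁) x.1, (p.2 : V₂ ≃ₗ[F] V₂) x.2) =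
      ((q.1 : V₁ ≃ₗ[F] V₁) x.1, (q.2 : V₂ ≃ₗ[F] V₂) x.2) := fun x => by
    apply e.injective
    rw [← isomGroupProd_apply e he, ← isomGroupProd_apply e he, hpq]
  exact Prod.ext (Subtype.ext (LinearEquiv.ext fun x => (Prod.ext_iff.mp (key (x, 0))).1))
    (Subtype.ext (LinearEquiv.ext fun x => (Prod.ext_iff.mp (key (0, x))).2))

/-- The restriction of a bilinear form to a submodule. -/
def formOn (B : LinearMap.BilinForm F V) (W : Submodule F V) : LinearMap.BilinForm F W :=
  B.compl₁₂ W.subtype W.subtype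

theorem formOn_apply (W : Submodule F V) (x y : W) : formOn B W x y = B x y := rfl

theorem exists_restrict_isom (B : LinearMap.BilinForm F V) {g : V ≃ₗ[F] V} (hg : g ∈ isomGroup B)
    {W : Submodule F V}
    (h1 : ∀ x ∈ W, g x ∈ W) (h2 : ∀ x ∈ W, g.symm x ∈ W) :
    ∃ a : isomGroup (formOn B W), ∀ x, ((a : W ≃ₗ[F] W) x : V) = g x :=
  ⟨⟨LinearEquiv.ofLinearMap (g.toLinearMap.restrict h1) (g.symm.toLinearMap.restrict h2)
      (LinearMap.ext fun x => Subtype.ext (g.apply_symm_apply x))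
      (LinearMap.ext fun x => Subtype.ext (g.symm_apply_apply x)),
    fun x y => hg x y⟩, fun _ => rfl⟩

/-- The eigenspace of `t` for the eigenvalue `s`. -/
def eigenSub (t : V ≃ₗ[F] V) (s : F) : Submodule F V where
  carrier := {x | t x = s • x}
  zero_mem' := by simp
  add_mem' := fun {a b} ha hb => by
    change t (a + b) = s • (a + b)
    rw [map_add, smul_add]; exact congrArg₂ (· + ·) ha hb
  smul_mem' := fun c a ha => by
    change t (c • a) = s • c • a
    rw [map_smul, smul_comm]; exact congrArg (c • ·) ha

theorem mem_eigenSub {t : V ≃ₗ[F] V} {s : F} {x : V} : x ∈ eigenSub t s ↔ t x = s • x := Iff.rfl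

section Involution

variable {t : V ≃ₗ[F] V} (h2 : (2 : F) ≠ 0) (ht : t * t = 1)

include h2 ht in
theorem exists_eigenSub_add (x : V) :
    ∃ u ∈ eigenSub t (1 : F), ∃ v ∈ eigenSub t (-1 : F), u + v = x := by
  have htt : t (t x) = x := LinearEquiv.congr_fun ht x
  refine ⟨(2⁻¹ : F) • (x + t x), ?_, (2⁻¹ : F) • (x - t x), ?_, ?_⟩
  · rw [mem_eigenSub, map_smul, map_add, htt]
    module
  · rw [mem_eigenSub, map_smul, map_sub, htt]
    module
  · rw [← smul_add, add_add_sub_cancel, ← two_smul F x, smul_smul, inv_mul_cancel₀ h2, one_smul]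

include h2 in
theorem eigenSub_orthogonal (hB : t ∈ isomGroup B) {u v : V} (hu : u ∈ eigenSub t (1 : F))
    (hv : v ∈ eigenSub t (-1 : F)) : B u v = 0 := by
  have h := hB u v
  rw [mem_eigenSub.mp hu, mem_eigenSub.mp hv, one_smul, neg_one_smul, map_neg,
    neg_eq_iff_add_eq_zero, ← two_mul] at h
  exact (mul_eq_zero.mp h).resolve_left h2

include h2 ht in
theorem isCompl_eigenSub : IsCompl (eigenSub t (1 : F)) (eigenSub t (-1 : F)) := by
  constructor
  · rw [Submodule.disjoint_def]
    intro x h1 h3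
    rw [mem_eigenSub] at h1 h3
    rw [h1, one_smul, neg_one_smul, ← sub_eq_zero, sub_neg_eq_add, ← two_smul F x] at h3
    exact (smul_eq_zero.mp h3).resolve_left h2
  · rw [codisjoint_iff, eq_top_iff]
    intro x _
    exact Submodule.mem_sup.mpr (exists_eigenSub_add h2 ht x)

include h2 ht in
theorem IsSymmNondeg.eigenSub (hB : IsSymmNondeg B) (htB : t ∈ isomGroup B) :
    IsSymmNondeg (formOn B (eigenSub t 1)) ∧ IsSymmNondeg (formOn B (eigenSub t (-1))) := by
  refine ⟨⟨fun x y => hB.symm x y, fun x hx => Subtype.ext (hB.nondeg _ fun y => ?_)⟩,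
    ⟨fun x y => hB.symm x y, fun x hx => Subtype.ext (hB.nondeg _ fun y => ?_)⟩⟩
  all_goals obtain ⟨u, hu, v, hv, rfl⟩ := exists_eigenSub_add h2 ht y
  · rw [map_add, eigenSub_orthogonal h2 htB x.2 hv, add_zero]
    exact hx ⟨u, hu⟩
  · rw [map_add, hB.symm x u, eigenSub_orthogonal h2 htB hu x.2, zero_add]
    exact hx ⟨v, hv⟩

end Involution

theorem eigenSub_mem_of_commute {t g : V ≃ₗ[F] V} (h : g * t = t * g) {s : F} {x : V}
    (hx : x ∈ eigenSub t s) : g x ∈ eigenSub t s := by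
  have h1 : g (t x) = t (g x) := LinearEquiv.congr_fun h x
  rw [mem_eigenSub] at hx ⊢
  rw [← h1, hx, map_smul]

theorem NoSymplectic.of_eigenSub [Finite F] [FiniteDimensional F V] (h2 : (2 : F) ≠ 0)
    (hB : IsSymmNondeg B) (z t : isomGroup B) (hzc : ∀ g, g * z = z * g) (hz2 : z * z = 1)
    (ht : t * t = 1)
    (h1 : NoSymplectic (isomGroup (formOn B (eigenSub (t : V ≃ₗ[F] V) 1))))
    (h3 : NoSymplectic (isomGroup (formOn B (eigenSub (t : V ≃ₗ[F] V) (-1)))))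
    (E : Subgroup (isomGroup B)) (hE : ∀ g, g ∈ E ↔ g * t * g⁻¹ = t ∨ g * t * g⁻¹ = z * t) :
    NoSymplectic E := by
  have ht' : (t : V ≃ₗ[F] V) * t = 1 := congrArg Subtype.val ht
  obtain ⟨hB1, hB3⟩ := hB.eigenSub h2 ht' t.2
  let e := Submodule.prodEquivOfIsCompl _ _ (isCompl_eigenSub h2 ht')
  have he : ∀ p, e p = (p.1 : V) + p.2 := fun p => rfl
  have heB : ∀ p q, B (e p) (e q) = formOn B (eigenSub (t : V ≃ₗ[F] V) 1) p.1 q.1 +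
      formOn B (eigenSub (t : V ≃ₗ[F] V) (-1)) p.2 q.2 := by
    intro p q
    simp only [he, map_add, LinearMap.add_apply, formOn_apply]
    rw [eigenSub_orthogonal h2 t.2 p.1.2 q.2.2, hB.symm p.2 q.1,
      eigenSub_orthogonal h2 t.2 q.1.2 p.2.2]
    ring
  have := finite_isomGroup B
  have := finite_isomGroup (formOn B (eigenSub (t : V ≃ₗ[F] V) 1))
  have := finite_isomGroup (formOn B (eigenSub (t : V ≃ₗ[F] V) (-1)))
  let f := isomGroupProd e heB
  have hfinj : Function.Injective f := isomGroupProd_injective e heB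
  have hf : ∀ p x, (f p : V ≃ₗ[F] V) (e x) = e (p.1.1 x.1, p.2.1 x.2) :=
    isomGroupProd_apply e heB
  have hte : ∀ x, (t : V ≃ₗ[F] V) (e x) = e (x.1, -x.2) := fun x => by
    rw [he, map_add, mem_eigenSub.mp x.1.2, mem_eigenSub.mp x.2.2, one_smul, neg_one_smul]
    rfl
  have hfE : ∀ p, f p ∈ E := by
    intro p
    refine (hE _).mpr (Or.inl ?_)
    rw [_root_.mul_inv_eq_iff_eq_mul]
    refine Subtype.ext (LinearEquiv.ext fun x => ?_)
    obtain ⟨x, rfl⟩ := e.surjective x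
    change (f p : V ≃ₗ[F] V) ((t : V ≃ₗ[F] V) (e x)) = (t : V ≃ₗ[F] V) ((f p : V ≃ₗ[F] V) (e x))
    rw [hte, hf, hf, hte, map_neg]
  have hmem : ∀ g : isomGroup B, g * t * g⁻¹ = t → g ∈ f.range := by
    intro g hg
    rw [_root_.mul_inv_eq_iff_eq_mul] at hg
    have hg1 : (g : V ≃ₗ[F] V) * t = t * g := congrArg Subtype.val hg
    have hg2 : (g : V ≃ₗ[F] V)⁻¹ * t = t * (g : V ≃ₗ[F] V)⁻¹ := by
      rw [_root_.inv_mul_eq_iff_eq_mul, ← mul_assoc, hg1, _root_.mul_inv_cancel_right]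
    obtain ⟨a, ha⟩ := exists_restrict_isom B g.2 (W := eigenSub (t : V ≃ₗ[F] V) 1)
      (fun x => eigenSub_mem_of_commute hg1) (fun x => eigenSub_mem_of_commute hg2)
    obtain ⟨b, hb⟩ := exists_restrict_isom B g.2 (W := eigenSub (t : V ≃ₗ[F] V) (-1))
      (fun x => eigenSub_mem_of_commute hg1) (fun x => eigenSub_mem_of_commute hg2)
    refine ⟨(a, b), Subtype.ext (LinearEquiv.ext fun x => ?_)⟩
    obtain ⟨x, rfl⟩ := e.surjective x
    rw [hf, he, he, map_add, ha, hb]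
  refine NoSymplectic.of_injective_of_card_le (f.codRestrict E hfE)
    (fun p q h => hfinj (congrArg Subtype.val h))
    (NoSymplectic.prod h1 h3 (hB1.isRealGroup h2) (hB3.isRealGroup h2))
    (IsRealGroup.prod (hB1.isRealGroup h2) (hB3.isRealGroup h2)) ?_
  rw [Nat.card_congr (MonoidHom.ofInjective hfinj).toEquiv]
  by_cases hb : ∃ b, b * t * b⁻¹ = z * t
  · obtain ⟨b, hb⟩ := hb
    refine card_le_two_mul_of_subset (b := b) fun g hg => ?_
    rcases (hE g).mp hg with h | h
    · exact Or.inl (hmem g h)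
    · refine Or.inr (hmem _ ?_)
      have hb' : b⁻¹ * t * b = z * t := by
        have : b⁻¹ * (z * (b * t * b⁻¹)) * b = b⁻¹ * (z * (z * t)) * b := by rw [hb]
        rw [← mul_assoc z z, hz2, one_mul] at this
        rw [← this, ← mul_assoc b⁻¹, hzc]
        group
      calc g * b⁻¹ * t * (g * b⁻¹)⁻¹ = g * (b⁻¹ * t * b) * g⁻¹ := by group
        _ = z * (g * t * g⁻¹) := by rw [hb', ← mul_assoc g, hzc g]; group
        _ = t := by rw [h, ← mul_assoc, hz2, one_mul]
  · refine card_le_two_mul_of_subset (b := 1) fun g hg => Or.inl (hmem g ?_)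
    exact ((hE g).mp hg).resolve_right fun h => hb ⟨g, h⟩

theorem IsSymmNondeg.noSymplectic [Finite F] [FiniteDimensional F V] (h2 : (2 : F) ≠ 0)
    (hB : IsSymmNondeg B) : NoSymplectic (isomGroup B) := by
  induction hn : Module.finrank F V using Nat.strong_induction_on generalizing V with
  | _ n ih =>
  rcases Nat.eq_zero_or_pos n with rfl | hpos
  · have := Module.finrank_zero_iff.mp hn
    exact noSymplectic_of_dihedral 1 1 (mul_one _) (by simp) fun g =>
      ⟨0, Or.inl (Subtype.ext (LinearEquiv.ext fun x => Subsingleton.elim _ _))⟩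
  have := Module.finrank_pos_iff.mp (hn ▸ hpos)
  have := finite_isomGroup B
  let z : isomGroup B := ⟨LinearEquiv.neg F, fun x y => by simp⟩
  have hz : ∀ x, (z : V ≃ₗ[F] V) x = -x := fun x => rfl
  have hz2 : z * z = 1 := Subtype.ext (LinearEquiv.ext fun x => neg_neg x)
  have hzc : ∀ g, g * z = z * g := fun g =>
    Subtype.ext (LinearEquiv.ext fun x => map_neg (g : V ≃ₗ[F] V) x)
  refine NoSymplectic.of_involutions hz2 (fun h => ?_) hzc (hB.exists_inverting h2)
    fun t ht ht1 htz E hE => ?_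
  · obtain ⟨x, hx⟩ := exists_ne (0 : V)
    have : -x = x := LinearEquiv.congr_fun (congrArg Subtype.val h) x
    rw [neg_eq_iff_add_eq_zero, ← two_smul F x] at this
    exact hx ((smul_eq_zero.mp this).resolve_left h2)
  · have ht' : (t : V ≃ₗ[F] V) * t = 1 := congrArg Subtype.val ht
    obtain ⟨hB1, hB3⟩ := hB.eigenSub h2 ht' t.2
    have hlt : ∀ s : F, (∃ x, (t : V ≃ₗ[F] V) x ≠ s • x) →
        Module.finrank F (_root_.eigenSub (t : V ≃ₗ[F] V) s) < n := by
      rintro s ⟨x, hx⟩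
      rw [← hn]
      exact Submodule.finrank_lt fun h => hx (mem_eigenSub.mp (h ▸ Submodule.mem_top))
    refine NoSymplectic.of_eigenSub h2 hB z t hzc hz2 ht (ih _ (hlt 1 ?_) hB1 rfl)
      (ih _ (hlt (-1) ?_) hB3 rfl) E hE
    · by_contra! hcon
      exact ht1 (Subtype.ext (LinearEquiv.ext fun x => (hcon x).trans (one_smul F x)))
    · by_contra! hcon
      exact htz (Subtype.ext (LinearEquiv.ext fun x => (hcon x).trans (neg_one_smul F x)))

end IsomGroup

section Complete

variable {G : Type} [Group G] [Fintype G]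

theorem Representation.IsIrreducible.simple {V : Type} [AddCommGroup V] [Module ℂ V]
    [FiniteDimensional ℂ V] {ρ : Representation ℂ G V} (h : ρ.IsIrreducible) :
    Simple (FDRep.of ρ) :=
  (FDRep.simple_iff_char_is_norm_one (FDRep.of ρ)).mpr h.sum_char_mul_char_inv

variable {κ : Type} [Fintype κ] {S : κ → FDRep ℂ G}

theorem exists_char_eq_sum (hcomplete : ∀ ρ : FDRep ℂ G, Simple ρ → ∃ i, Nonempty (ρ ≅ S i))
    {V : Type} [AddCommGroup V] [Module ℂ V] [FiniteDimensional ℂ V] (ρ : Representation ℂ G V) :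
    ∃ n : κ → ℕ, ∀ g, ρ.character g = ∑ i, n i * (S i).character g := by
  induction hn : Module.finrank ℂ V using Nat.strong_induction_on generalizing V with
  | _ n ih =>
  rcases subsingleton_or_nontrivial V with hV | hV
  · refine ⟨0, fun g => ?_⟩
    have : ρ g = 0 := LinearMap.ext fun x => Subsingleton.elim _ _
    simp [Representation.character, this]
  obtain ⟨σ, -, hσ0, hσ⟩ := exists_irreducible_sub (ρ := ρ) ⊤ top_ne_bot (fun _ _ _ => trivial)
  obtain ⟨K, hK, hKρ⟩ := exists_invariant_isCompl (ρ := ρ) σ.toSubmodule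
    (fun g w hw => σ.apply_mem_toSubmodule g hw)
  let τ : Subrepresentation ρ := ⟨K, fun g w hw => hKρ g w hw⟩
  have hlt : Module.finrank ℂ K < n := by
    rw [← hn, ← Submodule.finrank_add_eq_of_isCompl hK]
    have := Submodule.one_le_finrank_iff.mpr hσ0
    omega
  obtain ⟨m, hm⟩ := ih _ hlt τ.toRepresentation rfl
  obtain ⟨j, ⟨i⟩⟩ := hcomplete _ hσ.simple
  refine ⟨m + Pi.single j 1, fun g => ?_⟩
  have h1 : ρ.character g = σ.toRepresentation.character g + τ.toRepresentation.character g :=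
    trace_eq_add_of_isCompl hK (ρ g) (fun w hw => σ.apply_mem_toSubmodule g hw)
      (fun w hw => hKρ g w hw)
  have h2 : σ.toRepresentation.character g = (S j).character g :=
    congrFun (FDRep.char_iso i) g
  rw [h1, h2, hm]
  simp only [Pi.add_apply, Nat.cast_add, add_mul, Finset.sum_add_distrib]
  rw [add_comm, Finset.sum_eq_single (f := fun i => ((Pi.single j 1 : κ → ℕ) i : ℂ) * _) j]
  · simp
  · intro b _ hb
    simp [hb]
  · simp

variable (hsimple : ∀ i, Simple (S i)) (hdistinct : ∀ i j, Nonempty (S i ≅ S j) → i = j)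
  (hcomplete : ∀ ρ : FDRep ℂ G, Simple ρ → ∃ i, Nonempty (ρ ≅ S i))

include hsimple hdistinct

omit [Fintype κ] in
theorem sum_char_mul_char_inv_eq (i j : κ) :
    ∑ g, (S i).character g * (S j).character g⁻¹ = if i = j then (Nat.card G : ℂ) else 0 := by
  have hc : (Nat.card G : ℂ) ≠ 0 := by exact_mod_cast Nat.card_pos.ne'
  let _ : Invertible (Nat.card G : ℂ) := invertibleOfNonzero hc
  have := hsimple i
  have := hsimple j
  have h := FDRep.char_orthonormal (S i) (S j)
  have h' : Nonempty (S i ≅ S j) ↔ i = j := ⟨hdistinct i j, fun h => h ▸ ⟨Iso.refl _⟩⟩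
  rw [inv_mul_eq_iff_eq_mul₀ hc] at h
  rw [h]
  simp only [h']
  split_ifs <;> simp

theorem sum_combination_mul_char_inv (n : κ → ℕ) (j : κ) :
    ∑ g, (∑ i, n i * (S i).character g) * (S j).character g⁻¹ = n j * Nat.card G := by
  simp only [Finset.sum_mul]
  rw [Finset.sum_comm]
  simp only [mul_assoc, ← Finset.mul_sum, sum_char_mul_char_inv_eq hsimple hdistinct]
  simp

include hcomplete

theorem exists_irreducible_char_eq (j : κ) : ∃ (V : Type) (_ : AddCommGroup V) (_ : Module ℂ V)
    (_ : FiniteDimensional ℂ V) (ρ : Representation ℂ G V), ρ.IsIrreducible ∧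
      ∀ g, (S j).character g = ρ.character g := by
  let ρ : Representation ℂ G (S j) := (S j).ρ
  have hc : (Nat.card G : ℂ) ≠ 0 := by exact_mod_cast Nat.card_pos.ne'
  have hnt : Nontrivial (S j) := by
    by_contra hV
    rw [not_nontrivial_iff_subsingleton] at hV
    have h0 : ∀ g, (S j).character g = 0 := fun g => by
      have : ρ g = 0 := LinearMap.ext fun x => Subsingleton.elim _ _
      change LinearMap.trace ℂ _ (ρ g) = 0
      rw [this, map_zero]
    have := sum_char_mul_char_inv_eq hsimple hdistinct j j
    simp only [h0, mul_zero, Finset.sum_const_zero, if_true] at this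
    exact hc this.symm
  obtain ⟨σ, -, hσ0, hσ⟩ := exists_irreducible_sub (ρ := ρ) ⊤ top_ne_bot (fun _ _ _ => trivial)
  obtain ⟨K, hK, hKρ⟩ := exists_invariant_isCompl (ρ := ρ) σ.toSubmodule
    (fun g w hw => σ.apply_mem_toSubmodule g hw)
  let τ : Subrepresentation ρ := ⟨K, fun g w hw => hKρ g w hw⟩
  obtain ⟨m, hm⟩ := exists_char_eq_sum hcomplete τ.toRepresentation
  obtain ⟨i, ⟨e⟩⟩ := hcomplete _ hσ.simple
  have h1 : ∀ g, (S j).character g = (S i).character g + ∑ i, m i * (S i).character g := fun g => by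
    rw [← hm, ← FDRep.char_iso e]
    exact trace_eq_add_of_isCompl hK (ρ g) (fun w hw => σ.apply_mem_toSubmodule g hw)
      (fun w hw => hKρ g w hw)
  have h2 := sum_char_mul_char_inv_eq hsimple hdistinct j i
  simp only [h1, add_mul, Finset.sum_add_distrib] at h2
  rw [sum_combination_mul_char_inv hsimple hdistinct, sum_char_mul_char_inv_eq hsimple hdistinct,
    if_pos rfl, ← one_add_mul] at h2
  have hij : j = i := by
    by_contra hne
    rw [if_neg hne] at h2
    rcases mul_eq_zero.mp h2 with h | h
    · have : (1 + m i : ℕ) = (0 : ℕ) := by exact_mod_cast h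
      omega
    · exact hc h
  refine ⟨σ.toSubmodule, inferInstance, inferInstance, inferInstance, σ.toRepresentation, hσ,
    fun g => ?_⟩
  exact (congrArg (fun k => (S k).character g) hij).trans (congrFun (FDRep.char_iso e) g).symm

theorem sum_finrank_eq_card_involutions (hN : NoSymplectic G) (hG : IsRealGroup G) :
    ∑ j, (Module.finrank ℂ (S j) : ℝ) = Nat.card {g : G // g * g = 1} := by
  have hc : (Nat.card G : ℂ) ≠ 0 := by exact_mod_cast Nat.card_pos.ne'
  have hsq : ∀ j, ∑ g, (S j).character (g * g) = Nat.card G := by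
    intro j
    obtain ⟨V, _, _, _, ρ, hρ, hch⟩ := exists_irreducible_char_eq hsimple hdistinct hcomplete j
    simp only [hch]
    exact hN.sum_char_sq hG hρ
  let reg : Representation ℂ G (G → ℂ) :=
    { toFun := fun g => LinearMap.funLeft ℂ ℂ fun x => x * g
      map_one' := by ext; simp [LinearMap.funLeft_apply]
      map_mul' := fun a b => by ext; simp [LinearMap.funLeft_apply, mul_assoc] }
  have hreg : ∀ g, reg.character g = if g = 1 then (Nat.card G : ℂ) else 0 := by
    intro g
    rw [Representation.character, LinearMap.trace_eq_matrix_trace ℂ (Pi.basisFun ℂ G),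
      Matrix.trace]
    have : ∀ x, Matrix.diag (LinearMap.toMatrix (Pi.basisFun ℂ G) (Pi.basisFun ℂ G) (reg g)) x =
        if g = 1 then 1 else 0 := by
      intro x
      simp [reg, LinearMap.funLeft_apply, Pi.single_apply]
    simp only [this]
    split_ifs <;> simp
  obtain ⟨n, hn⟩ := exists_char_eq_sum hcomplete reg
  have hnj : ∀ j, (n j : ℂ) = Module.finrank ℂ (S j) := by
    intro j
    have h := sum_combination_mul_char_inv hsimple hdistinct n j
    simp only [← hn, hreg, ite_mul, zero_mul, Finset.sum_ite_eq', Finset.mem_univ, if_true,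
      _root_.inv_one, FDRep.char_one] at h
    rw [mul_comm] at h
    exact (mul_right_cancel₀ hc h).symm
  have h1 : ∑ g : G, reg.character (g * g) = (Nat.card {g : G // g * g = 1} : ℂ) * Nat.card G := by
    simp only [hreg]
    rw [← Finset.sum_filter, Finset.sum_const, nsmul_eq_mul,
      Nat.card_eq_fintype_card (α := {g : G // g * g = 1}),
      Fintype.card_subtype]
  simp only [hn] at h1
  rw [Finset.sum_comm] at h1
  simp only [← Finset.mul_sum, hsq, hnj, ← Finset.sum_mul] at h1
  exact_mod_cast mul_right_cancel₀ hc h1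

end Complete

section NondegSubspaces

variable {F : Type} [Field F] {V : Type} [AddCommGroup V] [Module F V]
  {B : LinearMap.BilinForm F V}

theorem IsSymmNondeg.isRefl (hB : IsSymmNondeg B) : B.IsRefl := fun x y h => by
  rw [← hB.symm]; exact h

theorem IsSymmNondeg.formOn_iff (hB : IsSymmNondeg B) (W : Submodule F V) :
    IsSymmNondeg (formOn B W) ↔ ∀ x ∈ W, (∀ y ∈ W, B x y = 0) → x = 0 := by
  refine ⟨fun h x hx hxy => ?_, fun h => ⟨fun x y => hB.symm x y, fun x hx => ?_⟩⟩
  · exact congrArg Subtype.val (h.nondeg ⟨x, hx⟩ fun y => hxy y y.2)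
  · exact Subtype.ext (h x x.2 fun y hy => hx ⟨y, hy⟩)

theorem IsSymmNondeg.isCompl_orthogonal [FiniteDimensional F V] (hB : IsSymmNondeg B)
    {W : Submodule F V} (hW : IsSymmNondeg (formOn B W)) : IsCompl W (B.orthogonal W) := by
  rw [LinearMap.BilinForm.isCompl_orthogonal_iff_disjoint hB.isRefl, Submodule.disjoint_def]
  intro x hx hx'
  exact (hB.formOn_iff W).mp hW x hx fun y hy => by rw [hB.symm]; exact hx' y hy

theorem mem_orthogonal_span_range {ι : Type*} {s : ι → V} {x : V} :
    x ∈ B.orthogonal (Submodule.span F (Set.range s)) ↔ ∀ i, B (s i) x = 0 := by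
  refine ⟨fun h i => h _ (Submodule.subset_span ⟨i, rfl⟩), fun h y hy => ?_⟩
  have : Submodule.span F (Set.range s) ≤ LinearMap.ker (B.flip x) := by
    rw [Submodule.span_le]
    rintro _ ⟨i, rfl⟩
    exact h i
  exact this hy

theorem IsSymmNondeg.sup_iff [FiniteDimensional F V] (hB : IsSymmNondeg B) {P : Submodule F V}
    (hP : IsSymmNondeg (formOn B P)) (U : Submodule F (B.orthogonal P)) :
    IsSymmNondeg (formOn B (U.map (B.orthogonal P).subtype ⊔ P)) ↔
      IsSymmNondeg (formOn (formOn B (B.orthogonal P)) U) := by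
  have hort : ∀ p ∈ P, ∀ u : B.orthogonal P, B p u = 0 := fun p hp u => u.2 p hp
  have hort' : ∀ p ∈ P, ∀ u : B.orthogonal P, B u p = 0 := fun p hp u => by
    rw [hB.symm, hort p hp]
  have hPx := (hB.formOn_iff P).mp hP
  rw [hB.formOn_iff]
  refine ⟨fun h => ⟨fun x y => hB.symm x y, fun x hx => ?_⟩, fun h x hx hxy => ?_⟩
  · refine Subtype.ext (Subtype.ext (h x (Submodule.mem_sup_left ⟨x, x.2, rfl⟩) fun y hy => ?_))
    obtain ⟨_, ⟨u, hu, rfl⟩, p, hp, rfl⟩ := Submodule.mem_sup.mp hy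
    rw [map_add, hort' p hp, add_zero]
    exact hx ⟨u, hu⟩
  · obtain ⟨_, ⟨u, hu, rfl⟩, p, hp, rfl⟩ := Submodule.mem_sup.mp hx
    have hu0 : (⟨u, hu⟩ : U) = 0 := h.nondeg _ fun y => by
      have := hxy y (Submodule.mem_sup_left ⟨y, y.2, rfl⟩)
      rw [map_add, LinearMap.add_apply, hort p hp, add_zero] at this
      exact this
    have hp0 : p = 0 := hPx p hp fun y hy => by
      have := hxy y (Submodule.mem_sup_right hy)
      rw [map_add, LinearMap.add_apply] at this
      rwa [Submodule.subtype_apply, hort' y hy, zero_add] at this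
    have hu0' : u = 0 := congrArg Subtype.val hu0
    rw [hp0, hu0', map_zero, add_zero]

theorem IsSymmNondeg.orthogonal [FiniteDimensional F V] (hB : IsSymmNondeg B) {P : Submodule F V}
    (hP : IsSymmNondeg (formOn B P)) : IsSymmNondeg (formOn B (B.orthogonal P)) := by
  rw [hB.formOn_iff]
  intro x hx hxy
  refine hB.nondeg x fun y => ?_
  have : y ∈ P ⊔ B.orthogonal P := by
    rw [(hB.isCompl_orthogonal hP).sup_eq_top]; trivial
  obtain ⟨p, hp, u, hu, rfl⟩ := Submodule.mem_sup.mp this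
  rw [map_add, hxy u hu, hB.symm, hx p hp, add_zero]

/-- The number of nondegenerate subspaces of dimension `k`. -/
def nondegCount (B : LinearMap.BilinForm F V) (k : ℕ) : ℕ :=
  Nat.card {W : Submodule F V // IsSymmNondeg (formOn B W) ∧ Module.finrank F W = k}

/-- The Gram matrix of a tuple. -/
def gramMatrix (B : LinearMap.BilinForm F V) {j : ℕ} (s : Fin j → V) : Matrix (Fin j) (Fin j) F :=
  Matrix.of fun a b => B (s a) (s b)

theorem eq_zero_of_gramMatrix {j : ℕ} {s : Fin j → V} (hs : (gramMatrix B s).det ≠ 0)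
    {c : Fin j → F} (hc : ∀ b, B (∑ a, c a • s a) (s b) = 0) : c = 0 := by
  refine Matrix.eq_zero_of_vecMul_eq_zero hs (funext fun b => ?_)
  refine Eq.trans ?_ (hc b)
  simp [Matrix.vecMul, dotProduct, gramMatrix, map_sum, LinearMap.sum_apply]

theorem finrank_span_of_gramMatrix {j : ℕ} {s : Fin j → V} (hs : (gramMatrix B s).det ≠ 0) :
    Module.finrank F (Submodule.span F (Set.range s)) = j := by
  have : LinearIndependent F s := by
    rw [Fintype.linearIndependent_iff]
    intro c hc
    exact congrFun (eq_zero_of_gramMatrix hs fun b => by rw [hc]; simp)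
  rw [finrank_span_eq_card this, Fintype.card_fin]

theorem IsSymmNondeg.span_of_gramMatrix (hB : IsSymmNondeg B) {j : ℕ} {s : Fin j → V}
    (hs : (gramMatrix B s).det ≠ 0) :
    IsSymmNondeg (formOn B (Submodule.span F (Set.range s))) := by
  rw [hB.formOn_iff]
  intro x hx hxy
  obtain ⟨c, rfl⟩ := (Submodule.mem_span_range_iff_exists_fun F).mp hx
  rw [eq_zero_of_gramMatrix hs fun b => hxy _ (Submodule.subset_span ⟨b, rfl⟩)]
  simp

theorem IsSymmNondeg.card_containing [FiniteDimensional F V] (hB : IsSymmNondeg B)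
    {P : Submodule F V} (hP : IsSymmNondeg (formOn B P)) (k : ℕ) {j : ℕ}
    (hj : Module.finrank F P = j) :
    Nat.card {W : {W : Submodule F V // IsSymmNondeg (formOn B W) ∧
        Module.finrank F W = k + j} // P ≤ W} =
      nondegCount (formOn B (B.orthogonal P)) k := by
  have hc := (hB.isCompl_orthogonal hP).symm
  let e : Submodule F (B.orthogonal P) ≃o Set.Ici P :=
    (Submodule.mapIic _).trans hc.IicOrderIsoIci
  have he : ∀ U, (e U : Submodule F V) = U.map (B.orthogonal P).subtype ⊔ P := fun U => rfl
  refine (Nat.card_congr ?_).symm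
  refine (e.toEquiv.subtypeEquiv (q := fun W : Set.Ici P => IsSymmNondeg (formOn B (W : Submodule F V)) ∧
    Module.finrank F (W : Submodule F V) = k + j) fun U => ?_).trans ?_
  · change _ ↔ IsSymmNondeg (formOn B (e U : Submodule F V)) ∧
      Module.finrank F (e U : Submodule F V) = _
    rw [he, hB.sup_iff hP]
    have h1 := Submodule.finrank_sup_add_finrank_inf_eq (U.map (B.orthogonal P).subtype) P
    have h2 : U.map (B.orthogonal P).subtype ⊓ P = ⊥ :=
      eq_bot_iff.mpr (le_trans (inf_le_inf_right _ (Submodule.map_subtype_le _ _)) hc.inf_eq_bot.le)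
    rw [h2, finrank_bot, add_zero, Submodule.finrank_map_subtype_eq] at h1
    rw [h1, hj, Nat.add_right_cancel_iff]
  · exact
      { toFun := fun W => ⟨⟨W.1, W.2⟩, W.1.2⟩
        invFun := fun W => ⟨⟨W.1.1, W.2⟩, W.1.2⟩
        left_inv := fun _ => rfl
        right_inv := fun _ => rfl }

/-- The number of `j`-tuples with nondegenerate Gram matrix. -/
def tupleCount (B : LinearMap.BilinForm F V) (j : ℕ) : ℕ :=
  Nat.card {s : Fin j → V // (gramMatrix B s).det ≠ 0}

theorem card_mul_eq_card_mul_of_fibers {α β : Type*} [Finite α] [Finite β] (r : α → β → Prop)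
    {c d : ℝ} (hc : ∀ a, (Nat.card {b // r a b} : ℝ) = c)
    (hd : ∀ b, (Nat.card {a // r a b} : ℝ) = d) :
    (Nat.card α : ℝ) * c = Nat.card β * d := by
  have := Fintype.ofFinite α
  have := Fintype.ofFinite β
  have h1 : Nat.card (Σ a, {b // r a b}) = Nat.card (Σ b, {a // r a b}) :=
    Nat.card_congr
      { toFun := fun x => ⟨x.2.1, x.1, x.2.2⟩
        invFun := fun x => ⟨x.2.1, x.1, x.2.2⟩
        left_inv := fun _ => rfl
        right_inv := fun _ => rfl }
  rw [Nat.card_sigma, Nat.card_sigma] at h1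
  have h2 := congrArg (Nat.cast : ℕ → ℝ) h1
  simp only [Nat.cast_sum, hc, hd, Finset.sum_const, Finset.card_univ, nsmul_eq_mul,
    ← Nat.card_eq_fintype_card] at h2
  exact h2

theorem IsSymmNondeg.nondegCount_mul [Finite F] [FiniteDimensional F V] (hB : IsSymmNondeg B)
    {k j : ℕ} {c d : ℝ}
    (hc : ∀ W : Submodule F V, IsSymmNondeg (formOn B W) → Module.finrank F W = k + j →
      (tupleCount (formOn B W) j : ℝ) = c)
    (hd : ∀ W : Submodule F V, IsSymmNondeg (formOn B W) →
      Module.finrank F W + j = Module.finrank F V →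
        (nondegCount (formOn B W) k : ℝ) = d) :
    (nondegCount B (k + j) : ℝ) * c = tupleCount B j * d := by
  have := Module.finite_of_finite F (M := V)
  refine card_mul_eq_card_mul_of_fibers
    (fun (W : {W : Submodule F V // IsSymmNondeg (formOn B W) ∧ Module.finrank F W = k + j})
      (s : {s : Fin j → V // (gramMatrix B s).det ≠ 0}) => ∀ i, s.1 i ∈ W.1)
    (fun W => ?_) (fun s => ?_)
  · rw [← hc W.1 W.2.1 W.2.2]
    exact congrArg Nat.cast <| Nat.card_congr
      { toFun := fun s => ⟨fun i => ⟨s.1.1 i, s.2 i⟩, s.1.2⟩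
        invFun := fun s => ⟨⟨fun i => s.1 i, s.2⟩, fun i => (s.1 i).2⟩
        left_inv := fun _ => rfl
        right_inv := fun _ => rfl }
  · have hP := hB.span_of_gramMatrix s.2
    have hj := finrank_span_of_gramMatrix s.2
    have hsum := Submodule.finrank_add_eq_of_isCompl (hB.isCompl_orthogonal hP)
    rw [← hd _ (hB.orthogonal hP) (by omega), ← hB.card_containing hP k hj]
    simp only [Submodule.span_le, Set.range_subset_iff, SetLike.mem_coe]

end NondegSubspaces

section IsotropicCount

theorem card_eq_card_and_add {α : Type*} [Finite α] (p r : α → Prop) :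
    Nat.card {x // p x} = Nat.card {x // p x ∧ r x} + Nat.card {x // p x ∧ ¬ r x} := by
  have := Fintype.ofFinite α
  simp only [Nat.card_eq_fintype_card, Fintype.card_subtype]
  rw [← Finset.card_filter_add_card_filter_not (s := Finset.univ.filter p) r,
    Finset.filter_filter, Finset.filter_filter]

variable {F : Type} [Field F] {V : Type} [AddCommGroup V] [Module F V]
  {B : LinearMap.BilinForm F V}

theorem card_mul_card_of_translate (u : V) (φ : V → F) {p r : V → Prop}
    (h1 : ∀ (x : V) (t : F), p x → r (x + t • u)) (h2 : ∀ x t, p x → φ (x + t • u) = t)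
    (h3 : ∀ y, r y → p (y - φ y • u)) :
    Nat.card F * Nat.card {x // p x} = Nat.card {y // r y} := by
  rw [← Nat.card_prod]
  exact Nat.card_congr
    { toFun := fun x => ⟨x.2 + x.1 • u, h1 _ _ x.2.2⟩
      invFun := fun y => (φ y, ⟨y - φ y • u, h3 _ y.2⟩)
      left_inv := fun x => Prod.ext (h2 _ _ x.2.2)
        (Subtype.ext (by simp [h2 _ _ x.2.2]))
      right_inv := fun y => Subtype.ext (sub_add_cancel _ _) }

/-- The number of isotropic vectors, including zero. -/
def isoCount (B : LinearMap.BilinForm F V) : ℕ := Nat.card {v : V // B v v = 0}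

theorem IsSymmNondeg.exists_eq_one (hB : IsSymmNondeg B) {u : V} (hu : u ≠ 0) :
    ∃ v, B u v = 1 := by
  by_contra! h
  refine hu (hB.nondeg u fun y => ?_)
  by_contra hy
  refine h ((B u y)⁻¹ • y) ?_
  rw [map_smul, smul_eq_mul, inv_mul_cancel₀ hy]

theorem IsSymmNondeg.exists_hyperbolic (hB : IsSymmNondeg B) (h2 : (2 : F) ≠ 0) {u : V}
    (hu : u ≠ 0) (huu : B u u = 0) : ∃ v, B u v = 1 ∧ B v v = 0 := by
  obtain ⟨v, hv⟩ := hB.exists_eq_one hu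
  refine ⟨v - (B v v / 2) • u, by simp [hv, huu], ?_⟩
  simp only [map_sub, map_smul, LinearMap.sub_apply, LinearMap.smul_apply, smul_eq_mul, hv, huu,
    hB.symm v u]
  field_simp
  ring

theorem IsSymmNondeg.card_mul_card_perp [Finite F] (hB : IsSymmNondeg B) {u : V} (hu : u ≠ 0) :
    Nat.card F * Nat.card {v // B u v = 0} = Nat.card V := by
  obtain ⟨v, hv⟩ := hB.exists_eq_one hu
  rw [card_mul_card_of_translate v (B u) (r := fun _ => True) (fun _ _ _ => trivial)
    (fun x t hx => by simp [hx, hv]) (fun y _ => by simp [hv])]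
  exact Nat.card_congr (Equiv.subtypeUnivEquiv fun _ => trivial)

theorem IsSymmNondeg.card_mul_card_not_perp (hB : IsSymmNondeg B)
    (h2 : (2 : F) ≠ 0) {u : V} (huu : B u u = 0) :
    Nat.card F * Nat.card {v // B v v = 0 ∧ ¬ B u v = 0} = Nat.card {v // ¬ B u v = 0} := by
  refine card_mul_card_of_translate u (fun w => B w w / (2 * B u w)) (fun x t hx => ?_)
    (fun x t hx => ?_) (fun y hy => ⟨?_, ?_⟩)
  · simp [huu, hx.2]
  · simp only [map_add, map_smul, LinearMap.add_apply, LinearMap.smul_apply, smul_eq_mul, huu,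
      hx.1, hB.symm x u, mul_zero, add_zero]
    rw [div_eq_iff (mul_ne_zero h2 hx.2)]
    ring
  · simp only [map_sub, map_smul, LinearMap.sub_apply, LinearMap.smul_apply, smul_eq_mul, huu,
      hB.symm y u]
    field_simp
    ring
  · simpa [huu] using hy

theorem card_eq_card_add (α : Type*) [Finite α] (r : α → Prop) :
    Nat.card α = Nat.card {x // r x} + Nat.card {x // ¬ r x} := by
  have := card_eq_card_and_add (fun _ : α => True) r
  simpa only [true_and, Nat.card_congr (Equiv.subtypeUnivEquiv fun _ : α => trivial)] using this

theorem IsSymmNondeg.isoCount_eq [Finite F] [Finite V] (hB : IsSymmNondeg B) (h2 : (2 : F) ≠ 0)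
    {u : V} (hu : u ≠ 0) (huu : B u u = 0) :
    Nat.card F * Nat.card F * isoCount B + Nat.card V =
      Nat.card F * Nat.card F * Nat.card {v // B v v = 0 ∧ B u v = 0} +
        Nat.card F * Nat.card V := by
  have h1 := card_eq_card_and_add (fun v => B v v = 0) (fun v => B u v = 0)
  have h3 := hB.card_mul_card_not_perp h2 huu
  have h4 := hB.card_mul_card_perp hu
  have h5 := card_eq_card_add V fun v => B u v = 0
  rw [isoCount, h1]
  nlinarith

/-- The orthogonal complement of a pair of vectors. -/
abbrev pairOrthogonal (B : LinearMap.BilinForm F V) (u v : V) : Submodule F V :=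
  B.orthogonal (Submodule.span F (Set.range ![u, v]))

theorem mem_pairOrthogonal {u v x : V} : x ∈ pairOrthogonal B u v ↔ B u x = 0 ∧ B v x = 0 := by
  rw [mem_orthogonal_span_range, Fin.forall_fin_two]
  rfl

theorem IsSymmNondeg.formOn_pairOrthogonal [FiniteDimensional F V] (hB : IsSymmNondeg B) {u v : V}
    (huu : B u u = 0) (huv : B u v = 1) :
    IsSymmNondeg (formOn B (pairOrthogonal B u v)) ∧
      Module.finrank F (pairOrthogonal B u v) + 2 = Module.finrank F V := by
  have hdet : (gramMatrix B ![u, v]).det ≠ 0 := by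
    rw [Matrix.det_fin_two]
    simp [gramMatrix, huu, huv, hB.symm v u]
  have hP := hB.span_of_gramMatrix hdet
  have hsum := Submodule.finrank_add_eq_of_isCompl (hB.isCompl_orthogonal hP)
  rw [finrank_span_of_gramMatrix hdet] at hsum
  exact ⟨hB.orthogonal hP, (add_comm _ _).trans hsum⟩

theorem IsSymmNondeg.card_perp_eq (hB : IsSymmNondeg B) {u v : V}
    (huu : B u u = 0) (huv : B u v = 1) :
    Nat.card F * isoCount (formOn B (pairOrthogonal B u v)) =
      Nat.card {x // B x x = 0 ∧ B u x = 0} := by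
  have hvu : B v u = 1 := by rw [hB.symm, huv]
  have hB' := hB.symm
  rw [← card_mul_card_of_translate (p := fun x => x ∈ pairOrthogonal B u v ∧ B x x = 0)
    u (B v) (fun x t hx => ?_) (fun x t hx => ?_) (fun y hy => ?_)]
  · congr 1
    exact Nat.card_congr
      { toFun := fun x => ⟨x.1, x.1.2, x.2⟩
        invFun := fun x => ⟨⟨x.1, x.2.1⟩, x.2.2⟩
        left_inv := fun _ => rfl
        right_inv := fun _ => rfl }
  · obtain ⟨h1, h2⟩ := hx
    rw [mem_pairOrthogonal] at h1
    simp [huu, h1, h2, hB' x u]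
  · rw [mem_pairOrthogonal] at hx
    simp [hvu, hx]
  · rw [mem_pairOrthogonal]
    simp [huu, hy, hvu, hB' y u]

theorem IsSymmNondeg.isoCount_recursion [Finite F] [FiniteDimensional F V] (hB : IsSymmNondeg B)
    (h2 : (2 : F) ≠ 0) {u v : V} (huu : B u u = 0) (huv : B u v = 1) :
    Nat.card F ^ 2 * isoCount B + Nat.card F ^ Module.finrank F V =
      Nat.card F ^ 3 * isoCount (formOn B (pairOrthogonal B u v)) +
        Nat.card F ^ (Module.finrank F V + 1) := by
  have := Module.finite_of_finite F (M := V)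
  have hu : u ≠ 0 := by rintro rfl; simp at huv
  have h := hB.isoCount_eq h2 hu huu
  rw [← hB.card_perp_eq huu huv, Module.natCard_eq_pow_finrank (K := F) (V := V)] at h
  linear_combination h

theorem exists_ne_zero_perp [FiniteDimensional F V] (hn : 3 ≤ Module.finrank F V) (u v : V) :
    ∃ x, x ≠ 0 ∧ B u x = 0 ∧ B v x = 0 := by
  have h1 := LinearMap.finrank_range_add_finrank_ker ((B u).prod (B v))
  have h2 : Module.finrank F (LinearMap.range ((B u).prod (B v))) ≤ 2 :=
    (Submodule.finrank_le _).trans (by simp)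
  have h3 : LinearMap.ker ((B u).prod (B v)) ≠ ⊥ := fun h => by
    rw [h, finrank_bot] at h1
    omega
  obtain ⟨x, hx, hx0⟩ := Submodule.exists_mem_ne_zero_of_ne_bot h3
  rw [LinearMap.mem_ker] at hx
  exact ⟨x, hx0, congrArg Prod.fst hx, congrArg Prod.snd hx⟩

theorem IsSymmNondeg.exists_isotropic [Fintype F] [FiniteDimensional F V] (hB : IsSymmNondeg B)
    (hF : Odd (Fintype.card F)) (hn : 3 ≤ Module.finrank F V) : ∃ u, u ≠ 0 ∧ B u u = 0 := by
  by_contra! h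
  obtain ⟨u, hu, -⟩ := exists_ne_zero_perp (B := B) hn 0 0
  obtain ⟨v, hv, huv, -⟩ := exists_ne_zero_perp (B := B) hn u u
  obtain ⟨w, hw, huw, hvw⟩ := exists_ne_zero_perp (B := B) hn u v
  have hdeg : ∀ c a : F, a ≠ 0 → (Polynomial.C a * Polynomial.X ^ 2 + Polynomial.C c).degree = 2 := by
    intro c a ha
    have := Polynomial.degree_quadratic (a := a) (b := 0) (c := c) ha
    simpa using this
  obtain ⟨a, b, hab⟩ := FiniteField.exists_root_sum_quadratic (hdeg 0 _ (h u hu))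
    (hdeg (B w w) _ (h v hv)) (Nat.odd_iff.mp hF)
  simp only [map_zero, add_zero, Polynomial.eval_mul, Polynomial.eval_C, Polynomial.eval_pow,
    Polynomial.eval_X, Polynomial.eval_add] at hab
  refine h (a • u + b • v + w) (fun h0 => ?_) ?_
  · have : B w (a • u + b • v + w) = B w w := by
      simp [hB.symm w u, hB.symm w v, huw, hvw]
    rw [h0, map_zero] at this
    exact h w hw this.symm
  · simp only [map_add, map_smul, LinearMap.add_apply, LinearMap.smul_apply, smul_eq_mul,
      hB.symm w u, hB.symm w v, hB.symm v u, huv, huw, hvw]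
    linear_combination hab

theorem isoCount_of_anisotropic (h : ∀ u, B u u = 0 → u = 0) : isoCount B = 1 := by
  rw [isoCount, Nat.card_eq_one_iff_unique]
  exact ⟨⟨fun x y => Subtype.ext ((h _ x.2).trans (h _ y.2).symm)⟩, ⟨0, by simp⟩⟩

theorem IsSymmNondeg.isoCount_odd [Fintype F] [FiniteDimensional F V] (hB : IsSymmNondeg B)
    (hF : Odd (Fintype.card F)) (h2 : (2 : F) ≠ 0) {m : ℕ} (hn : Module.finrank F V = 2 * m + 1) :
    isoCount B = Nat.card F ^ (2 * m) := by
  induction m generalizing V with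
  | zero =>
    rw [mul_zero, pow_zero]
    refine isoCount_of_anisotropic fun u huu => ?_
    by_contra hu
    refine hu (hB.nondeg u fun y => ?_)
    obtain ⟨c, rfl⟩ := exists_smul_eq_of_finrank_eq_one hn hu y
    simp [huu]
  | succ m ih =>
    obtain ⟨u, hu, huu⟩ := hB.exists_isotropic hF (by omega)
    obtain ⟨v, huv, -⟩ := hB.exists_hyperbolic h2 hu huu
    obtain ⟨hB', hn'⟩ := hB.formOn_pairOrthogonal huu huv
    have h := hB.isoCount_recursion h2 huu huv
    rw [ih hB' (by omega), hn] at h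
    have hq : 0 < Nat.card F := Nat.card_pos
    refine Nat.eq_of_mul_eq_mul_left (pow_pos hq 2) ?_
    refine Nat.add_right_cancel (h.trans ?_)
    ring

/-- A system of `m` mutually orthogonal hyperbolic pairs. -/
def HasHyperbolicSystem (B : LinearMap.BilinForm F V) (m : ℕ) : Prop :=
  ∃ e f : Fin m → V, (∀ i j, B (e i) (e j) = 0) ∧ (∀ i j, B (f i) (f j) = 0) ∧
    ∀ i j, B (e i) (f j) = if i = j then 1 else 0

theorem IsSymmNondeg.hasHyperbolicSystem_succ (hB : IsSymmNondeg B) {u v : V}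
    (huu : B u u = 0) (hvv : B v v = 0) (huv : B u v = 1) {m : ℕ}
    (h : HasHyperbolicSystem (formOn B (pairOrthogonal B u v)) m) :
    HasHyperbolicSystem B (m + 1) := by
  obtain ⟨e, f, hee, hff, hef⟩ := h
  have hu : ∀ x : pairOrthogonal B u v, B u x = 0 := fun x => (mem_pairOrthogonal.mp x.2).1
  have hv : ∀ x : pairOrthogonal B u v, B v x = 0 := fun x => (mem_pairOrthogonal.mp x.2).2
  refine ⟨Fin.cons u fun i => e i, Fin.cons v fun i => f i, fun i j => ?_, fun i j => ?_,
    fun i j => ?_⟩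
  · refine Fin.cases ?_ (fun i => ?_) i <;> refine Fin.cases ?_ (fun j => ?_) j
    · simpa using huu
    · simpa using hu _
    · simpa [hB.symm _ u] using hu _
    · simpa [formOn_apply] using hee i j
  · refine Fin.cases ?_ (fun i => ?_) i <;> refine Fin.cases ?_ (fun j => ?_) j
    · simpa using hvv
    · simpa using hv _
    · simpa [hB.symm _ v] using hv _
    · simpa [formOn_apply] using hff i j
  · refine Fin.cases ?_ (fun i => ?_) i <;> refine Fin.cases ?_ (fun j => ?_) j
    · simpa using huv
    · simpa [(Fin.succ_ne_zero _).symm] using hu _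
    · simpa [hB.symm _ v, Fin.succ_ne_zero] using hv _
    · simpa [formOn_apply, Fin.succ_inj] using hef i j

theorem exists_hyperbolic_pair_of_hasHyperbolicSystem (hB : IsSymmNondeg B) {m : ℕ}
    (h : HasHyperbolicSystem B (m + 1)) : ∃ u v, B u u = 0 ∧ B v v = 0 ∧ B u v = 1 ∧
      HasHyperbolicSystem (formOn B (pairOrthogonal B u v)) m := by
  obtain ⟨e, f, hee, hff, hef⟩ := h
  have he : ∀ i : Fin m, e i.succ ∈ pairOrthogonal B (e 0) (f 0) := fun i => by
    rw [mem_pairOrthogonal, hee, hB.symm, hef]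
    simp [Fin.succ_ne_zero]
  have hf : ∀ i : Fin m, f i.succ ∈ pairOrthogonal B (e 0) (f 0) := fun i => by
    rw [mem_pairOrthogonal, hff, hef]
    simp [(Fin.succ_ne_zero _).symm]
  refine ⟨e 0, f 0, hee 0 0, hff 0 0, by simp [hef], fun i => ⟨_, he i⟩, fun i => ⟨_, hf i⟩,
    fun i j => hee _ _, fun i j => hff _ _, fun i j => ?_⟩
  rw [formOn_apply, hef]
  simp [Fin.succ_inj]

theorem IsSymmNondeg.isoCount_even [Fintype F] [FiniteDimensional F V] (hB : IsSymmNondeg B)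
    (hF : Odd (Fintype.card F)) (h2 : (2 : F) ≠ 0) {m : ℕ} (hn : Module.finrank F V = 2 * m) :
    (Nat.card F : ℤ) * isoCount B = (Nat.card F : ℤ) ^ (2 * m) +
      (if HasHyperbolicSystem B m then 1 else -1) *
        ((Nat.card F : ℤ) ^ (m + 1) - (Nat.card F : ℤ) ^ m) := by
  have hq : (Nat.card F : ℤ) ≠ 0 := by exact_mod_cast Nat.card_pos.ne'
  induction m generalizing V with
  | zero =>
    have := Module.finrank_zero_iff.mp hn
    rw [if_pos ⟨Fin.elim0, Fin.elim0, fun i => i.elim0, fun i => i.elim0, fun i => i.elim0⟩,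
      isoCount_of_anisotropic fun u _ => Subsingleton.elim _ _]
    ring
  | succ m ih =>
    have key : ∀ u v, B u u = 0 → B u v = 1 →
        (HasHyperbolicSystem (formOn B (pairOrthogonal B u v)) m ↔
          HasHyperbolicSystem B (m + 1)) →
        (Nat.card F : ℤ) * isoCount B = (Nat.card F : ℤ) ^ (2 * (m + 1)) +
          (if HasHyperbolicSystem B (m + 1) then 1 else -1) *
            ((Nat.card F : ℤ) ^ (m + 1 + 1) - (Nat.card F : ℤ) ^ (m + 1)) := by
      intro u v huu huv hiff
      obtain ⟨hB', hn'⟩ := hB.formOn_pairOrthogonal huu huv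
      have h := hB.isoCount_recursion h2 huu huv
      have ih := ih hB' (by omega)
      rw [hn] at h
      zify at h
      simp only [hiff] at ih
      refine mul_left_cancel₀ hq ?_
      linear_combination h + (Nat.card F : ℤ) ^ 2 * ih
    by_cases hsys : HasHyperbolicSystem B (m + 1)
    · obtain ⟨u, v, huu, -, huv, h⟩ := exists_hyperbolic_pair_of_hasHyperbolicSystem hB hsys
      exact key u v huu huv (iff_of_true h hsys)
    · by_cases hiso : ∃ u, u ≠ 0 ∧ B u u = 0
      · obtain ⟨u, hu, huu⟩ := hiso
        obtain ⟨v, huv, hvv⟩ := hB.exists_hyperbolic h2 hu huu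
        exact key u v huu huv ⟨hB.hasHyperbolicSystem_succ huu hvv huv, fun h => (hsys h).elim⟩
      · have hm : m = 0 := by
          by_contra hm
          exact hiso (hB.exists_isotropic hF (by omega))
        subst hm
        push Not at hiso
        rw [if_neg hsys, isoCount_of_anisotropic fun u huu => by
          by_contra hu
          exact hiso u hu huu]
        ring

end IsotropicCount

section TupleCount

variable {F : Type} [Field F] {V : Type} [AddCommGroup V] [Module F V]
  {B : LinearMap.BilinForm F V}

theorem natCard_subtype_eq_sum {α : Type*} [Fintype α] (p : α → Prop) [DecidablePred p] :
    (Nat.card {x // p x} : ℝ) = ∑ x, if p x then 1 else 0 := by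
  rw [Nat.card_eq_fintype_card, Fintype.card_subtype]
  simp

theorem tupleCount_one [Finite V] :
    (tupleCount B 1 : ℝ) = Nat.card V - isoCount B := by
  have h := card_eq_card_add V fun v => B v v = 0
  have h1 : tupleCount B 1 = Nat.card {v : V // ¬ B v v = 0} := by
    refine Nat.card_congr ((Equiv.funUnique (Fin 1) V).subtypeEquiv fun s => ?_)
    rw [Matrix.det_fin_one]
    rfl
  rw [h1, h, isoCount]
  push_cast
  ring

theorem sum_isotropic [Fintype V] (a b : ℝ) :
    (∑ u : V, if B u u = 0 then if u = 0 then a else b else 0) = a + (isoCount B - 1) * b := by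
  have h : ∀ u : V, (if B u u = 0 then if u = 0 then a else b else 0) =
      (if B u u = 0 then 1 else 0) * b + if u = 0 then a - b else 0 := by
    intro u
    by_cases hu : u = 0
    · simp [hu]
    · simp [hu]
  simp only [h, Finset.sum_add_distrib, ← Finset.sum_mul, ← natCard_subtype_eq_sum,
    Finset.sum_ite_eq', Finset.mem_univ, if_true, isoCount]
  ring

variable [Finite F] [Fintype V] (hB : IsSymmNondeg B) (h2 : (2 : F) ≠ 0)

include hB

omit [Fintype V] in
theorem IsSymmNondeg.card_perp {u : V} (hu : u ≠ 0) :
    (Nat.card {v // B u v = 0} : ℝ) = Nat.card V / Nat.card F := by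
  have hq : (Nat.card F : ℝ) ≠ 0 := by exact_mod_cast Nat.card_pos.ne'
  rw [eq_div_iff hq, mul_comm]
  exact_mod_cast hB.card_mul_card_perp hu

include h2 in
theorem IsSymmNondeg.card_isotropic_perp {u : V} (hu : u ≠ 0) (huu : B u u = 0) :
    (Nat.card {v // B v v = 0 ∧ B u v = 0} : ℝ) =
      isoCount B + Nat.card V / Nat.card F ^ 2 - Nat.card V / Nat.card F := by
  have hq : (Nat.card F : ℝ) ≠ 0 := by exact_mod_cast Nat.card_pos.ne'
  have h := hB.isoCount_eq h2 hu huu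
  rify at h
  field_simp
  linear_combination -h

theorem IsSymmNondeg.card_anisotropic_perp {u : V} (hu : u ≠ 0) :
    (Nat.card {v // ¬ B v v = 0 ∧ B u v = 0} : ℝ) =
      Nat.card V / Nat.card F - Nat.card {v // B v v = 0 ∧ B u v = 0} := by
  rw [← hB.card_perp hu, card_eq_card_and_add (fun v => B u v = 0) fun v => B v v = 0]
  simp only [and_comm]
  push_cast
  ring

include h2 in
/-- The number of orthogonal pairs of an anisotropic and an isotropic vector. -/
theorem IsSymmNondeg.sum_card_isotropic_perp :
    (∑ v : V, if B v v = 0 then 0 else (Nat.card {u // B u u = 0 ∧ B v u = 0} : ℝ)) =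
      Nat.card V - isoCount B + (isoCount B - 1) *
        (2 * (Nat.card V / Nat.card F) - isoCount B - Nat.card V / Nat.card F ^ 2) := by
  rw [← sum_isotropic (B := B)]
  have h1 : ∀ v : V, (if B v v = 0 then 0 else (Nat.card {u // B u u = 0 ∧ B v u = 0} : ℝ)) =
      ∑ u : V, if B u u = 0 ∧ ¬ B v v = 0 ∧ B u v = 0 then 1 else 0 := by
    intro v
    rw [natCard_subtype_eq_sum]
    simp only [hB.symm v]
    split_ifs with h <;> simp [h]
  simp only [h1]
  rw [Finset.sum_comm]
  refine Finset.sum_congr rfl fun u _ => ?_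
  by_cases huu : B u u = 0
  · simp only [huu, true_and, if_true]
    rw [← natCard_subtype_eq_sum]
    split_ifs with hu
    · subst hu
      simp only [map_zero, LinearMap.zero_apply, and_true]
      have h := card_eq_card_add V fun v => B v v = 0
      rw [h, isoCount]
      push_cast
      ring
    · rw [hB.card_anisotropic_perp hu, hB.card_isotropic_perp h2 hu huu]
      ring
  · simp [huu]

theorem IsSymmNondeg.card_gram_ne_zero (v : V) :
    (Nat.card {w // B v v * B w w - B v w * B w v ≠ 0} : ℝ) =
      (if B v v = 0 then if v = 0 then 0 else (Nat.card V - Nat.card V / Nat.card F : ℝ) else 0) +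
      Nat.card F * ((if B v v = 0 then 0 else 1 : ℝ) * (Nat.card V / Nat.card F) -
        if B v v = 0 then 0 else (Nat.card {u // B u u = 0 ∧ B v u = 0} : ℝ)) := by
  by_cases hv : v = 0
  · simp [hv]
  by_cases hvv : B v v = 0
  · have h := card_eq_card_add V fun w => B v w = 0
    simp only [hvv, hv, if_true, if_false, zero_mul, zero_sub, hB.symm _ v, sub_zero, mul_zero,
      add_zero, ← hB.card_perp hv, neg_ne_zero, mul_self_ne_zero]
    rw [h]
    push_cast
    ring
  · have h : Nat.card F * Nat.card {u // ¬ B u u = 0 ∧ B v u = 0} =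
        Nat.card {w // B v v * B w w - B v w * B w v ≠ 0} := by
      refine card_mul_card_of_translate v (fun w => B v w / B v v) (fun x t hx => ?_)
        (fun x t hx => ?_) (fun y hy => ⟨fun h0 => hy ?_, ?_⟩)
      · simp only [map_add, map_smul, LinearMap.add_apply, LinearMap.smul_apply, smul_eq_mul,
          hx.2, hB.symm x v]
        convert mul_ne_zero hvv hx.1 using 1
        ring
      · simp [hx.2, hvv]
      · simp only [map_sub, map_smul, LinearMap.sub_apply, LinearMap.smul_apply, smul_eq_mul,
          hB.symm y v] at h0 ⊢
        field_simp at h0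
        linear_combination h0
      · simp [hvv]
    rw [← h]
    push_cast
    rw [hB.card_anisotropic_perp hv]
    simp [hvv]

include h2 in
theorem IsSymmNondeg.tupleCount_two :
    (tupleCount B 2 : ℝ) =
      (isoCount B - 1) * (Nat.card V - Nat.card V / Nat.card F) +
      Nat.card F * ((Nat.card V - isoCount B) * (Nat.card V / Nat.card F) -
        (Nat.card V - isoCount B + (isoCount B - 1) *
          (2 * (Nat.card V / Nat.card F) - isoCount B - Nat.card V / Nat.card F ^ 2))) := by
  have h1 : tupleCount B 2 =
      ∑ v : V, Nat.card {w // B v v * B w w - B v w * B w v ≠ 0} := by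
    rw [← Nat.card_sigma]
    refine Nat.card_congr (((finTwoArrowEquiv V).subtypeEquiv
      (q := fun p => B p.1 p.1 * B p.2 p.2 - B p.1 p.2 * B p.2 p.1 ≠ 0) fun s => ?_).trans ?_)
    · rw [Matrix.det_fin_two]
      rfl
    · exact Equiv.subtypeProdEquivSigmaSubtype
        fun v w => B v v * B w w - B v w * B w v ≠ 0
  have h3 : (∑ v : V, if B v v = 0 then 0 else 1 : ℝ) = Nat.card V - isoCount B := by
    have h := card_eq_card_add V fun v => B v v = 0
    rw [h, isoCount]
    push_cast
    rw [natCard_subtype_eq_sum fun v => ¬ B v v = 0]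
    simp
  rw [h1]
  push_cast
  simp only [hB.card_gram_ne_zero, Finset.sum_add_distrib, ← Finset.mul_sum,
    Finset.sum_sub_distrib, ← Finset.sum_mul]
  rw [sum_isotropic, h3, hB.sum_card_isotropic_perp h2]
  ring

end TupleCount

section TupleCountFormula

variable {F : Type} [Field F] [Fintype F] {V : Type} [AddCommGroup V] [Module F V]
  [FiniteDimensional F V] {B : LinearMap.BilinForm F V} (hB : IsSymmNondeg B)
  (hF : Odd (Fintype.card F)) (h2 : (2 : F) ≠ 0) {m : ℕ}

include hB hF h2

theorem IsSymmNondeg.tupleCount_two_odd (hn : Module.finrank F V = 2 * m + 1) :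
    (tupleCount B 2 : ℝ) = (Nat.card F : ℝ) ^ (2 * m) * ((Nat.card F : ℝ) ^ (2 * m) - 1) *
      ((Nat.card F : ℝ) ^ 2 - Nat.card F) := by
  have := Module.finite_of_finite F (M := V)
  have := Fintype.ofFinite V
  have hq : (Nat.card F : ℝ) ≠ 0 := by exact_mod_cast Nat.card_pos.ne'
  rw [hB.tupleCount_two h2, hB.isoCount_odd hF h2 hn, Module.natCard_eq_pow_finrank (K := F) (V := V), hn]
  push_cast
  field_simp
  ring

theorem IsSymmNondeg.tupleCount_two_even (hn : Module.finrank F V = 2 * m) :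
    (tupleCount B 2 : ℝ) = ((Nat.card F : ℝ) ^ (2 * m) - 1) *
      ((Nat.card F : ℝ) ^ (2 * m) - (Nat.card F : ℝ) ^ (2 * m) / Nat.card F) := by
  have := Module.finite_of_finite F (M := V)
  have := Fintype.ofFinite V
  have hq : (Nat.card F : ℝ) ≠ 0 := by exact_mod_cast Nat.card_pos.ne'
  obtain ⟨s, hs, h⟩ : ∃ s : ℝ, s ^ 2 = 1 ∧ (Nat.card F : ℝ) * isoCount B =
      (Nat.card F : ℝ) ^ (2 * m) + s * ((Nat.card F : ℝ) ^ (m + 1) - (Nat.card F : ℝ) ^ m) := by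
    have h := congrArg (Int.cast : ℤ → ℝ) (hB.isoCount_even hF h2 hn)
    push_cast at h
    exact ⟨_, by split_ifs <;> norm_num, h⟩
  have h' : (isoCount B : ℝ) = (Nat.card F : ℝ) ^ (2 * m) / Nat.card F +
      s * ((Nat.card F : ℝ) ^ m - (Nat.card F : ℝ) ^ m / Nat.card F) := by
    field_simp
    linear_combination h
  rw [hB.tupleCount_two h2, h', Module.natCard_eq_pow_finrank (K := F) (V := V), hn]
  push_cast
  rw [show (Nat.card F : ℝ) ^ (2 * m) = ((Nat.card F : ℝ) ^ m) ^ 2 by ring]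
  generalize (Nat.card F : ℝ) ^ m = x
  obtain ⟨y, rfl⟩ : ∃ y, x = Nat.card F * y := ⟨x / Nat.card F, by field_simp⟩
  rw [show (Nat.card F * y) ^ 2 / Nat.card F = Nat.card F * y ^ 2 by field_simp,
    show (Nat.card F * y) ^ 2 / (Nat.card F : ℝ) ^ 2 = y ^ 2 by field_simp,
    show Nat.card F * y / Nat.card F = y by field_simp]
  linear_combination Nat.card F * (Nat.card F * y - y) ^ 2 * hs

theorem IsSymmNondeg.tupleCount_one_odd (hn : Module.finrank F V = 2 * m + 1) :
    (tupleCount B 1 : ℝ) = (Nat.card F : ℝ) ^ (2 * m) * (Nat.card F - 1) := by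
  have := Module.finite_of_finite F (M := V)
  rw [tupleCount_one, hB.isoCount_odd hF h2 hn, Module.natCard_eq_pow_finrank (K := F) (V := V), hn]
  push_cast
  ring

theorem IsSymmNondeg.tupleCount_one_even (hn : Module.finrank F V = 2 * (m + 1)) :
    (tupleCount B 1 : ℝ) = (Nat.card F - 1) * (Nat.card F : ℝ) ^ m *
      ((Nat.card F : ℝ) ^ (m + 1) - if HasHyperbolicSystem B (m + 1) then 1 else -1) := by
  have := Module.finite_of_finite F (M := V)
  have hq : (Nat.card F : ℝ) ≠ 0 := by exact_mod_cast Nat.card_pos.ne'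
  have h := congrArg (Int.cast : ℤ → ℝ) (hB.isoCount_even hF h2 hn)
  push_cast at h
  rw [tupleCount_one, Module.natCard_eq_pow_finrank (K := F) (V := V), hn]
  push_cast
  refine mul_left_cancel₀ hq ?_
  linear_combination -h

end TupleCountFormula

theorem gbinom_zero_right (m : ℕ) (Q : ℝ) : gbinom m 0 Q = 1 := by simp [gbinom]

theorem gbinom_succ_succ {Q : ℝ} (hQ : 1 < Q) {m l : ℕ} (h : l ≤ m) :
    gbinom (m + 1) (l + 1) Q * (Q ^ (l + 1) - 1) = gbinom m l Q * (Q ^ (m + 1) - 1) := by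
  have hne : Q ^ (l + 1) - 1 ≠ 0 := sub_ne_zero.mpr (one_lt_pow₀ hQ l.succ_ne_zero).ne'
  rw [gbinom, Finset.prod_Icc_succ_top (by omega), Nat.add_sub_add_right, mul_assoc,
    div_mul_cancel₀ _ hne, show m - l + (l + 1) = m + 1 by omega, gbinom]

section SubspaceCount

variable {F : Type} [Field F]

theorem IsSymmNondeg.nondegCount_zero {V : Type} [AddCommGroup V] [Module F V]
    [FiniteDimensional F V] {B : LinearMap.BilinForm F V} (hB : IsSymmNondeg B) :
    nondegCount B 0 = 1 := by
  rw [nondegCount, Nat.card_eq_one_iff_unique]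
  refine ⟨⟨fun W W' => Subtype.ext ?_⟩, ⟨⊥, ?_, finrank_bot F V⟩⟩
  · rw [Submodule.finrank_eq_zero.mp W.2.2, Submodule.finrank_eq_zero.mp W'.2.2]
  · exact (hB.formOn_iff ⊥).mpr fun x hx _ => hx

variable [Fintype F] (hF : Odd (Fintype.card F)) (h2 : (2 : F) ≠ 0)

include hF h2

theorem nondegCount_even (k d : ℕ) : ∀ {V : Type} [AddCommGroup V] [Module F V]
    [FiniteDimensional F V] {B : LinearMap.BilinForm F V}, IsSymmNondeg B →
    Module.finrank F V = 2 * (k + d) → (nondegCount B (2 * k) : ℝ) =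
      (Nat.card F : ℝ) ^ (2 * k * d) * gbinom (k + d) k ((Nat.card F : ℝ) ^ 2) := by
  have hq : (1 : ℝ) < Nat.card F := by exact_mod_cast Finite.one_lt_card
  induction k with
  | zero =>
    intro V _ _ _ B hB hn
    simp [hB.nondegCount_zero, gbinom_zero_right]
  | succ k ih =>
    intro V _ _ _ B hB hn
    have key := hB.nondegCount_mul (k := 2 * k) (j := 2)
      (fun W hW hd => hW.tupleCount_two_even hF h2 (m := k + 1) hd)
      (fun W hW hd => ih hW (by omega))
    rw [hB.tupleCount_two_even hF h2 hn] at key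
    have hg := gbinom_succ_succ (one_lt_pow₀ hq two_ne_zero) (Nat.le_add_right k d)
    have h0 : (Nat.card F : ℝ) ≠ 0 := by positivity
    have h1 : (Nat.card F : ℝ) - 1 ≠ 0 := by linarith
    have h3 : (Nat.card F : ℝ) ^ (2 * (k + 1)) - 1 ≠ 0 :=
      sub_ne_zero.mpr (one_lt_pow₀ hq (by omega)).ne'
    rw [← pow_mul, ← pow_mul] at hg
    have h4 : (Nat.card F : ℝ) ^ (2 * (k + 1)) - (Nat.card F : ℝ) ^ (2 * (k + 1)) / Nat.card F
        = (Nat.card F : ℝ) ^ (2 * k + 1) * (Nat.card F - 1) := by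
      field_simp
      ring
    have h5 : (Nat.card F : ℝ) ^ (2 * (k + 1 + d)) -
        (Nat.card F : ℝ) ^ (2 * (k + 1 + d)) / Nat.card F
        = (Nat.card F : ℝ) ^ (2 * d) * (Nat.card F : ℝ) ^ (2 * k + 1) * (Nat.card F - 1) := by
      field_simp
      ring
    rw [h4, h5] at key
    refine mul_right_cancel₀ (mul_ne_zero h3 (mul_ne_zero (pow_ne_zero (2 * k + 1) h0) h1)) ?_
    rw [show k + 1 + d = k + d + 1 by ring] at key ⊢
    linear_combination key - (Nat.card F : ℝ) ^ (2 * (k + 1) * d) *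
      ((Nat.card F : ℝ) ^ (2 * k + 1) * (Nat.card F - 1)) * hg

theorem nondegCount_even_odd (k d : ℕ) : ∀ {V : Type} [AddCommGroup V] [Module F V]
    [FiniteDimensional F V] {B : LinearMap.BilinForm F V}, IsSymmNondeg B →
    Module.finrank F V = 2 * (k + d) + 1 → (nondegCount B (2 * k) : ℝ) =
      (Nat.card F : ℝ) ^ (2 * k * (d + 1)) * gbinom (k + d) k ((Nat.card F : ℝ) ^ 2) := by
  have hq : (1 : ℝ) < Nat.card F := by exact_mod_cast Finite.one_lt_card
  induction k with
  | zero =>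
    intro V _ _ _ B hB hn
    simp [hB.nondegCount_zero, gbinom_zero_right]
  | succ k ih =>
    intro V _ _ _ B hB hn
    have key := hB.nondegCount_mul (k := 2 * k) (j := 2)
      (fun W hW hd => hW.tupleCount_two_even hF h2 (m := k + 1) hd)
      (fun W hW hd => ih hW (by omega))
    rw [hB.tupleCount_two_odd hF h2 hn] at key
    have hg := gbinom_succ_succ (one_lt_pow₀ hq two_ne_zero) (Nat.le_add_right k d)
    have h0 : (Nat.card F : ℝ) ≠ 0 := by positivity
    have h1 : (Nat.card F : ℝ) - 1 ≠ 0 := by linarith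
    have h3 : (Nat.card F : ℝ) ^ (2 * (k + 1)) - 1 ≠ 0 :=
      sub_ne_zero.mpr (one_lt_pow₀ hq (by omega)).ne'
    rw [← pow_mul, ← pow_mul] at hg
    have h4 : (Nat.card F : ℝ) ^ (2 * (k + 1)) - (Nat.card F : ℝ) ^ (2 * (k + 1)) / Nat.card F
        = (Nat.card F : ℝ) ^ (2 * k + 1) * (Nat.card F - 1) := by
      field_simp
      ring
    rw [h4] at key
    refine mul_right_cancel₀ (mul_ne_zero h3 (mul_ne_zero (pow_ne_zero (2 * k + 1) h0) h1)) ?_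
    rw [show k + 1 + d = k + d + 1 by ring] at key ⊢
    linear_combination key - (Nat.card F : ℝ) ^ (2 * (k + 1) * (d + 1)) *
      ((Nat.card F : ℝ) ^ (2 * k + 1) * (Nat.card F - 1)) * hg

theorem IsSymmNondeg.nondegCount_odd {k d : ℕ} {V : Type} [AddCommGroup V] [Module F V]
    [FiniteDimensional F V] {B : LinearMap.BilinForm F V} (hB : IsSymmNondeg B)
    (hn : Module.finrank F V = 2 * (k + d + 1)) : (nondegCount B (2 * k + 1) : ℝ) =
      (Nat.card F : ℝ) ^ (k + d) * ((Nat.card F : ℝ) ^ (k + d + 1) -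
        if HasHyperbolicSystem B (k + d + 1) then 1 else -1) *
      ((Nat.card F : ℝ) ^ (2 * k * d) * gbinom (k + d) k ((Nat.card F : ℝ) ^ 2)) := by
  have hq : (1 : ℝ) < Nat.card F := by exact_mod_cast Finite.one_lt_card
  have h0 : (Nat.card F : ℝ) ≠ 0 := by positivity
  have h1 : (Nat.card F : ℝ) - 1 ≠ 0 := by linarith
  have key := hB.nondegCount_mul (k := 2 * k) (j := 1)
    (fun W hW hd => hW.tupleCount_one_odd hF h2 hd)
    (fun W hW hd => nondegCount_even_odd hF h2 k d hW (by omega))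
  rw [hB.tupleCount_one_even hF h2 hn] at key
  refine mul_right_cancel₀ (mul_ne_zero (pow_ne_zero (2 * k) h0) h1) ?_
  rw [key]
  ring

end SubspaceCount

section Involutions

variable {F : Type} [Field F] {V : Type} [AddCommGroup V] [Module F V] [FiniteDimensional F V]
  {B : LinearMap.BilinForm F V}

omit [FiniteDimensional F V] in
theorem IsSymmNondeg.eq_of_eigenSub_neg_one_eq (h2 : (2 : F) ≠ 0) (hB : IsSymmNondeg B)
    {s t : V ≃ₗ[F] V} (hs : s * s = 1) (ht : t * t = 1) (hsB : s ∈ isomGroup B)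
    (htB : t ∈ isomGroup B) (h : _root_.eigenSub s (-1 : F) = _root_.eigenSub t (-1)) : s = t := by
  have hW := (hB.formOn_iff _).mp (hB.eigenSub h2 ht htB).2
  ext x
  obtain ⟨u, hu, v, hv, rfl⟩ := exists_eigenSub_add h2 hs x
  have hut : u ∈ _root_.eigenSub t (1 : F) := by
    obtain ⟨u', hu', v', hv', rfl⟩ := exists_eigenSub_add h2 ht u
    suffices v' = 0 by rwa [this, add_zero]
    refine hW v' hv' fun w hw => ?_
    have h1 := eigenSub_orthogonal h2 hsB hu (h ▸ hw)
    rwa [map_add, LinearMap.add_apply, eigenSub_orthogonal h2 htB hu' hw, zero_add] at h1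
  rw [map_add, map_add, mem_eigenSub.mp hu, mem_eigenSub.mp hut, mem_eigenSub.mp hv,
    mem_eigenSub.mp (h ▸ hv : v ∈ _root_.eigenSub t (-1 : F))]

theorem IsSymmNondeg.exists_eigenSub_neg_one_eq (h2 : (2 : F) ≠ 0) (hB : IsSymmNondeg B)
    {W : Submodule F V} (hW : IsSymmNondeg (formOn B W)) :
    ∃ t ∈ isomGroup B, t * t = 1 ∧ _root_.eigenSub t (-1 : F) = W := by
  have hc := hB.isCompl_orthogonal hW
  let p : V →ₗ[F] V := W.projection _ hc
  have hpW : ∀ x, p x ∈ W := fun x => Submodule.projection_apply_mem hc x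
  have hp : ∀ x ∈ W, p x = x := fun x hx => Submodule.projection_apply_of_mem_left hc hx
  have hp' : ∀ x, ∀ w ∈ W, B w (x - p x) = 0 := fun x w hw => by
    have : p (x - p x) = 0 := by rw [map_sub, hp _ (hpW x), sub_self]
    exact (Submodule.projection_apply_eq_zero_iff hc).mp this w hw
  let r : V →ₗ[F] V := LinearMap.id - (2 : F) • p
  have hr : ∀ x, r x = x - (2 : F) • p x := fun x => rfl
  have hrr : Function.Involutive r := fun x => by
    rw [hr, hr, map_sub, map_smul, hp _ (hpW x)]
    module
  refine ⟨LinearEquiv.ofInvolutive r hrr, fun x y => ?_, LinearEquiv.ext hrr, ?_⟩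
  · change B (r x) (r y) = B x y
    have h1 := hp' y (p x) (hpW x)
    have h3 := hp' x (p y) (hpW y)
    rw [hB.symm] at h3
    simp only [hr, map_sub, map_smul, LinearMap.sub_apply, LinearMap.smul_apply, smul_eq_mul]
      at h1 h3 ⊢
    linear_combination (-2) * h1 - 2 * h3
  · ext x
    rw [mem_eigenSub]
    change r x = _ ↔ _
    rw [hr, sub_eq_iff_eq_add, neg_one_smul, ← sub_eq_iff_eq_add', sub_neg_eq_add, ← two_smul F x]
    exact ⟨fun h => by rw [smul_right_injective V h2 h]; exact hpW x, fun h => by rw [hp x h]⟩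

theorem IsSymmNondeg.card_involutions [Finite F] (h2 : (2 : F) ≠ 0) (hB : IsSymmNondeg B) :
    Nat.card {g : isomGroup B // g * g = 1} =
      ∑ k ∈ Finset.range (Module.finrank F V + 1), nondegCount B k := by
  have := Module.finite_of_finite F (M := V)
  have h1 : Nat.card {g : isomGroup B // g * g = 1} =
      Nat.card {W : Submodule F V // IsSymmNondeg (formOn B W)} := by
    have hg : ∀ g : {g : isomGroup B // g * g = 1}, (g.1 : V ≃ₗ[F] V) * g.1 = 1 := fun g =>
      congrArg Subtype.val g.2
    refine Nat.card_congr (Equiv.ofBijective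
      (fun g => ⟨_root_.eigenSub (g.1 : V ≃ₗ[F] V) (-1), (hB.eigenSub h2 (hg g) g.1.2).2⟩)
      ⟨fun s t h => ?_, fun W => ?_⟩)
    · exact Subtype.ext (Subtype.ext (hB.eq_of_eigenSub_neg_one_eq h2 (hg s) (hg t) s.1.2 t.1.2
        (congrArg Subtype.val h)))
    · obtain ⟨t, ht, htt, h⟩ := hB.exists_eigenSub_neg_one_eq h2 W.2
      exact ⟨⟨⟨t, ht⟩, Subtype.ext htt⟩, Subtype.ext h⟩
  simp only [h1, Finset.sum_range, nondegCount]
  rw [← Nat.card_sigma]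
  exact Nat.card_congr
    { toFun := fun W => ⟨⟨Module.finrank F W.1, Nat.lt_succ_of_le W.1.finrank_le⟩, W.1, W.2, rfl⟩
      invFun := fun x => ⟨x.2.1, x.2.2.1⟩
      left_inv := fun _ => rfl
      right_inv := by
        rintro ⟨k, W, hW, h⟩
        obtain rfl : k = ⟨Module.finrank F W, Nat.lt_succ_of_le W.finrank_le⟩ := Fin.ext h.symm
        rfl }

theorem sum_range_two_mul_add_one {M : Type*} [AddCommMonoid M] (f : ℕ → M) (m : ℕ) :
    ∑ k ∈ Finset.range (2 * m + 1), f k =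
      ∑ k ∈ Finset.range (m + 1), f (2 * k) + ∑ k ∈ Finset.range m, f (2 * k + 1) := by
  induction m with
  | zero => simp
  | succ m ih =>
    rw [show 2 * (m + 1) + 1 = 2 * m + 1 + 1 + 1 by ring, Finset.sum_range_succ,
      Finset.sum_range_succ, ih, Finset.sum_range_succ _ (m + 1), Finset.sum_range_succ _ m]
    rw [Finset.sum_range_succ _ m, show 2 * (m + 1) = 2 * m + 1 + 1 by ring]
    abel

theorem IsSymmNondeg.card_involutions_eq [Fintype F] (hF : Odd (Fintype.card F))
    (h2 : (2 : F) ≠ 0) (hB : IsSymmNondeg B) {m : ℕ} (hn : Module.finrank F V = 2 * (m + 1)) :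
    (Nat.card {g : isomGroup B // g * g = 1} : ℝ) =
      (∑ k ∈ Finset.range (m + 2), (Nat.card F : ℝ) ^ (2 * k * (m + 1 - k)) *
        gbinom (m + 1) k ((Nat.card F : ℝ) ^ 2)) +
      (Nat.card F : ℝ) ^ m * ((Nat.card F : ℝ) ^ (m + 1) -
        if HasHyperbolicSystem B (m + 1) then 1 else -1) *
      ∑ k ∈ Finset.range (m + 1),
        (Nat.card F : ℝ) ^ (2 * k * (m - k)) * gbinom m k ((Nat.card F : ℝ) ^ 2) := by
  rw [hB.card_involutions h2, hn, sum_range_two_mul_add_one, Nat.cast_add, Nat.cast_sum,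
    Nat.cast_sum, Finset.mul_sum]
  congr 1
  · refine Finset.sum_congr rfl fun k hk => ?_
    obtain ⟨d, hd⟩ := Nat.exists_eq_add_of_le (Nat.lt_succ_iff.mp (Finset.mem_range.mp hk))
    rw [hd] at hn ⊢
    rw [nondegCount_even hF h2 k d hB hn, Nat.add_sub_cancel_left]
  · refine Finset.sum_congr rfl fun k hk => ?_
    obtain ⟨d, rfl⟩ := Nat.exists_eq_add_of_le (Nat.lt_succ_iff.mp (Finset.mem_range.mp hk))
    rw [hB.nondegCount_odd hF h2 hn, Nat.add_sub_cancel_left]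

end Involutions

section Transport

variable {F : Type} [Field F] {N : Type} [Fintype N]

theorem isSymmNondeg_toBilin' [DecidableEq N] {J : Matrix N N F} (hJ : IsUnit J) (hs : Jᵀ = J) :
    IsSymmNondeg (Matrix.toBilin' J) := by
  refine ⟨fun x y => ?_, fun x hx => ?_⟩
  · rw [Matrix.toBilin'_apply', Matrix.toBilin'_apply', dotProduct_mulVec, ← mulVec_transpose, hs,
      dotProduct_comm]
  · have h : J *ᵥ x = 0 := by
      refine dotProduct_eq_zero _ fun y => ?_
      have := hx y
      rwa [Matrix.toBilin'_apply', dotProduct_mulVec, ← mulVec_transpose, hs] at this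
    exact Matrix.eq_zero_of_mulVec_eq_zero (((Matrix.isUnit_iff_isUnit_det J).mp hJ).ne_zero) h

/-- Invertible matrices as linear automorphisms of the space of column vectors. -/
def glEquiv (F N : Type) [Field F] [Fintype N] [DecidableEq N] :
    GL N F ≃* ((N → F) ≃ₗ[F] (N → F)) :=
  Matrix.GeneralLinearGroup.toLin.trans (LinearMap.GeneralLinearGroup.generalLinearEquiv F (N → F))

theorem glEquiv_apply [DecidableEq N] (g : GL N F) (x : N → F) :
    glEquiv F N g x = (g : Matrix N N F) *ᵥ x := rfl

theorem toBilin'_mulVec_mulVec [DecidableEq N] (J g : Matrix N N F) (x y : N → F) :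
    Matrix.toBilin' J (g *ᵥ x) (g *ᵥ y) = Matrix.toBilin' (gᵀ * J * g) x y := by
  rw [Matrix.toBilin'_apply', Matrix.toBilin'_apply', ← mulVec_mulVec, ← mulVec_mulVec,
    dotProduct_mulVec x, vecMul_transpose]

theorem mem_fixGroup_iff_glEquiv_mem [DecidableEq N] {J : Matrix N N F} {g : GL N F} :
    g ∈ fixGroup J ↔ glEquiv F N g ∈ isomGroup (Matrix.toBilin' J) := by
  simp only [isomGroup_mem_iff, glEquiv_apply, toBilin'_mulVec_mulVec]
  refine ⟨fun h x y => congrArg (fun M => Matrix.toBilin' M x y) h, fun h => ?_⟩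
  exact Matrix.toBilin'.injective (LinearMap.ext₂ h)

/-- The matrix group preserving `J` is the isometry group of the bilinear form of `J`. -/
def fixGroupEquiv [DecidableEq N] (J : Matrix N N F) :
    fixGroup J ≃* isomGroup (Matrix.toBilin' J) :=
  ((glEquiv F N).subgroupMap (fixGroup J)).trans <| MulEquiv.subgroupCongr <| by
    ext t
    obtain ⟨g, rfl⟩ := (glEquiv F N).surjective t
    rw [← mem_fixGroup_iff_glEquiv_mem]
    exact Subgroup.mem_map_iff_mem (glEquiv F N).injective

theorem hasHyperbolicSystem_toBilin'_iff {m : ℕ} {J : Matrix (Fin m ⊕ Fin m) (Fin m ⊕ Fin m) F}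
    (hJ : IsUnit J) (hs : Jᵀ = J) : HasHyperbolicSystem (Matrix.toBilin' J) m ↔ IsSplit J := by
  have hB := isSymmNondeg_toBilin' hJ hs
  have hP : ∀ (P : Matrix (Fin m ⊕ Fin m) (Fin m ⊕ Fin m) F) i j,
      (Pᵀ * J * P) i j = Matrix.toBilin' J (Pᵀ i) (Pᵀ j) := fun P i j => by
    rw [Matrix.mul_mul_apply, Matrix.toBilin'_apply']
  constructor
  · rintro ⟨e, f, hee, hff, hef⟩
    let P : Matrix (Fin m ⊕ Fin m) (Fin m ⊕ Fin m) F := (Matrix.of (Sum.elim e f))ᵀ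
    have hPJ : Pᵀ * J * P = Jsplit m F := by
      ext i j
      rw [hP]
      rcases i with i | i <;> rcases j with j | j
      · exact (hee i j)
      · exact (hef i j).trans (Matrix.one_apply ..).symm
      · refine (hB.symm _ _).trans ((hef j i).trans ?_)
        rw [Jsplit, Matrix.fromBlocks_apply₂₁, Matrix.one_apply]
        simp only [eq_comm]
      · exact (hff i j)
    refine ⟨Matrix.GeneralLinearGroup.mkOfDetNeZero P fun h0 => ?_, hPJ⟩
    have h1 : Jsplit m F * Jsplit m F = 1 := by
      rw [Jsplit, Matrix.fromBlocks_multiply]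
      simp
    have h3 := congrArg Matrix.det h1
    rw [Matrix.det_mul, ← hPJ, Matrix.det_mul, h0, mul_zero, zero_mul, Matrix.det_one] at h3
    exact zero_ne_one h3
  · rintro ⟨P, h⟩
    have hP' : ∀ i j, Matrix.toBilin' J ((P.val)ᵀ i) ((P.val)ᵀ j) = Jsplit m F i j :=
      fun i j => by rw [← hP, h]
    refine ⟨fun i => (P.val)ᵀ (Sum.inl i), fun i => (P.val)ᵀ (Sum.inr i),
      fun i j => ?_, fun i j => ?_, fun i j => ?_⟩
    · rw [hP', Jsplit, Matrix.fromBlocks_apply₁₁, Matrix.zero_apply]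
    · rw [hP', Jsplit, Matrix.fromBlocks_apply₂₂, Matrix.zero_apply]
    · rw [hP', Jsplit, Matrix.fromBlocks_apply₁₂, Matrix.one_apply]

end Transport

theorem stmt_12 (m : ℕ) (hm : 1 ≤ m) (q : ℕ) (hq : ∃ p r : ℕ, p.Prime ∧ Odd p ∧ 0 < r ∧ q = p ^ r)
    (F : Type) [Field F] [Fintype F] [DecidableEq F] (hF : Fintype.card F = q)
    (J : Matrix (Fin m ⊕ Fin m) (Fin m ⊕ Fin m) F) (hJunit : IsUnit J) (hJsymm : Jᵀ = J)
    (ε : ℝ) (hsplit : IsSplit J → ε = 1) (hnonsplit : ¬ IsSplit J → ε = -1)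
    (κ : Type) [Fintype κ] (S : κ → FDRep ℂ ↥(fixGroup J))
    (hsimple : ∀ i, Simple (S i))
    (hdistinct : ∀ i j : κ, Nonempty (S i ≅ S j) → i = j)
    (hcomplete : ∀ ρ : FDRep ℂ ↥(fixGroup J), Simple ρ → ∃ i, Nonempty (ρ ≅ S i)) :
    ∑ j : κ, (Module.finrank ℂ (S j) : ℝ)
      = (∑ k ∈ Finset.range (m + 1), (q : ℝ) ^ (2 * k * (m - k)) * gbinom m k ((q : ℝ) ^ 2))
        + (q : ℝ) ^ (m - 1) * ((q : ℝ) ^ m - ε) *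
          ∑ k ∈ Finset.range m,
            (q : ℝ) ^ (2 * k * (m - k - 1)) * gbinom (m - 1) k ((q : ℝ) ^ 2) := by
  have hFodd : Odd (Fintype.card F) := by
    obtain ⟨p, r, -, hp, -, rfl⟩ := hq
    exact hF ▸ hp.pow
  have h2 : (2 : F) ≠ 0 := Ring.two_ne_zero fun h =>
    (Nat.not_even_iff_odd.mpr hFodd) (Nat.even_iff.mpr (FiniteField.even_card_of_char_two h))
  have hB := isSymmNondeg_toBilin' hJunit hJsymm
  have := finite_isomGroup (Matrix.toBilin' J)
  let e := fixGroupEquiv J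
  have hreal : IsRealGroup (fixGroup J) :=
    IsRealGroup.of_surjective e.symm.toMonoidHom e.symm.surjective (hB.isRealGroup h2)
  have hno : NoSymplectic (fixGroup J) :=
    NoSymplectic.of_injective_of_card_le e.symm.toMonoidHom e.symm.injective
      (hB.noSymplectic h2) (hB.isRealGroup h2)
      ((Nat.card_congr e.toEquiv).le.trans (Nat.le_mul_of_pos_left _ two_pos))
  have hinv : Nat.card {g : fixGroup J // g * g = 1} =
      Nat.card {g : isomGroup (Matrix.toBilin' J) // g * g = 1} :=
    Nat.card_congr (e.toEquiv.subtypeEquiv fun g =>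
      (e.map_eq_one_iff.symm.trans (by rw [map_mul]; rfl)))
  rw [sum_finrank_eq_card_involutions hsimple hdistinct hcomplete hno hreal, hinv]
  obtain ⟨m, rfl⟩ := Nat.exists_eq_succ_of_ne_zero (Nat.one_le_iff_ne_zero.mp hm)
  have hε : ε = if HasHyperbolicSystem (Matrix.toBilin' J) (m + 1) then 1 else -1 := by
    split_ifs with h
    · exact hsplit ((hasHyperbolicSystem_toBilin'_iff hJunit hJsymm).mp h)
    · exact hnonsplit fun h' => h ((hasHyperbolicSystem_toBilin'_iff hJunit hJsymm).mpr h')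
  have hn : Module.finrank F ((Fin (m + 1) ⊕ Fin (m + 1)) → F) = 2 * (m + 1) := by
    rw [Module.finrank_fintype_fun_eq_card, Fintype.card_sum, Fintype.card_fin, two_mul]
  have key := hB.card_involutions_eq hFodd h2 hn
  rw [Nat.card_eq_fintype_card (α := F), hF, ← hε] at key
  rw [key]
  simp only [Nat.succ_eq_add_one, Nat.add_sub_cancel, Nat.sub_right_comm _ _ 1]

end
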